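/- arXiv:2408.06989 — 2 statements merged into one kernel-verified Lean document; each statement's English description precedes it below -/
import Mathlib

section
/- Let n ≥ 2 and let Ω ⊆ ℝⁿ be an open set. Then the following two conditions are equivalent: (i) (Moser–Trudinger inequality) there exists a constant C > 0 such that ∫_Ω exp_{n-2}[γₙ |u(x)|^{n/(n-1)}] dx ≤ C for every u ∈ C_c^∞(Ω) with (∫_Ω |∇u(x)|ⁿ dx)^{1/n} ≤ 1; (ii) (Poincaré inequality) there exists a constant C > 0 such that (∫_Ω |u(x)|ⁿ dx)^{1/n} ≤ C (∫_Ω |∇u(x)|ⁿ dx)^{1/n} for every u ∈ C_c^∞(Ω). -/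
open MeasureTheory Real

/-- Surface measure of the unit sphere `S^{n-1} ⊆ ℝⁿ`, i.e. `ω_{n-1} = n · vol(Bⁿ)`. -/
noncomputable def sphereArea (n : ℕ) : ℝ :=
  n * (volume (Metric.ball (0 : EuclideanSpace ℝ (Fin n)) 1)).toReal

/-- The sharp Moser-Trudinger constant `γₙ = n ω_{n-1}^{1/(n-1)}`. -/
noncomputable def gammaMT (n : ℕ) : ℝ :=
  n * sphereArea n ^ ((1 : ℝ) / ((n : ℝ) - 1))

/-- `exp_m[t] = e^t − Σ_{k=0}^m t^k/k!`. -/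
noncomputable def expRem (m : ℕ) (t : ℝ) : ℝ :=
  Real.exp t - ∑ k ∈ Finset.range (m + 1), t ^ k / (Nat.factorial k)

section helpers
open Set ENNReal



lemma sphereArea_pos (n : ℕ) (hn : 2 ≤ n) : 0 < sphereArea n := by
  unfold sphereArea
  have h : 0 < (volume (Metric.ball (0 : EuclideanSpace ℝ (Fin n)) 1)).toReal :=
    ENNReal.toReal_pos (Metric.measure_ball_pos volume _ one_pos).ne' measure_ball_lt_top.ne
  have : (0:ℝ) < n := by positivity
  positivity

lemma toSphere_univ_eq (n : ℕ) :
    (volume : Measure (EuclideanSpace ℝ (Fin n))).toSphere univ = ENNReal.ofReal (sphereArea n) := by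
  rw [Measure.toSphere_apply_univ, sphereArea, ENNReal.ofReal_mul (by positivity),
    ENNReal.ofReal_toReal measure_ball_lt_top.ne]
  simp

lemma volume_ball_eq (n : ℕ) (hn : 2 ≤ n) (x : EuclideanSpace ℝ (Fin n)) (r : ℝ) (hr : 0 ≤ r) :
    volume (Metric.ball x r) = ENNReal.ofReal (sphereArea n * r ^ n / n) := by
  have : Nonempty (Fin n) := ⟨⟨0, by omega⟩⟩
  rw [Measure.addHaar_ball _ _ hr, sphereArea]
  rw [show (n * (volume (Metric.ball (0 : EuclideanSpace ℝ (Fin n)) 1)).toReal) * r ^ n / n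
    = r ^ n * (volume (Metric.ball (0 : EuclideanSpace ℝ (Fin n)) 1)).toReal by
      have : (0:ℝ) < n := by positivity
      field_simp]
  rw [ENNReal.ofReal_mul (by positivity), ENNReal.ofReal_toReal measure_ball_lt_top.ne]
  simp

/-- polar coordinates for the lower Lebesgue integral -/
lemma lintegral_polar (n : ℕ) (hn : 2 ≤ n) (f : EuclideanSpace ℝ (Fin n) → ℝ≥0∞)
    (hf : Measurable f) :
    ∫⁻ x, f x = ∫⁻ θ : Metric.sphere (0 : EuclideanSpace ℝ (Fin n)) 1,
      (∫⁻ r in Ioi (0:ℝ), ENNReal.ofReal (r ^ (n - 1)) * f (r • (θ : EuclideanSpace ℝ (Fin n))))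
        ∂(volume : Measure (EuclideanSpace ℝ (Fin n))).toSphere := by
  have : Nonempty (Fin n) := ⟨⟨0, by omega⟩⟩
  have hd : Module.finrank ℝ (EuclideanSpace ℝ (Fin n)) = n := by simp
  set μ := (volume : Measure (EuclideanSpace ℝ (Fin n)))
  have h1 : ∫⁻ x, f x ∂μ = ∫⁻ x : ({(0 : EuclideanSpace ℝ (Fin n))}ᶜ : Set _), f x ∂(μ.comap (↑)) := by
    rw [lintegral_subtype_comap (measurableSet_singleton _).compl, restrict_compl_singleton]
  have h2 := μ.measurePreserving_homeomorphUnitSphereProd.lintegral_comp_emb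
        (Homeomorph.measurableEmbedding _)
        (fun p => f ((p.2 : ℝ) • (p.1 : EuclideanSpace ℝ (Fin n))))
  have h3 : ∀ x : ({(0 : EuclideanSpace ℝ (Fin n))}ᶜ : Set _),
      f (((homeomorphUnitSphereProd _ x).2 : ℝ) •
        ((homeomorphUnitSphereProd _ x).1 : EuclideanSpace ℝ (Fin n))) = f x := by
    intro x
    congr 1
    have : ‖(x : EuclideanSpace ℝ (Fin n))‖ ≠ 0 := by
      exact norm_ne_zero_iff.2 x.2
    simp [smul_smul, this]
  rw [h1]
  simp_rw [h3] at h2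
  rw [h2, lintegral_prod _ (by
    apply Measurable.aemeasurable
    apply hf.comp
    fun_prop)]
  apply lintegral_congr
  intro θ
  rw [hd, Measure.volumeIoiPow, lintegral_withDensity_eq_lintegral_mul _ (by fun_prop)
    (g := fun y : Ioi (0:ℝ) => f ((y : ℝ) • (θ : EuclideanSpace ℝ (Fin n)))) (by fun_prop)]
  simp only [Pi.mul_apply]
  rw [lintegral_subtype_comap measurableSet_Ioi
    (fun r : ℝ => ENNReal.ofReal (r ^ (n-1)) * f (r • (θ : EuclideanSpace ℝ (Fin n))))]

/-- the Riesz kernel -/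
noncomputable def rk (n : ℕ) (z : EuclideanSpace ℝ (Fin n)) : ℝ≥0∞ :=
  ENNReal.ofReal ((‖z‖ ^ (n - 1))⁻¹)

lemma rk_meas (n : ℕ) : Measurable (rk n) := by unfold rk; fun_prop

lemma rk_neg (n : ℕ) (z : EuclideanSpace ℝ (Fin n)) : rk n (-z) = rk n z := by simp [rk]

lemma lintegral_polar_rk (n : ℕ) (hn : 2 ≤ n) (f : EuclideanSpace ℝ (Fin n) → ℝ≥0∞)
    (hf : Measurable f) :
    ∫⁻ x, f x * rk n x = ∫⁻ θ : Metric.sphere (0 : EuclideanSpace ℝ (Fin n)) 1,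
      (∫⁻ r in Ioi (0:ℝ), f (r • (θ : EuclideanSpace ℝ (Fin n))))
        ∂(volume : Measure (EuclideanSpace ℝ (Fin n))).toSphere := by
  rw [lintegral_polar n hn (fun x => f x * rk n x) (hf.mul (rk_meas n))]
  apply lintegral_congr
  intro θ
  apply setLIntegral_congr_fun measurableSet_Ioi
  intro r hr
  have hr : 0 < r := hr
  have hθ : ‖(θ : EuclideanSpace ℝ (Fin n))‖ = 1 := by simp
  simp only [rk, norm_smul, hθ, mul_one, Real.norm_eq_abs, abs_of_pos hr]
  rw [mul_left_comm, ← ENNReal.ofReal_mul (by positivity), mul_inv_cancel₀ (by positivity)]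
  simp

/-- pointwise representation bound -/
lemma repr_bound (n : ℕ) (hn : 2 ≤ n) (v : EuclideanSpace ℝ (Fin n) → ℝ)
    (hv : ContDiff ℝ 1 v) (hc : HasCompactSupport v) (x : EuclideanSpace ℝ (Fin n)) :
    ENNReal.ofReal (sphereArea n) * ‖v x‖ₑ ≤ ∫⁻ y, ‖fderiv ℝ v y‖ₑ * rk n (x - y) := by
  have hcont : Continuous (fderiv ℝ v) := hv.continuous_fderiv one_ne_zero
  have e1 : ∫⁻ y, ‖fderiv ℝ v y‖ₑ * rk n (x - y) = ∫⁻ z, ‖fderiv ℝ v (x - z)‖ₑ * rk n z := by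
    rw [← lintegral_sub_left_eq_self (fun z => ‖fderiv ℝ v (x - z)‖ₑ * rk n z) x]
    simp
  rw [e1, lintegral_polar_rk n hn (fun z => ‖fderiv ℝ v (x - z)‖ₑ) (by fun_prop),
    ← toSphere_univ_eq, mul_comm, ← lintegral_const]
  apply lintegral_mono
  intro θ
  have hθ : ‖(θ : EuclideanSpace ℝ (Fin n))‖ = 1 := by simp
  set g : ℝ → ℝ := fun r => v (x + r • (θ : EuclideanSpace ℝ (Fin n))) with hg
  have hgd : ∀ r, HasDerivAt g (fderiv ℝ v (x + r • (θ : EuclideanSpace ℝ (Fin n))) θ) r := by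
    intro r
    have h1 : HasDerivAt (fun r : ℝ => x + r • (θ : EuclideanSpace ℝ (Fin n))) (θ : EuclideanSpace ℝ (Fin n)) r := by
      simpa using ((hasDerivAt_id r).smul_const (θ : EuclideanSpace ℝ (Fin n))).const_add x
    exact ((hv.differentiable one_ne_zero).differentiableAt.hasFDerivAt).comp_hasDerivAt r h1
  have hgc : ContDiff ℝ 1 g := hv.comp (by fun_prop)
  have hgs : HasCompactSupport g := by
    apply hc.comp_isClosedEmbedding
    have hi : Isometry (fun r : ℝ => x + r • (θ : EuclideanSpace ℝ (Fin n))) := by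
      apply Isometry.of_dist_eq
      intro a b
      simp [dist_eq_norm, ← sub_smul, norm_smul, hθ]
    exact hi.isClosedEmbedding
  have h0 := hgs.enorm_le_lintegral_Ici_deriv hgc 0
  have e2 : g 0 = v x := by simp [hg]
  rw [e2] at h0
  refine h0.trans ?_
  have e3 : ∫⁻ y in Iic (0:ℝ), ‖deriv g y‖ₑ = ∫⁻ y in Ioi (0:ℝ), ‖deriv g (-y)‖ₑ := by
    rw [restrict_Iio_eq_restrict_Iic.symm]
    have := (Measure.measurePreserving_neg (volume : Measure ℝ)).setLIntegral_comp_preimage_emb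
      (Homeomorph.neg ℝ).measurableEmbedding (fun y => ‖deriv g y‖ₑ) (Iio 0)
    rw [← this]
    simp
  rw [e3]
  apply lintegral_mono
  intro r
  simp only
  rw [(hgd (-r)).deriv]
  have : x + -r • (θ : EuclideanSpace ℝ (Fin n)) = x - r • (θ : EuclideanSpace ℝ (Fin n)) := by
    simp [sub_eq_add_neg]
  rw [this]
  refine (ContinuousLinearMap.le_opENorm _ _).trans ?_
  have : ‖(θ : EuclideanSpace ℝ (Fin n))‖ₑ = 1 := by
    rw [← ofReal_norm, hθ]; simp
  rw [this, mul_one]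

lemma near_int (n : ℕ) (hn : 2 ≤ n) (r : ℝ) (hr : 0 ≤ r) :
    ∫⁻ z in Metric.ball (0 : EuclideanSpace ℝ (Fin n)) r, rk n z ≤ ENNReal.ofReal (sphereArea n * r) := by
  have h1 : ∫⁻ z in Metric.ball (0 : EuclideanSpace ℝ (Fin n)) r, rk n z
      = ∫⁻ z, (Metric.ball (0 : EuclideanSpace ℝ (Fin n)) r).indicator 1 z * rk n z := by
    rw [← lintegral_indicator measurableSet_ball]
    congr 1; ext z; by_cases h : z ∈ Metric.ball (0 : EuclideanSpace ℝ (Fin n)) r <;> simp [indicator, h]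
  rw [h1, lintegral_polar_rk n hn _ (measurable_one.indicator measurableSet_ball),
    ENNReal.ofReal_mul (sphereArea_pos n hn).le, ← toSphere_univ_eq, mul_comm, ← lintegral_const]
  apply lintegral_mono
  intro θ
  have : ∀ ρ ∈ Ioi (0:ℝ), (Metric.ball (0 : EuclideanSpace ℝ (Fin n)) r).indicator
      (1 : EuclideanSpace ℝ (Fin n) → ℝ≥0∞) (ρ • (θ : EuclideanSpace ℝ (Fin n))) = (Ioo 0 r).indicator 1 ρ := by
    intro ρ hρ
    have hρ : 0 < ρ := hρ
    simp [indicator, norm_smul, abs_of_pos hρ, hρ]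
  beta_reduce
  rw [setLIntegral_congr_fun measurableSet_Ioi this, lintegral_indicator_one measurableSet_Ioo]
  refine (Measure.restrict_apply_le _ _).trans ?_
  simp

lemma far_int (n : ℕ) (hn : 2 ≤ n) (r R : ℝ) (hr : 0 < r) (hR : r ≤ R) :
    ∫⁻ z in Metric.ball (0 : EuclideanSpace ℝ (Fin n)) R \ Metric.ball 0 r,
      ENNReal.ofReal ((‖z‖ ^ n)⁻¹) ≤ ENNReal.ofReal (sphereArea n * Real.log (R / r)) := by
  set A := Metric.ball (0 : EuclideanSpace ℝ (Fin n)) R \ Metric.ball 0 r with hA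
  have hAm : MeasurableSet A := measurableSet_ball.diff measurableSet_ball
  have h1 : ∫⁻ z in A, ENNReal.ofReal ((‖z‖ ^ n)⁻¹)
      = ∫⁻ z, A.indicator (fun z => ENNReal.ofReal (‖z‖⁻¹)) z * rk n z := by
    rw [← lintegral_indicator hAm]
    congr 1; ext z; by_cases h : z ∈ A <;> simp [indicator, h]
    rw [rk, ← ENNReal.ofReal_mul (by positivity), ← mul_inv, ← pow_succ', Nat.sub_add_cancel (by omega)]
  rw [h1, lintegral_polar_rk n hn _ (Measurable.indicator (by fun_prop) hAm),
    ENNReal.ofReal_mul (sphereArea_pos n hn).le, ← toSphere_univ_eq, mul_comm, ← lintegral_const]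
  apply lintegral_mono
  intro θ
  have : ∀ ρ ∈ Ioi (0:ℝ), A.indicator
      (fun z => ENNReal.ofReal (‖z‖⁻¹)) (ρ • (θ : EuclideanSpace ℝ (Fin n))) =
        (Ico r R).indicator (fun ρ => ENNReal.ofReal ρ⁻¹) ρ := by
    intro ρ hρ
    have hρ : 0 < ρ := hρ
    simp [indicator, norm_smul, abs_of_pos hρ, hA, and_comm]
  beta_reduce
  rw [setLIntegral_congr_fun measurableSet_Ioi this]
  refine (setLIntegral_le_lintegral _ _).trans ?_
  rw [lintegral_indicator measurableSet_Ico, restrict_Ico_eq_restrict_Ioc,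
    ← integral_inv_of_pos hr (hr.trans_le hR), intervalIntegral.integral_of_le hR,
    ofReal_integral_eq_lintegral_ofReal]
  · have := (intervalIntegral.intervalIntegrable_inv (μ := volume) (a := r) (b := R) (f := id) (fun x hx => ?_) continuousOn_id)
    · exact this.1
    · rw [uIcc_of_le hR] at hx
      exact (hr.trans_le hx.1).ne'
  · filter_upwards [ae_restrict_mem measurableSet_Ioc] with y hy
    exact inv_nonneg.2 (hr.trans hy.1).le

/-- conjugate exponent -/
noncomputable def pc (n : ℕ) : ℝ := (n : ℝ) / ((n : ℝ) - 1)

lemma pc_conj (n : ℕ) (hn : 2 ≤ n) : (pc n).HolderConjugate n := by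
  have h : (2:ℝ) ≤ n := by exact_mod_cast hn
  have : (n:ℝ) - 1 ≠ 0 := by linarith
  refine (Real.holderConjugate_iff).2 ⟨?_, ?_⟩
  · unfold pc; rw [one_lt_div (by linarith)]; linarith
  · unfold pc; field_simp; ring

lemma pc_gt (n : ℕ) (hn : 2 ≤ n) : 1 < pc n := (pc_conj n hn).lt

lemma pc_sub (n : ℕ) (hn : 2 ≤ n) : pc n - 1 = 1 / ((n:ℝ) - 1) := by
  have h : (2:ℝ) ≤ n := by exact_mod_cast hn
  have : (n:ℝ) - 1 ≠ 0 := by linarith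
  unfold pc; field_simp; ring

lemma pc_div (n : ℕ) (hn : 2 ≤ n) : pc n / n = 1 / ((n:ℝ) - 1) := by
  have h : (2:ℝ) ≤ n := by exact_mod_cast hn
  have : (n:ℝ) - 1 ≠ 0 := by linarith
  unfold pc; field_simp

lemma pc_mul (n : ℕ) (hn : 2 ≤ n) : ((n - 1 : ℕ) : ℝ) * pc n = n := by
  have h : (2:ℝ) ≤ n := by exact_mod_cast hn
  have : (n:ℝ) - 1 ≠ 0 := by linarith
  rw [Nat.cast_sub (by omega)]
  unfold pc; push_cast; field_simp

lemma rpow_add_le_real (p a b M : ℝ) (hp : 1 ≤ p) (ha : 0 ≤ a) (hb : 0 ≤ b) (hM : a + b ≤ M) :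
    (a + b) ^ p ≤ a ^ p + p * M ^ (p - 1) * b := by
  rcases eq_or_lt_of_le (add_nonneg ha hb) with h | h
  · have h1 : a = 0 := by linarith
    have h2 : b = 0 := by linarith
    subst h1 h2; simp
  · have key := one_add_mul_self_le_rpow_one_add (s := -(b / (a+b))) (by
      have : b / (a+b) ≤ 1 := by rw [div_le_one h]; linarith
      linarith) hp
    have e : 1 + -(b/(a+b)) = a / (a+b) := by field_simp; ring
    rw [e, Real.div_rpow ha h.le, le_div_iff₀ (by positivity)] at key
    have e2 : (a+b)^p = (a+b)^(p-1) * (a+b) := by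
      rw [← Real.rpow_add_one h.ne']; congr 1; ring
    have e3 : (1 + p * -(b/(a+b))) * (a+b)^p = (a+b)^p - p * (a+b)^(p-1) * b := by
      rw [e2]; field_simp; ring
    rw [e3] at key
    have : (a+b)^(p-1) ≤ M^(p-1) := Real.rpow_le_rpow h.le hM (by linarith)
    have : p * (a+b)^(p-1) * b ≤ p * M^(p-1) * b := by gcongr
    linarith

lemma rpow_add_le_enn (p M : ℝ) (a b : ℝ≥0∞) (hp : 1 ≤ p) (hM0 : 0 ≤ M)
    (hM : a + b ≤ ENNReal.ofReal M) :
    (a + b) ^ p ≤ a ^ p + ENNReal.ofReal (p * M ^ (p - 1)) * b := by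
  have ha : a ≠ ∞ := ne_top_of_le_ne_top ENNReal.ofReal_ne_top (le_self_add.trans hM)
  have hb : b ≠ ∞ := ne_top_of_le_ne_top ENNReal.ofReal_ne_top (le_add_self.trans hM)
  lift a to NNReal using ha
  lift b to NNReal using hb
  have h := rpow_add_le_real p a b M hp a.2 b.2 (by
    rw [← ENNReal.ofReal_coe_nnreal, ← ENNReal.ofReal_coe_nnreal, ← ENNReal.ofReal_add a.coe_nonneg b.coe_nonneg,
      ENNReal.ofReal_le_ofReal_iff hM0] at hM
    exact hM)
  rw [← ENNReal.ofReal_coe_nnreal, ← ENNReal.ofReal_coe_nnreal, ← ENNReal.ofReal_add a.coe_nonneg b.coe_nonneg,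
    ENNReal.ofReal_rpow_of_nonneg (by positivity) (by linarith),
    ENNReal.ofReal_rpow_of_nonneg (by positivity) (by linarith), ← ENNReal.ofReal_mul (by positivity),
    ← ENNReal.ofReal_add (by positivity) (by positivity)]
  exact ENNReal.ofReal_le_ofReal h

section
variable {n : ℕ}

local notation "𝔼" => EuclideanSpace ℝ (Fin n)

lemma near_int' (hn : 2 ≤ n) (r : ℝ) (hr : 0 ≤ r) (y : 𝔼) :
    ∫⁻ x in Metric.ball y r, rk n (x - y) ≤ ENNReal.ofReal (sphereArea n * r) := by
  refine le_trans (le_of_eq ?_) (near_int n hn r hr)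
  rw [← lintegral_indicator measurableSet_ball, ← lintegral_indicator measurableSet_ball,
    ← lintegral_sub_right_eq_self ((Metric.ball (0 : 𝔼) r).indicator (fun z => rk n z)) y]
  congr 1; ext x
  simp [indicator, dist_eq_norm]

lemma KE_bound (hn : 2 ≤ n) (S : Set 𝔼) (r : ℝ) (hr : 0 < r)
    (hvol : volume S = ENNReal.ofReal (sphereArea n * r ^ n / n)) (y : 𝔼) :
    ∫⁻ x in S, rk n (x - y) ≤ ENNReal.ofReal (2 * sphereArea n * r) := by
  have hω := sphereArea_pos n hn
  have hn' : (1:ℝ) ≤ n := by exact_mod_cast (by omega : 1 ≤ n)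
  have h1 : ∫⁻ x in S, rk n (x - y) ≤ (∫⁻ x in Metric.ball y r, rk n (x - y))
      + ∫⁻ x in S, ENNReal.ofReal ((r ^ (n-1))⁻¹) := by
    rw [← lintegral_indicator measurableSet_ball]
    refine le_trans ?_ (add_le_add_left (setLIntegral_le_lintegral S _) _)
    rw [← lintegral_add_right _ measurable_const]
    apply lintegral_mono
    intro x
    by_cases hx : x ∈ Metric.ball y r
    · simp [hx]
    · simp only [hx, not_false_eq_true, indicator_of_notMem, zero_add, rk]
      apply ENNReal.ofReal_le_ofReal
      have : r ≤ ‖x - y‖ := by simpa [dist_eq_norm] using hx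
      gcongr
  refine h1.trans ((add_le_add_left (near_int' hn r hr.le y) _).trans ?_)
  rw [setLIntegral_const, hvol, ← ENNReal.ofReal_mul (by positivity), ← ENNReal.ofReal_add (by positivity) (by positivity)]
  apply ENNReal.ofReal_le_ofReal
  have e : r ^ n = r ^ (n-1) * r := by rw [← pow_succ, Nat.sub_add_cancel (by omega)]
  have : (r ^ (n-1))⁻¹ * (sphereArea n * r ^ n / n) = sphereArea n * r / n := by
    rw [e]; field_simp
  rw [this]
  have : sphereArea n * r / n ≤ sphereArea n * r := div_le_self (by positivity) hn'
  linarith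

/-- far part of the kernel -/
noncomputable def rkf (n : ℕ) (r : ℝ) (z : EuclideanSpace ℝ (Fin n)) : ℝ≥0∞ :=
  (Metric.ball (0 : EuclideanSpace ℝ (Fin n)) r)ᶜ.indicator (rk n) z

/-- near part of the kernel -/
noncomputable def rkn (n : ℕ) (r : ℝ) (z : EuclideanSpace ℝ (Fin n)) : ℝ≥0∞ :=
  (Metric.ball (0 : EuclideanSpace ℝ (Fin n)) r).indicator (rk n) z

lemma rkf_meas (r : ℝ) : Measurable (rkf n r) := (rk_meas n).indicator measurableSet_ball.compl
lemma rkn_meas (r : ℝ) : Measurable (rkn n r) := (rk_meas n).indicator measurableSet_ball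

lemma rk_split (r : ℝ) (z : 𝔼) : rk n z = rkf n r z + rkn n r z := by
  rw [rkf, rkn, add_comm]
  exact (indicator_self_add_compl_apply _ _ _).symm

lemma rkf_pow_int (hn : 2 ≤ n) (A : Set 𝔼) (r R : ℝ) (hr : 0 < r) (hR : r ≤ R)
    (hvol : volume A ≤ ENNReal.ofReal (sphereArea n * R ^ n / n)) (x : 𝔼) :
    ∫⁻ y in A, (rkf n r (x - y)) ^ (pc n) ≤
      ENNReal.ofReal (sphereArea n * Real.log (R / r) + sphereArea n / n) := by
  have hω := sphereArea_pos n hn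
  have hR0 : 0 < R := hr.trans_le hR
  have hn' : (1:ℝ) ≤ n := by exact_mod_cast (by omega : 1 ≤ n)
  have hlog : 0 ≤ Real.log (R / r) := Real.log_nonneg (by rwa [one_le_div hr])
  set T := Metric.ball (0 : 𝔼) R \ Metric.ball 0 r with hT
  have hTm : MeasurableSet T := measurableSet_ball.diff measurableSet_ball
  have pw : ∀ z : 𝔼, (rkf n r z) ^ (pc n) ≤
      T.indicator (fun z => ENNReal.ofReal ((‖z‖ ^ n)⁻¹)) z + ENNReal.ofReal ((R ^ n)⁻¹) := by
    intro z
    have hk : (rk n z) ^ (pc n) = ENNReal.ofReal ((‖z‖ ^ n)⁻¹) := by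
      rw [rk, ENNReal.ofReal_rpow_of_nonneg (by positivity) (by have := pc_gt n hn; linarith)]
      congr 1
      rw [Real.inv_rpow (by positivity), ← Real.rpow_natCast, ← Real.rpow_mul (by positivity),
        pc_mul n hn, Real.rpow_natCast]
    by_cases h1 : z ∈ Metric.ball (0 : 𝔼) r
    · simp only [rkf, mem_compl_iff, h1, not_true_eq_false, not_false_eq_true, indicator_of_notMem]
      rw [ENNReal.zero_rpow_of_pos (by have := pc_gt n hn; linarith)]
      simp
    · have : rkf n r z = rk n z := by simp [rkf, h1]
      rw [this, hk]
      by_cases h2 : z ∈ Metric.ball (0 : 𝔼) R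
      · have : z ∈ T := ⟨h2, h1⟩
        simp [this]
      · refine le_trans ?_ le_add_self
        apply ENNReal.ofReal_le_ofReal
        have : R ≤ ‖z‖ := by simpa using h2
        gcongr
  calc ∫⁻ y in A, (rkf n r (x - y)) ^ (pc n)
      ≤ ∫⁻ y in A, (T.indicator (fun z => ENNReal.ofReal ((‖z‖ ^ n)⁻¹)) (x - y) + ENNReal.ofReal ((R ^ n)⁻¹)) :=
        lintegral_mono (fun y => pw _)
    _ = (∫⁻ y in A, (T.indicator (fun z => ENNReal.ofReal ((‖z‖ ^ n)⁻¹)) (x - y))) + ENNReal.ofReal ((R ^ n)⁻¹) * volume A := by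
        rw [lintegral_add_right _ measurable_const, setLIntegral_const]
    _ ≤ (∫⁻ y, (T.indicator (fun z => ENNReal.ofReal ((‖z‖ ^ n)⁻¹)) (x - y))) + ENNReal.ofReal ((R ^ n)⁻¹) * ENNReal.ofReal (sphereArea n * R ^ n / n) := by
        gcongr
        exact Measure.restrict_le_self
    _ ≤ ENNReal.ofReal (sphereArea n * Real.log (R / r)) + ENNReal.ofReal (sphereArea n / n) := by
        rw [lintegral_sub_left_eq_self (T.indicator (fun z => ENNReal.ofReal ((‖z‖ ^ n)⁻¹))) x, lintegral_indicator hTm, ← ENNReal.ofReal_mul (by positivity)]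
        gcongr
        · exact far_int n hn r R hr hR
        · apply le_of_eq; field_simp
    _ = _ := by rw [← ENNReal.ofReal_add (by positivity) (by positivity)]

lemma jensen_enn (hn : 2 ≤ n) {α : Type*} [MeasurableSpace α] (μ : Measure α) (g : α → ℝ≥0∞)
    (hg : AEMeasurable g μ) :
    (∫⁻ x, g x ∂μ) ^ (pc n) ≤ (∫⁻ x, g x ^ (pc n) ∂μ) * (μ univ) ^ (pc n - 1) := by
  have h := ENNReal.lintegral_mul_le_Lp_mul_Lq μ (pc_conj n hn) hg (aemeasurable_const (b := (1:ℝ≥0∞)))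
  simp only [Pi.mul_apply, mul_one, ENNReal.one_rpow, lintegral_one] at h
  have hp := pc_gt n hn
  calc _ ≤ ((∫⁻ x, g x ^ (pc n) ∂μ) ^ (1 / pc n) * (μ univ) ^ (1 / (n:ℝ))) ^ (pc n) := by
        apply ENNReal.rpow_le_rpow h (by linarith)
    _ = _ := by
      rw [ENNReal.mul_rpow_of_nonneg _ _ (by linarith), ← ENNReal.rpow_mul, ← ENNReal.rpow_mul,
        one_div_mul_cancel (by linarith), ENNReal.rpow_one, pc_sub n hn, ← pc_div n hn]
      congr 2; ring

/-- the additive constant -/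
noncomputable def C0 (n : ℕ) : ℝ := 1 + pc n * n * (2 * n) ^ (pc n - 1)

lemma C0_ge (hn : 2 ≤ n) : 1 ≤ C0 n := by
  have hp := pc_gt n hn
  have : 0 ≤ pc n * n * (2 * n) ^ (pc n - 1) := by positivity
  unfold C0; linarith

lemma KE_pow_int (hn : 2 ≤ n) (S A : Set 𝔼) (r R : ℝ) (hr : 0 < r) (hR : r ≤ R)
    (hS : volume S = ENNReal.ofReal (sphereArea n * r ^ n / n))
    (hvol : volume A ≤ ENNReal.ofReal (sphereArea n * R ^ n / n)) :
    ∫⁻ y in A, (∫⁻ x in S, rk n (x - y)) ^ (pc n) ≤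
      ENNReal.ofReal ((sphereArea n * r ^ n / n) ^ (pc n) * (sphereArea n / n * (n * Real.log (R / r) + C0 n))) := by
  have hω := sphereArea_pos n hn
  have hp := pc_gt n hn
  have hn' : (1:ℝ) ≤ n := by exact_mod_cast (by omega : 1 ≤ n)
  have hlog : 0 ≤ Real.log (R / r) := Real.log_nonneg (by rwa [one_le_div hr])
  set t := sphereArea n * r ^ n / n with ht
  have ht0 : 0 < t := by positivity
  have hm1 : Measurable (fun y : 𝔼 => ∫⁻ x in S, rkf n r (x - y)) := by
    apply Measurable.lintegral_prod_right (f := fun y : 𝔼 => fun x : 𝔼 => rkf n r (x - y))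
    exact (rkf_meas r).comp (measurable_snd.sub measurable_fst)
  have hm2 : Measurable (fun y : 𝔼 => ∫⁻ x in S, rkn n r (x - y)) := by
    apply Measurable.lintegral_prod_right (f := fun y : 𝔼 => fun x : 𝔼 => rkn n r (x - y))
    exact (rkn_meas r).comp (measurable_snd.sub measurable_fst)
  have split : ∀ y : 𝔼, ∫⁻ x in S, rk n (x - y) = (∫⁻ x in S, rkf n r (x - y)) + ∫⁻ x in S, rkn n r (x - y) := by
    intro y
    rw [← lintegral_add_right _ (show Measurable (fun x : 𝔼 => rkn n r (x - y)) from (rkn_meas r).comp (measurable_id.sub_const y))]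
    simp_rw [← rk_split r]
  have pw : ∀ y : 𝔼, (∫⁻ x in S, rk n (x - y)) ^ (pc n) ≤
      (∫⁻ x in S, rkf n r (x - y) ^ (pc n)) * ENNReal.ofReal (t ^ (pc n - 1)) +
      ENNReal.ofReal (pc n * (2 * sphereArea n * r) ^ (pc n - 1)) * ∫⁻ x in S, rkn n r (x - y) := by
    intro y
    have h1 := KE_bound hn S r hr hS y
    rw [split] at h1 ⊢
    refine (rpow_add_le_enn (pc n) (2 * sphereArea n * r) _ _ hp.le (by positivity) h1).trans ?_
    gcongr
    refine (jensen_enn hn _ _ ((rkf_meas r).comp (measurable_id.sub_const y)).aemeasurable).trans ?_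
    rw [Measure.restrict_apply_univ, hS, ENNReal.ofReal_rpow_of_pos ht0]
    simp
  have swap1 : ∫⁻ y in A, ∫⁻ x in S, rkf n r (x - y) ^ (pc n) ≤
      ENNReal.ofReal (sphereArea n * Real.log (R / r) + sphereArea n / n) * ENNReal.ofReal t := by
    rw [lintegral_lintegral_swap]
    · calc _ ≤ ∫⁻ x in S, ENNReal.ofReal (sphereArea n * Real.log (R / r) + sphereArea n / n) :=
          lintegral_mono (fun x => rkf_pow_int hn A r R hr hR hvol x)
        _ = _ := by rw [setLIntegral_const, hS]
    · apply Measurable.aemeasurable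
      exact (((rkf_meas r).comp (measurable_snd.sub measurable_fst)).pow_const _)
  have swap2 : ∫⁻ y in A, ∫⁻ x in S, rkn n r (x - y) ≤ ENNReal.ofReal (sphereArea n * r) * ENNReal.ofReal t := by
    rw [lintegral_lintegral_swap]
    · calc _ ≤ ∫⁻ x in S, ENNReal.ofReal (sphereArea n * r) := by
            apply lintegral_mono
            intro x
            refine (setLIntegral_le_lintegral _ _).trans ?_
            rw [lintegral_sub_left_eq_self (rkn n r) x]
            unfold rkn
            rw [lintegral_indicator measurableSet_ball]
            exact near_int n hn r hr.le
        _ = _ := by rw [setLIntegral_const, hS]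
    · apply Measurable.aemeasurable
      exact ((rkn_meas r).comp (measurable_snd.sub measurable_fst))
  calc _ ≤ ∫⁻ y in A, ((∫⁻ x in S, rkf n r (x - y) ^ (pc n)) * ENNReal.ofReal (t ^ (pc n - 1)) +
      ENNReal.ofReal (pc n * (2 * sphereArea n * r) ^ (pc n - 1)) * ∫⁻ x in S, rkn n r (x - y)) :=
        lintegral_mono pw
    _ = (∫⁻ y in A, ∫⁻ x in S, rkf n r (x - y) ^ (pc n)) * ENNReal.ofReal (t ^ (pc n - 1)) +
        ENNReal.ofReal (pc n * (2 * sphereArea n * r) ^ (pc n - 1)) * ∫⁻ y in A, ∫⁻ x in S, rkn n r (x - y) := by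
        rw [lintegral_add_right _ (hm2.const_mul _), lintegral_const_mul _ hm2,
          lintegral_mul_const' _ _ ENNReal.ofReal_ne_top]
    _ ≤ (ENNReal.ofReal (sphereArea n * Real.log (R / r) + sphereArea n / n) * ENNReal.ofReal t) * ENNReal.ofReal (t ^ (pc n - 1)) +
        ENNReal.ofReal (pc n * (2 * sphereArea n * r) ^ (pc n - 1)) * (ENNReal.ofReal (sphereArea n * r) * ENNReal.ofReal t) := by
        gcongr
    _ = _ := by
        rw [← ENNReal.ofReal_mul (by positivity), ← ENNReal.ofReal_mul (by positivity),
          ← ENNReal.ofReal_mul (by positivity), ← ENNReal.ofReal_mul (by positivity),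
          ← ENNReal.ofReal_add (by positivity) (by positivity)]
        congr 1
        have e1 : t ^ (pc n) = t * t ^ (pc n - 1) := by
          rw [← Real.rpow_one_add' ht0.le (by linarith)]; congr 1; ring
        have e2 : (2 * sphereArea n * r) ^ (pc n - 1) * r = (2 * n) ^ (pc n - 1) * t ^ (pc n - 1) := by
          have e3 : r = (r ^ (n-1)) ^ (pc n - 1) := by
            rw [← Real.rpow_natCast, ← Real.rpow_mul hr.le, pc_sub n hn, Nat.cast_sub (by omega)]
            have : (n:ℝ) - 1 ≠ 0 := by
              have h : (2:ℝ) ≤ n := by exact_mod_cast hn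
              linarith
            push_cast
            rw [mul_one_div_cancel this, Real.rpow_one]
          nth_rw 2 [e3]
          rw [← Real.mul_rpow (by positivity) (by positivity), ← Real.mul_rpow (by positivity) (by positivity)]
          congr 1
          rw [ht]
          have e : r ^ n = r * r ^ (n-1) := by rw [← pow_succ', Nat.sub_add_cancel (by omega)]
          rw [e]; field_simp
        have e4 : pc n * (2 * sphereArea n * r) ^ (pc n - 1) * (sphereArea n * r * t) =
            pc n * ((2 * sphereArea n * r) ^ (pc n - 1) * r) * sphereArea n * t := by ring
        rw [e4, e2, e1, C0]
        field_simp
        ring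

lemma weak_est (hn : 2 ≤ n) (v : 𝔼 → ℝ) (hv : ContDiff ℝ 1 v) (hc : HasCompactSupport v)
    (S A : Set 𝔼) (hSm : MeasurableSet S) (hA : MeasurableSet A) (r R : ℝ) (hr : 0 < r) (hR : r ≤ R)
    (hS : volume S = ENNReal.ofReal (sphereArea n * r ^ n / n))
    (hvol : volume A ≤ ENNReal.ofReal (sphereArea n * R ^ n / n))
    (c : ℝ) (hc0 : 0 ≤ c) (hcS : ∀ x ∈ S, c ≤ v x) (hsupp : ∀ x ∉ A, fderiv ℝ v x = 0)
    (e : ℝ) (he : 0 ≤ e) (hE : ∫⁻ x in A, ‖fderiv ℝ v x‖ₑ ^ n ≤ ENNReal.ofReal e) :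
    gammaMT n * c ^ (pc n) ≤ (n * Real.log (R / r) + C0 n) * e ^ (1 / ((n:ℝ) - 1)) := by
  have hω := sphereArea_pos n hn
  have hp := pc_gt n hn
  have hn' : (1:ℝ) ≤ n := by exact_mod_cast (by omega : 1 ≤ n)
  have hn2 : (2:ℝ) ≤ n := by exact_mod_cast hn
  have hlog : 0 ≤ Real.log (R / r) := Real.log_nonneg (by rwa [one_le_div hr])
  have hC := C0_ge hn
  have hcont : Continuous (fderiv ℝ v) := hv.continuous_fderiv one_ne_zero
  set t := sphereArea n * r ^ n / n with ht
  have ht0 : 0 < t := by positivity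
  set L := n * Real.log (R / r) + C0 n with hL
  have hL0 : 0 ≤ L := by positivity
  have hm1 : Measurable (fun y : 𝔼 => ∫⁻ x in S, rk n (x - y)) := by
    apply Measurable.lintegral_prod_right (f := fun y : 𝔼 => fun x : 𝔼 => rk n (x - y))
    exact (rk_meas n).comp (measurable_snd.sub measurable_fst)
  have h1 : ENNReal.ofReal (sphereArea n * c * t) ≤
      ∫⁻ y in A, ‖fderiv ℝ v y‖ₑ * ∫⁻ x in S, rk n (x - y) := by
    calc ENNReal.ofReal (sphereArea n * c * t)
        = ∫⁻ x in S, ENNReal.ofReal (sphereArea n * c) := by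
          rw [setLIntegral_const, hS, ← ENNReal.ofReal_mul (by positivity)]
      _ ≤ ∫⁻ x in S, ∫⁻ y, ‖fderiv ℝ v y‖ₑ * rk n (x - y) := by
          apply setLIntegral_mono' hSm
          intro x hx
          refine le_trans ?_ (repr_bound n hn v hv hc x)
          rw [ENNReal.ofReal_mul hω.le]
          gcongr
          rw [← ofReal_norm]
          apply ENNReal.ofReal_le_ofReal
          exact (hcS x hx).trans (le_abs_self _)
      _ = ∫⁻ y, ∫⁻ x in S, ‖fderiv ℝ v y‖ₑ * rk n (x - y) := by
          rw [lintegral_lintegral_swap]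
          apply Measurable.aemeasurable
          have m1 : Measurable (fun q : 𝔼 × 𝔼 => ‖fderiv ℝ v q.2‖ₑ) := by fun_prop
          have m2 : Measurable (fun q : 𝔼 × 𝔼 => rk n (q.1 - q.2)) :=
            (rk_meas n).comp (measurable_fst.sub measurable_snd)
          exact m1.mul m2
      _ = ∫⁻ y, ‖fderiv ℝ v y‖ₑ * ∫⁻ x in S, rk n (x - y) := by
          apply lintegral_congr; intro y
          rw [lintegral_const_mul' _ _ (by simp)]
      _ = _ := by
          rw [← lintegral_indicator hA]
          apply lintegral_congr; intro y
          by_cases hy : y ∈ A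
          · simp [hy]
          · rw [← ofReal_norm, hsupp y hy, norm_zero, ENNReal.ofReal_zero, zero_mul, indicator_of_notMem hy]
  have h2 : ∫⁻ y in A, ‖fderiv ℝ v y‖ₑ * ∫⁻ x in S, rk n (x - y) ≤
      ENNReal.ofReal e ^ (1 / (n:ℝ)) * ENNReal.ofReal (t ^ (pc n) * (sphereArea n / n * L)) ^ (1 / pc n) := by
    have := ENNReal.lintegral_mul_le_Lp_mul_Lq (volume.restrict A) (pc_conj n hn).symm
      (f := fun y => ‖fderiv ℝ v y‖ₑ) (by fun_prop) hm1.aemeasurable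
    refine this.trans ?_
    simp only [ENNReal.rpow_natCast]
    have hk := KE_pow_int hn S A r R hr hR hS hvol
    gcongr
  have h3 := h1.trans h2
  rw [ENNReal.ofReal_rpow_of_nonneg he (by positivity), ENNReal.ofReal_rpow_of_nonneg (by positivity) (by positivity),
    ← ENNReal.ofReal_mul (by positivity), ENNReal.ofReal_le_ofReal_iff (by positivity)] at h3
  have h4 := Real.rpow_le_rpow (by positivity) h3 (by linarith : 0 ≤ pc n)
  rw [Real.mul_rpow (by positivity) (by positivity), Real.mul_rpow (by positivity) (by positivity),
    Real.mul_rpow (by positivity) (by positivity), ← Real.rpow_mul he, ← Real.rpow_mul (by positivity),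
    one_div_mul_cancel (by linarith), Real.rpow_one,
    show 1 / (n:ℝ) * pc n = 1 / ((n:ℝ) - 1) by rw [← pc_div n hn]; ring] at h4
  have ht1 : 0 < t ^ (pc n) := by positivity
  have h5 : sphereArea n ^ (pc n) * c ^ (pc n) ≤ e ^ (1 / ((n:ℝ) - 1)) * (sphereArea n / n * L) := by
    apply le_of_mul_le_mul_right _ ht1
    linarith
  have h6 : sphereArea n ^ (pc n) = sphereArea n * sphereArea n ^ (1 / ((n:ℝ) - 1)) := by
    rw [← pc_sub n hn, ← Real.rpow_one_add' hω.le (by linarith)]; congr 1; ring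
  rw [h6] at h5
  rw [gammaMT]
  have h7 : sphereArea n / n > 0 := by positivity
  apply le_of_mul_le_mul_left _ h7
  calc _ = sphereArea n * sphereArea n ^ (1 / ((n:ℝ) - 1)) * c ^ (pc n) := by field_simp
    _ ≤ _ := h5
    _ = _ := by ring
end

lemma two_holder (n : ℕ) (hn : 2 ≤ n) (a b c d : ℝ) (ha : 0 ≤ a) (hb : 0 ≤ b) (hc : 0 ≤ c) (hd : 0 ≤ d) :
    a * c + b * d ≤ (a ^ (pc n) + b ^ (pc n)) ^ (1 / pc n) * (c ^ n + d ^ n) ^ (1 / (n:ℝ)) := by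
  have := Real.inner_le_Lp_mul_Lq_of_nonneg (Finset.univ : Finset (Fin 2)) (pc_conj n hn)
    (f := ![a, b]) (g := ![c, d]) (by intro i _; fin_cases i <;> simpa)
    (by intro i _; fin_cases i <;> simpa)
  simpa using this

/-- `p`-th power version of the two-term Hoelder inequality -/
lemma two_holder_pow (n : ℕ) (hn : 2 ≤ n) (a b c d : ℝ) (ha : 0 ≤ a) (hb : 0 ≤ b) (hc : 0 ≤ c) (hd : 0 ≤ d) :
    (a * c + b * d) ^ (pc n) ≤ (a ^ (pc n) + b ^ (pc n)) * (c ^ n + d ^ n) ^ (1 / ((n:ℝ) - 1)) := by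
  have hp := pc_gt n hn
  have h := Real.rpow_le_rpow (by positivity) (two_holder n hn a b c d ha hb hc hd) (by linarith : 0 ≤ pc n)
  rw [Real.mul_rpow (by positivity) (by positivity), ← Real.rpow_mul (by positivity),
    ← Real.rpow_mul (by positivity), one_div_mul_cancel (by linarith), Real.rpow_one,
    show 1 / (n:ℝ) * pc n = 1 / ((n:ℝ) - 1) by rw [← pc_div n hn]; ring] at h
  exact h

lemma core_pair (n : ℕ) (hn : 2 ≤ n) (C j : ℝ) (hC : 1 ≤ C) (hj : 0 ≤ j) (k1 k2 : ℕ) (h1 : 1 ≤ k1)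
    (hk : k1 < k2) (τ1 τ2 ε : ℝ) (hε0 : 0 ≤ ε) (hε1 : ε ≤ 1)
    (hA : (k1:ℝ) ≤ (τ1 + C) * ε ^ (1 / ((n:ℝ) - 1)))
    (hB : ((k2:ℝ) ^ (1 / pc n) - (k1:ℝ) ^ (1 / pc n)) ^ (pc n) ≤ (τ2 - τ1 + C) * (1 - ε) ^ (1 / ((n:ℝ) - 1)))
    (hj1 : τ1 - k1 ≤ j) (hj2 : τ2 - k2 ≤ j)
    (hbig : (4:ℝ) ^ (n - 1) * ((n:ℝ) - 1) * (j + 2 * C) ≤ k1) :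
    (k2:ℝ) - k1 ≤ (1 + 2 * (4 ^ (n - 1) * ((n:ℝ) - 1))) * (j + 2 * C) := by
  have hp := pc_gt n hn
  have hn2 : (2:ℝ) ≤ n := by exact_mod_cast hn
  have hq : 0 < 1 / ((n:ℝ) - 1) := by apply one_div_pos.2; linarith
  set q := 1 / ((n:ℝ) - 1) with hqdef
  set L := j + 2 * C with hL
  have hL0 : 0 < L := by positivity
  have hk1 : (1:ℝ) ≤ k1 := by exact_mod_cast h1
  have hk12 : (k1:ℝ) < k2 := by exact_mod_cast hk
  have hεq : ε ^ q ≤ 1 := Real.rpow_le_one hε0 hε1 hq.le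
  have hεq0 : 0 ≤ ε ^ q := by positivity
  have hpos : 0 < τ1 + C := by
    by_contra hcon
    push Not at hcon
    have : (τ1 + C) * ε ^ q ≤ 0 := mul_nonpos_of_nonpos_of_nonneg hcon hεq0
    linarith
  have hτ1 : (k1:ℝ) ≤ τ1 + C := hA.trans (mul_le_of_le_one_right hpos.le hεq)
  -- estimate on `1 - ε`
  set δ := 1 - ε with hδ
  have hδ0 : 0 ≤ δ := by linarith
  have hnm : ((n - 1 : ℕ) : ℝ) = (n:ℝ) - 1 := by rw [Nat.cast_sub (by omega)]; simp
  have hδ1 : δ ≤ ((n:ℝ) - 1) * L / k1 := by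
    have e1 : (k1:ℝ) ≤ (k1 + L) * ε ^ q := hA.trans
      (mul_le_mul_of_nonneg_right (by linarith : τ1 + C ≤ k1 + L) hεq0)
    have e2 : (k1:ℝ) / (k1 + L) ≤ ε ^ q := by
      rw [div_le_iff₀ (by positivity)]; linarith
    have e3 : ((k1:ℝ) / (k1 + L)) ^ (n-1) ≤ ε := by
      calc _ ≤ (ε ^ q) ^ (n-1) := by gcongr
        _ = ε := by
          rw [← Real.rpow_natCast, ← Real.rpow_mul hε0, hnm, hqdef, one_div_mul_cancel (by linarith), Real.rpow_one]
    have e4 := one_add_mul_le_pow (a := -(L / (k1 + L))) (by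
      have : L / (k1 + L) ≤ 1 := by rw [div_le_one (by positivity)]; linarith
      linarith) (n - 1)
    have e5 : 1 + -(L / (k1 + L)) = (k1:ℝ) / (k1 + L) := by field_simp; ring
    rw [e5, hnm] at e4
    have e6 : δ ≤ ((n:ℝ) - 1) * (L / (k1 + L)) := by linarith
    refine e6.trans ?_
    rw [← mul_div_assoc]
    have : 0 ≤ ((n:ℝ) - 1) * L := by apply mul_nonneg; linarith; positivity
    gcongr
    linarith
  set x := (k2:ℝ) - k1 with hx
  have hx0 : 0 < x := by linarith
  have hy : τ2 - τ1 + C ≤ x + L := by linarith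
  have hB2 : ((k2:ℝ) ^ (1 / pc n) - (k1:ℝ) ^ (1 / pc n)) ≤ ((x + L) * δ ^ q) ^ (1 / pc n) := by
    have h0 : 0 ≤ (k2:ℝ) ^ (1 / pc n) - (k1:ℝ) ^ (1 / pc n) :=
      sub_nonneg.2 (Real.rpow_le_rpow (by positivity) hk12.le (by positivity))
    have h3 : ((k2:ℝ) ^ (1 / pc n) - (k1:ℝ) ^ (1 / pc n)) ^ (pc n) ≤ (x + L) * δ ^ q :=
      hB.trans (by gcongr)
    have h4 := Real.rpow_le_rpow (by positivity) h3 (by positivity : 0 ≤ 1 / pc n)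
    rw [← Real.rpow_mul h0, mul_one_div_cancel (by linarith), Real.rpow_one] at h4
    exact h4
  have hH := two_holder_pow n hn ((k1:ℝ) ^ (1 / pc n)) (((x + L) / 4) ^ (1 / pc n)) 1
    ((4:ℝ) ^ (1 / pc n) * δ ^ (1 / (n:ℝ))) (by positivity) (by positivity) zero_le_one (by positivity)
  have e7 : ((x + L) * δ ^ q) ^ (1 / pc n) =
      ((x + L) / 4) ^ (1 / pc n) * ((4:ℝ) ^ (1 / pc n) * δ ^ (1 / (n:ℝ))) := by
    rw [← mul_assoc, ← Real.mul_rpow (by positivity) (by positivity), div_mul_cancel₀ _ (by norm_num),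
      Real.mul_rpow (by positivity) (by positivity), ← Real.rpow_mul hδ0]
    congr 2
    rw [hqdef, ← pc_div n hn]
    field_simp
  have e8 : ((4:ℝ) ^ (1 / pc n) * δ ^ (1 / (n:ℝ))) ^ n = 4 ^ (n-1) * δ := by
    rw [mul_pow, ← Real.rpow_natCast, ← Real.rpow_natCast (δ ^ _), ← Real.rpow_mul (by positivity),
      ← Real.rpow_mul hδ0, one_div_mul_cancel (by linarith), Real.rpow_one]
    congr 1
    rw [← Real.rpow_natCast, hnm]
    congr 1
    unfold pc
    field_simp
  have e9 : (((k1:ℝ) ^ (1 / pc n))) ^ (pc n) = k1 := by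
    rw [← Real.rpow_mul (by positivity), one_div_mul_cancel (by linarith), Real.rpow_one]
  have e10 : (((x + L) / 4) ^ (1 / pc n)) ^ (pc n) = (x + L) / 4 := by
    rw [← Real.rpow_mul (by positivity), one_div_mul_cancel (by linarith), Real.rpow_one]
  have e11 : (((k2:ℝ) ^ (1 / pc n))) ^ (pc n) = k2 := by
    rw [← Real.rpow_mul (by positivity), one_div_mul_cancel (by linarith), Real.rpow_one]
  rw [e8, e9, e10, mul_one, ← e7, one_pow] at hH
  have h5 : (k2:ℝ) ≤ ((k1:ℝ) + (x + L) / 4) * (1 + 4 ^ (n-1) * δ) ^ q := by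
    refine le_trans ?_ hH
    rw [← e11]
    apply Real.rpow_le_rpow (by positivity) (by linarith) (by linarith)
  set D := (4:ℝ) ^ (n - 1) * ((n:ℝ) - 1) with hD
  set B := (4:ℝ) ^ (n-1) * δ with hBdef
  have hB0 : 0 ≤ B := by positivity
  have hq1 : q ≤ 1 := by rw [hqdef, div_le_one (by linarith)]; linarith
  have h6 : (1 + B) ^ q ≤ 1 + B := by
    calc _ ≤ (1 + B) ^ (1:ℝ) := Real.rpow_le_rpow_of_exponent_le (by linarith) hq1
      _ = _ := Real.rpow_one _
  have h7 : B * k1 ≤ D * L := by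
    have := (le_div_iff₀ (by positivity)).1 hδ1
    calc B * k1 = 4 ^ (n-1) * (δ * k1) := by rw [hBdef]; ring
      _ ≤ 4 ^ (n-1) * (((n:ℝ) - 1) * L) := by gcongr
      _ = D * L := by rw [hD]; ring
  have h8 : B ≤ 1 := by
    have : B * k1 ≤ 1 * k1 := by linarith
    exact le_of_mul_le_mul_right this (by linarith)
  have h9 : (k2:ℝ) ≤ ((k1:ℝ) + (x + L) / 4) * (1 + B) := h5.trans (by gcongr)
  have h10 : (x + L) / 4 * B ≤ (x + L) / 4 := mul_le_of_le_one_right (by positivity) h8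
  have h11 : (k2 : ℝ) = k1 + x := by rw [hx]; ring
  nlinarith

lemma core_sum (n : ℕ) (hn : 2 ≤ n) (C : ℝ) (hC : 1 ≤ C) : ∃ C' : ℝ, 0 ≤ C' ∧
    ∀ (S : Finset ℕ) (τ ε : ℕ → ℝ), (∀ k ∈ S, 1 ≤ k) → (∀ k ∈ S, 0 ≤ ε k) → (∀ k ∈ S, ε k ≤ 1) →
    (∀ k ∈ S, (k:ℝ) ≤ (τ k + C) * ε k ^ (1 / ((n:ℝ) - 1))) →
    (∀ k1 ∈ S, ∀ k2 ∈ S, k1 < k2 → ((k2:ℝ) ^ (1 / pc n) - (k1:ℝ) ^ (1 / pc n)) ^ (pc n) ≤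
      (τ k2 - τ k1 + C) * (1 - ε k1) ^ (1 / ((n:ℝ) - 1))) →
    ∑ k ∈ S, Real.exp (k - τ k) ≤ C' := by
  have hn2 : (2:ℝ) ≤ n := by exact_mod_cast hn
  have hq : 0 < 1 / ((n:ℝ) - 1) := by apply one_div_pos.2; linarith
  set D := (4:ℝ) ^ (n - 1) * ((n:ℝ) - 1) with hD
  have hD0 : 0 ≤ D := by rw [hD]; apply mul_nonneg; positivity; linarith
  set w : ℕ → ℝ := fun j => ((1 + 3 * D) * ((j:ℝ) + 2 * C) + 2) * Real.exp (-(j:ℝ)) with hw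
  have hw0 : ∀ j, 0 ≤ w j := fun j => by positivity
  have hsum : Summable w := by
    have s0 := Real.summable_pow_mul_exp_neg_nat_mul 0 one_pos
    have s1 := Real.summable_pow_mul_exp_neg_nat_mul 1 one_pos
    have := (s1.mul_left (1 + 3 * D)).add (s0.mul_left ((1 + 3 * D) * (2 * C) + 2))
    refine this.congr (fun j => ?_)
    simp only [hw, pow_one, pow_zero, neg_mul, one_mul]
    ring
  refine ⟨Real.exp (C + 1) * ∑' j, w j, by
    have : 0 ≤ ∑' j, w j := tsum_nonneg hw0
    positivity, ?_⟩
  intro S τ ε hS hε0 hε1 hA hB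
  have hτ : ∀ k ∈ S, (k:ℝ) ≤ τ k + C := by
    intro k hk
    have h1 := hA k hk
    have h2 := Real.rpow_le_one (hε0 k hk) (hε1 k hk) hq.le
    have h3 : 0 ≤ ε k ^ (1 / ((n:ℝ) - 1)) := Real.rpow_nonneg (hε0 k hk) _
    have hk1 : (1:ℝ) ≤ k := by exact_mod_cast hS k hk
    have hpos : 0 < τ k + C := by
      by_contra hcon
      push Not at hcon
      have := mul_nonpos_of_nonpos_of_nonneg hcon h3
      linarith
    exact h1.trans (mul_le_of_le_one_right hpos.le h2)
  set J : ℕ → ℕ := fun k => ⌈τ k - k⌉₊ with hJ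
  have hcard : ∀ j : ℕ, ((S.filter (fun k => J k = j)).card : ℝ) ≤ (1 + 3 * D) * ((j:ℝ) + 2 * C) + 2 := by
    intro j
    set L := (j:ℝ) + 2 * C with hL
    have hL0 : 0 < L := by positivity
    set T := S.filter (fun k => J k = j) with hT
    have hTj : ∀ k ∈ T, τ k - k ≤ j := by
      intro k hk
      have : J k = j := (Finset.mem_filter.1 hk).2
      rw [← this]
      exact Nat.le_ceil _
    have hTS : ∀ k ∈ T, k ∈ S := fun k hk => (Finset.mem_filter.1 hk).1
    set T2 := T.filter (fun k : ℕ => D * L ≤ (k:ℝ)) with hT2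
    have c1 : (T.filter (fun k : ℕ => ¬ D * L ≤ (k:ℝ))).card ≤ ⌈D * L⌉₊ := by
      rw [← Finset.card_range ⌈D * L⌉₊]
      apply Finset.card_le_card
      intro k hk
      have := (Finset.mem_filter.1 hk).2
      push Not at this
      exact Finset.mem_range.2 (Nat.lt_ceil.2 this)
    have c2 : T2.card ≤ ⌊(1 + 2 * D) * L⌋₊ + 1 := by
      rcases T2.eq_empty_or_nonempty with h | h
      · rw [h]; simp
      · set m := T2.min' h
        have hm : m ∈ T2 := T2.min'_mem h
        have : T2 ⊆ Finset.Icc m (m + ⌊(1 + 2 * D) * L⌋₊) := by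
          intro k hk
          have hmk : m ≤ k := T2.min'_le k hk
          rw [Finset.mem_Icc]
          refine ⟨hmk, ?_⟩
          rcases hmk.eq_or_lt with h' | h'
          · omega
          · have hm1 := (Finset.mem_filter.1 hm)
            have hk1 := (Finset.mem_filter.1 hk)
            have := core_pair n hn C j hC (by positivity) m k (hS m (hTS m hm1.1)) h' (τ m) (τ k) (ε m)
              (hε0 m (hTS m hm1.1)) (hε1 m (hTS m hm1.1)) (hA m (hTS m hm1.1))
              (hB m (hTS m hm1.1) k (hTS k hk1.1) h') (hTj m hm1.1) (hTj k hk1.1) hm1.2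
            have h2 : k - m ≤ ⌊(1 + 2 * D) * L⌋₊ := by
              apply Nat.le_floor
              rw [Nat.cast_sub hmk]
              exact this
            omega
        refine (Finset.card_le_card this).trans ?_
        rw [Nat.card_Icc]
        omega
    have c3 : T.card = T2.card + (T.filter (fun k : ℕ => ¬ D * L ≤ (k:ℝ))).card :=
      (Finset.card_filter_add_card_filter_not (s := T) (p := fun k : ℕ => D * L ≤ (k:ℝ))).symm
    have c4 : (T.card : ℝ) ≤ (⌊(1 + 2 * D) * L⌋₊ + 1 : ℝ) + ⌈D * L⌉₊ := by
      exact_mod_cast (by omega : T.card ≤ ⌊(1 + 2 * D) * L⌋₊ + 1 + ⌈D * L⌉₊)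
    have c5 := Nat.floor_le (by positivity : 0 ≤ (1 + 2 * D) * L)
    have c6 := Nat.ceil_lt_add_one (by positivity : 0 ≤ D * L)
    nlinarith
  calc ∑ k ∈ S, Real.exp (k - τ k) ≤ ∑ k ∈ S, Real.exp (C + 1) * Real.exp (-(J k : ℝ)) := by
        apply Finset.sum_le_sum
        intro k hk
        rw [← Real.exp_add]
        apply Real.exp_le_exp.2
        have h1 := hτ k hk
        rcases le_total (τ k - k) 0 with h | h
        · have : J k = 0 := Nat.ceil_eq_zero.2 h
          rw [this]; simp; linarith
        · have := Nat.ceil_lt_add_one h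
          have h2 : (J k : ℝ) < τ k - k + 1 := this
          linarith
    _ = Real.exp (C + 1) * ∑ k ∈ S, Real.exp (-(J k : ℝ)) := by rw [Finset.mul_sum]
    _ = Real.exp (C + 1) * ∑ j ∈ S.image J, ∑ k ∈ S.filter (fun k => J k = j), Real.exp (-(J k : ℝ)) := by
        rw [Finset.sum_fiberwise_of_maps_to (fun k hk => Finset.mem_image_of_mem J hk)]
    _ ≤ Real.exp (C + 1) * ∑ j ∈ S.image J, w j := by
        gcongr with j hj
        calc _ = ∑ k ∈ S.filter (fun k => J k = j), Real.exp (-(j : ℝ)) := by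
              apply Finset.sum_congr rfl
              intro k hk
              rw [(Finset.mem_filter.1 hk).2]
          _ = ((S.filter (fun k => J k = j)).card : ℝ) * Real.exp (-(j:ℝ)) := by
              rw [Finset.sum_const, nsmul_eq_mul]
          _ ≤ _ := by
              simp only [hw]
              have := hcard j
              gcongr
    _ ≤ _ := by
        gcongr
        exact hsum.sum_le_tsum _ (fun j _ => hw0 j)

lemma trunc_exists (s1 s2 ε : ℝ) (h : s1 < s2) (hε : 0 < ε) (hε1 : ε < 1) : ∃ φ : ℝ → ℝ,
    ContDiff ℝ (⊤ : ℕ∞) φ ∧ (∀ s ≤ s1, φ s = 0) ∧ (∀ s, 0 ≤ φ s) ∧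
    (∀ s, 0 ≤ deriv φ s ∧ deriv φ s ≤ 1) ∧ (∀ s, s ∉ Ioo s1 s2 → deriv φ s = 0) ∧
    ∀ s ≥ s2, (1 - ε) * (s2 - s1) ≤ φ s := by
  set d := (s2 - s1) / 2 with hd
  have hd0 : 0 < d := by rw [hd]; linarith
  let f : ContDiffBump ((s1 + s2) / 2 : ℝ) :=
    { rIn := (1 - ε) * d
      rOut := d
      rIn_pos := by apply _root_.mul_pos <;> linarith
      rIn_lt_rOut := by nlinarith }
  have hfc : Continuous f := f.continuous
  have hder : ∀ s, HasDerivAt (fun s => ∫ t in s1..s, f t) (f s) s := fun s =>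
    intervalIntegral.integral_hasDerivAt_right (hfc.intervalIntegrable _ _)
      (hfc.stronglyMeasurableAtFilter _ _) hfc.continuousAt
  have hderiv : deriv (fun s => ∫ t in s1..s, f t) = f := funext fun s => (hder s).deriv
  have hzero : ∀ s, s ∉ Ioo s1 s2 → f s = 0 := by
    intro s hs
    have : s ∉ Function.support f := by
      rw [f.support_eq, Real.ball_eq_Ioo]
      convert hs using 3
      · show (s1 + s2) / 2 - d = s1
        rw [hd]; ring
      · show (s1 + s2) / 2 + d = s2
        rw [hd]; ring
    simpa using this
  have hlow : ∀ s ≤ s1, (∫ t in s1..s, f t) = 0 := by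
    intro s hs
    rw [intervalIntegral.integral_congr (g := fun _ => (0:ℝ))]
    · simp
    · intro t ht
      rw [uIcc_of_ge hs] at ht
      exact hzero t (fun h' => by have := h'.1; have := ht.2; linarith)
  refine ⟨fun s => ∫ t in s1..s, f t, ?_, hlow, ?_, ?_, ?_, ?_⟩
  · have : ContDiff ℝ ((⊤ : ℕ∞) : WithTop ℕ∞) (fun s => ∫ t in s1..s, f t) := by
      rw [contDiff_infty_iff_deriv]
      refine ⟨fun s => (hder s).differentiableAt, ?_⟩
      rw [hderiv]
      exact f.contDiff
    exact this
  · intro s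
    rcases le_total s s1 with h' | h'
    · exact (hlow s h').ge
    · exact intervalIntegral.integral_nonneg h' (fun t _ => f.nonneg)
  · intro s
    rw [hderiv]
    exact ⟨f.nonneg, f.le_one⟩
  · intro s hs
    rw [hderiv]
    exact hzero s hs
  · intro s hs
    have hm : (1 - ε) * d ≤ d := by nlinarith
    have h0 : 0 ≤ (1 - ε) * d := by apply mul_nonneg <;> linarith
    calc (1 - ε) * (s2 - s1) = ∫ t in ((s1 + s2) / 2 - (1 - ε) * d)..((s1 + s2) / 2 + (1 - ε) * d), (1:ℝ) := by
          rw [intervalIntegral.integral_const, smul_eq_mul, mul_one, hd]; ring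
      _ = ∫ t in ((s1 + s2) / 2 - (1 - ε) * d)..((s1 + s2) / 2 + (1 - ε) * d), f t := by
          apply intervalIntegral.integral_congr
          intro t ht
          rw [uIcc_of_le (by linarith)] at ht
          symm
          apply f.one_of_mem_closedBall
          rw [Real.closedBall_eq_Icc]
          exact ht
      _ ≤ ∫ t in s1..s, f t := by
          apply intervalIntegral.integral_mono_interval
          · rw [hd] at hm ⊢; linarith
          · linarith
          · rw [hd] at hm ⊢; linarith
          · exact Filter.Eventually.of_forall (fun t => f.nonneg)
          · exact hfc.intervalIntegrable _ _

section
variable {n : ℕ}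

local notation "𝔼" => EuclideanSpace ℝ (Fin n)

lemma trunc_fun (u : 𝔼 → ℝ) (hu : ContDiff ℝ (⊤ : ℕ∞) u) (hc : HasCompactSupport u)
    (s1 s2 ε : ℝ) (h0 : 0 ≤ s1) (h : s1 < s2) (hε : 0 < ε) (hε1 : ε < 1) : ∃ w : 𝔼 → ℝ,
    ContDiff ℝ (⊤ : ℕ∞) w ∧ HasCompactSupport w ∧ tsupport w ⊆ tsupport u ∧ (∀ x, 0 ≤ w x) ∧
    (∀ x, ¬ (s1 < u x ∧ u x < s2) → fderiv ℝ w x = 0) ∧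
    (∀ x, ‖fderiv ℝ w x‖ ≤ ‖fderiv ℝ u x‖) ∧
    ∀ x, s2 ≤ u x → (1 - ε) * (s2 - s1) ≤ w x := by
  obtain ⟨φ, p1, p2, p3, p4, p5, p6⟩ := trunc_exists s1 s2 ε h hε hε1
  have hφ0 : φ 0 = 0 := p2 0 h0
  have hd : ∀ x, fderiv ℝ (φ ∘ u) x = (deriv φ (u x)) • fderiv ℝ u x := by
    intro x
    have h1 : HasDerivAt φ (deriv φ (u x)) (u x) :=
      ((p1.differentiable (by simp)) (u x)).hasDerivAt
    have h2 : HasFDerivAt u (fderiv ℝ u x) x := ((hu.differentiable (by simp)) x).hasFDerivAt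
    exact (h1.comp_hasFDerivAt x h2).fderiv
  refine ⟨φ ∘ u, p1.comp hu, hc.comp_left hφ0, ?_, fun x => p3 _, ?_, ?_, fun x hx => p6 _ hx⟩
  · apply closure_mono
    intro x hx hx'
    apply hx
    simp only [Function.comp, hx', hφ0]
  · intro x hx
    rw [hd, p5 _ hx, zero_smul]
  · intro x
    rw [hd, norm_smul, Real.norm_eq_abs, abs_of_nonneg (p4 _).1]
    exact mul_le_of_le_one_left (norm_nonneg _) (p4 _).2

lemma weak_est2 (hn : 2 ≤ n) (v : 𝔼 → ℝ) (hv : ContDiff ℝ 1 v) (hc : HasCompactSupport v)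
    (S A : Set 𝔼) (hSm : MeasurableSet S) (hA : MeasurableSet A) (t1 t2 : ℝ) (ht2 : 0 < t2) (ht : t2 ≤ t1)
    (hS : volume S = ENNReal.ofReal t2)
    (hvol : volume A ≤ ENNReal.ofReal t1)
    (c : ℝ) (hc0 : 0 ≤ c) (hcS : ∀ x ∈ S, c ≤ v x) (hsupp : ∀ x ∉ A, fderiv ℝ v x = 0)
    (e : ℝ) (he : 0 ≤ e) (hE : ∫⁻ x in A, ‖fderiv ℝ v x‖ₑ ^ n ≤ ENNReal.ofReal e) :
    gammaMT n * c ^ (pc n) ≤ (Real.log (t1 / t2) + C0 n) * e ^ (1 / ((n:ℝ) - 1)) := by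
  have hω := sphereArea_pos n (by omega)
  have hn0 : (0:ℝ) < n := by positivity
  have hne : n ≠ 0 := by omega
  have key : ∀ t : ℝ, 0 < t → sphereArea n * ((n * t / sphereArea n) ^ (1 / (n:ℝ))) ^ n / n = t := by
    intro t ht
    rw [one_div, Real.rpow_inv_natCast_pow (by positivity) hne]
    field_simp
  have := weak_est hn v hv hc S A hSm hA ((n * t2 / sphereArea n) ^ (1 / (n:ℝ)))
    ((n * t1 / sphereArea n) ^ (1 / (n:ℝ))) (by positivity) (by gcongr)
    (by rw [key t2 ht2, hS]) (by rw [key t1 (by linarith)]; exact hvol) c hc0 hcS hsupp e he hE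
  rw [← Real.div_rpow (by have : 0 < t1 := by linarith
                          positivity) (by positivity)] at this
  have h1 : n * t1 / sphereArea n / (n * t2 / sphereArea n) = t1 / t2 := by field_simp
  rw [h1, Real.log_rpow (div_pos (by linarith) ht2), ← mul_assoc, mul_one_div_cancel hn0.ne', one_mul] at this
  exact this

lemma level_est (hn : 2 ≤ n) (u : 𝔼 → ℝ) (hu : ContDiff ℝ (⊤ : ℕ∞) u) (hc : HasCompactSupport u)
    (s1 s2 : ℝ) (h0 : 0 ≤ s1) (h : s1 < s2) (t1 t2 : ℝ) (ht2 : 0 < t2)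
    (hA : volume {x | s1 < u x} ≤ ENNReal.ofReal t1)
    (hS : volume {x | s2 ≤ u x} = ENNReal.ofReal t2)
    (e : ℝ) (he : 0 ≤ e)
    (hE : ∫⁻ x in {x | s1 < u x ∧ u x < s2}, ‖fderiv ℝ u x‖ₑ ^ n ≤ ENNReal.ofReal e) :
    gammaMT n * (s2 - s1) ^ (pc n) ≤ (Real.log (t1 / t2) + C0 n) * e ^ (1 / ((n:ℝ) - 1)) := by
  have huc := hu.continuous
  have ht : t2 ≤ t1 := by
    have h1 : ENNReal.ofReal t2 ≤ ENNReal.ofReal t1 := by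
      rw [← hS]
      refine le_trans (measure_mono ?_) hA
      intro x hx
      exact lt_of_lt_of_le h hx
    have h2 : 0 < ENNReal.ofReal t1 := lt_of_lt_of_le (ENNReal.ofReal_pos.2 ht2) h1
    exact (ENNReal.ofReal_le_ofReal_iff (ENNReal.ofReal_pos.1 h2).le).1 h1
  have key : ∀ ε ∈ Ioo (0:ℝ) 1, gammaMT n * ((1 - ε) * (s2 - s1)) ^ (pc n) ≤
      (Real.log (t1 / t2) + C0 n) * e ^ (1 / ((n:ℝ) - 1)) := by
    intro ε hε
    obtain ⟨w, w1, w2, w3, w4, w5, w6, w7⟩ := trunc_fun u hu hc s1 s2 ε h0 h hε.1 hε.2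
    apply weak_est2 hn w (w1.of_le (by simp)) w2 {x | s2 ≤ u x} {x | s1 < u x ∧ u x < s2}
      (isClosed_le continuous_const huc).measurableSet
      ((isOpen_lt continuous_const huc).inter (isOpen_lt huc continuous_const)).measurableSet t1 t2 ht2 ht hS
    · exact le_trans (measure_mono (fun x hx => hx.1)) hA
    · apply mul_nonneg <;> linarith [hε.2]
    · exact w7
    · exact w5
    · exact he
    · refine le_trans (lintegral_mono (fun x => ?_)) hE
      gcongr
      exact enorm_le_iff_norm_le.2 (w6 x)
  have hp := pc_gt n hn
  have hcont : Filter.Tendsto (fun ε : ℝ => gammaMT n * ((1 - ε) * (s2 - s1)) ^ (pc n))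
      (nhdsWithin 0 (Ioi 0)) (nhds (gammaMT n * ((1 - 0) * (s2 - s1)) ^ (pc n))) := by
    apply Filter.Tendsto.mono_left _ nhdsWithin_le_nhds
    apply Filter.Tendsto.const_mul
    apply Filter.Tendsto.rpow_const
    · exact (by fun_prop : Continuous (fun ε : ℝ => (1 - ε) * (s2 - s1))).tendsto 0
    · right; linarith
  rw [sub_zero, one_mul] at hcont
  refine le_of_tendsto hcont ?_
  filter_upwards [Ioo_mem_nhdsGT (zero_lt_one (α := ℝ))] with ε hε
  exact key ε hε

end

lemma gammaMT_pos (n : ℕ) (hn : 2 ≤ n) : 0 < gammaMT n := by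
  have := sphereArea_pos n (by omega)
  unfold gammaMT
  positivity

section
variable {n : ℕ}

local notation "𝔼" => EuclideanSpace ℝ (Fin n)

lemma mt_core (hn : 2 ≤ n) : ∃ C : ℝ, 0 ≤ C ∧ ∀ (u : 𝔼 → ℝ), ContDiff ℝ (⊤ : ℕ∞) u → HasCompactSupport u →
    ∀ t0 : ℝ, 0 ≤ t0 → volume {x | t0 < u x} ≤ 1 →
    ∫⁻ x in {x | t0 < u x}, ‖fderiv ℝ u x‖ₑ ^ n ≤ 1 →
    ∫⁻ x in {x | t0 < u x}, ENNReal.ofReal (Real.exp (gammaMT n * (u x - t0) ^ (pc n))) ≤ ENNReal.ofReal C := by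
  obtain ⟨C', hC', hcore⟩ := core_sum n hn (C0 n) (C0_ge hn)
  refine ⟨Real.exp 1 * (1 + C'), by positivity, ?_⟩
  intro u hu hc t0 ht0 hvol hE
  have huc := hu.continuous
  have hγ := gammaMT_pos n hn
  have hp := pc_gt n hn
  have hp0 : 0 < pc n := by linarith
  set γ := gammaMT n with hγdef
  set p := pc n with hpdef
  obtain ⟨M, hM⟩ : ∃ M : ℝ, ∀ x, u x ≤ M := by
    obtain ⟨M, hM⟩ := hc.exists_bound_of_continuous huc
    exact ⟨M, fun x => (le_abs_self _).trans (hM x)⟩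
  set N := ⌈γ * (max (M - t0) 0) ^ p⌉₊ with hN
  set s : ℕ → ℝ := fun k => t0 + (k / γ) ^ (1 / p) with hs
  set m : ℕ → ℝ≥0∞ := fun k => volume {x | s k ≤ u x} with hm
  have hspos : ∀ k : ℕ, 1 ≤ k → t0 < s k := by
    intro k hk
    have : (0:ℝ) < k := by exact_mod_cast hk
    simp only [hs]
    have : 0 < (k / γ) ^ (1 / p) := by positivity
    linarith
  have hm1 : ∀ k : ℕ, 1 ≤ k → m k ≤ 1 := by
    intro k hk
    refine le_trans (measure_mono ?_) hvol
    intro x hx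
    exact lt_of_lt_of_le (hspos k hk) hx
  have hmeas : ∀ k, MeasurableSet {x | s k ≤ u x} := fun k => (isClosed_le continuous_const huc).measurableSet
  have hmeasA : MeasurableSet {x | t0 < u x} := (isOpen_lt continuous_const huc).measurableSet
  -- pointwise bound
  have hpt : ∀ x ∈ {x | t0 < u x}, ENNReal.ofReal (Real.exp (γ * (u x - t0) ^ p)) ≤
      ENNReal.ofReal (Real.exp 1) + ∑ k ∈ Finset.Icc 1 N,
        ({x | s k ≤ u x}).indicator (fun _ => ENNReal.ofReal (Real.exp (k + 1))) x := by
    intro x hx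
    have hx' : t0 < u x := hx
    set y := γ * (u x - t0) ^ p with hy
    have hy0 : 0 ≤ y := by
      have : 0 ≤ u x - t0 := by linarith
      positivity
    have hyN : y ≤ N := by
      refine le_trans ?_ (Nat.le_ceil _)
      rw [hy]
      have h7 : u x - t0 ≤ max (M - t0) 0 := le_max_of_le_left (by linarith [hM x])
      gcongr
    set k := ⌊y⌋₊ with hk
    have hk1 : (k:ℝ) ≤ y := Nat.floor_le hy0
    have hk2 : y < k + 1 := Nat.lt_floor_add_one y
    rcases Nat.eq_zero_or_pos k with h | h
    · refine le_trans ?_ le_self_add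
      apply ENNReal.ofReal_le_ofReal
      apply Real.exp_le_exp.2
      rw [h] at hk2
      simp at hk2
      linarith
    · refine le_trans ?_ le_add_self
      have hkN : k ∈ Finset.Icc 1 N := by
        rw [Finset.mem_Icc]
        refine ⟨h, ?_⟩
        have : (k:ℝ) ≤ N := hk1.trans hyN
        exact_mod_cast this
      refine le_trans ?_ (Finset.single_le_sum (fun _ _ => zero_le) hkN)
      have hmem : x ∈ {x | s k ≤ u x} := by
        show t0 + (k / γ) ^ (1 / p) ≤ u x
        have h2 : (k / γ) ≤ (u x - t0) ^ p := by
          rw [div_le_iff₀ hγ]; linarith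
        have h3 := Real.rpow_le_rpow (by positivity) h2 (by positivity : 0 ≤ 1 / p)
        rw [← Real.rpow_mul (by linarith), mul_one_div_cancel hp0.ne', Real.rpow_one] at h3
        linarith
      rw [indicator_of_mem hmem]
      apply ENNReal.ofReal_le_ofReal
      apply Real.exp_le_exp.2
      linarith
  have hintg : ∫⁻ x in {x | t0 < u x}, ENNReal.ofReal (Real.exp (γ * (u x - t0) ^ p)) ≤
      ENNReal.ofReal (Real.exp 1) + ∑ k ∈ Finset.Icc 1 N, ENNReal.ofReal (Real.exp (k + 1)) * m k := by
    refine (setLIntegral_mono' hmeasA hpt).trans ?_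
    rw [lintegral_add_left measurable_const, lintegral_const, Measure.restrict_apply_univ,
      lintegral_finsetSum _ (fun k _ => measurable_const.indicator (hmeas k))]
    gcongr with k hk
    · exact mul_le_of_le_one_right zero_le hvol
    · rw [lintegral_indicator_const (hmeas k)]
      gcongr
      exact Measure.restrict_apply_le _ _
  set S := (Finset.Icc 1 N).filter (fun k => m k ≠ 0) with hS
  set τ : ℕ → ℝ := fun k => - Real.log (m k).toReal with hτ
  have hS1 : ∀ k ∈ S, 1 ≤ k := fun k hk => (Finset.mem_Icc.1 (Finset.mem_filter.1 hk).1).1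
  have hmS : ∀ k ∈ S, 0 < (m k).toReal := fun k hk =>
    ENNReal.toReal_pos (Finset.mem_filter.1 hk).2 (ne_top_of_le_ne_top one_ne_top (hm1 k (hS1 k hk)))
  have hmS' : ∀ k ∈ S, m k = ENNReal.ofReal (m k).toReal := fun k hk =>
    (ENNReal.ofReal_toReal (ne_top_of_le_ne_top one_ne_top (hm1 k (hS1 k hk)))).symm
  set ε : ℕ → ℝ := fun k => (∫⁻ x in {x | t0 < u x ∧ u x < s k}, ‖fderiv ℝ u x‖ₑ ^ n).toReal with hε
  have hεI : ∀ k, (∫⁻ x in {x | t0 < u x ∧ u x < s k}, ‖fderiv ℝ u x‖ₑ ^ n) ≤ 1 := fun k =>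
    (lintegral_mono_set (fun x hx => hx.1)).trans hE
  have hεeq : ∀ k, (∫⁻ x in {x | t0 < u x ∧ u x < s k}, ‖fderiv ℝ u x‖ₑ ^ n) = ENNReal.ofReal (ε k) := fun k =>
    (ENNReal.ofReal_toReal (ne_top_of_le_ne_top one_ne_top (hεI k))).symm
  have hε1 : ∀ k, ε k ≤ 1 := fun k => ENNReal.toReal_le_of_le_ofReal zero_le_one (by simpa using hεI k)
  have hε0 : ∀ k, 0 ≤ ε k := fun k => ENNReal.toReal_nonneg
  have hpw : ∀ a : ℝ, 0 ≤ a → γ * (a / γ ^ (1 / p)) ^ p = a ^ p := by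
    intro a ha
    rw [Real.div_rpow ha (by positivity), ← Real.rpow_mul hγ.le, one_div_mul_cancel hp0.ne', Real.rpow_one]
    field_simp
  have hroot : ∀ k : ℕ, ((k:ℝ) / γ) ^ (1 / p) = (k:ℝ) ^ (1 / p) / γ ^ (1 / p) := fun k =>
    Real.div_rpow (by positivity) hγ.le _
  have hfin := hcore S τ ε hS1 (fun k _ => hε0 k) (fun k _ => hε1 k) ?_ ?_
  · refine hintg.trans ?_
    have hsum : ∑ k ∈ Finset.Icc 1 N, ENNReal.ofReal (Real.exp (k + 1)) * m k =
        ENNReal.ofReal (Real.exp 1 * ∑ k ∈ S, Real.exp (k - τ k)) := by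
      rw [Finset.mul_sum, ENNReal.ofReal_sum_of_nonneg (fun k _ => by positivity)]
      rw [hS, Finset.sum_filter]
      apply Finset.sum_congr rfl
      intro k hk
      split_ifs with h
      · have hkS : k ∈ S := Finset.mem_filter.2 ⟨hk, h⟩
        rw [hmS' k hkS, ← ENNReal.ofReal_mul (by positivity)]
        congr 1
        simp only [hτ]
        rw [← Real.exp_add]
        conv_lhs => rw [← Real.exp_log (hmS k hkS), ← Real.exp_add]
        congr 1
        ring
      · push Not at h
        rw [h, mul_zero]
    have hnn : 0 ≤ ∑ k ∈ S, Real.exp (k - τ k) := Finset.sum_nonneg (fun k _ => (Real.exp_pos _).le)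
    rw [hsum, ← ENNReal.ofReal_add (Real.exp_pos _).le (mul_nonneg (Real.exp_pos _).le hnn)]
    apply ENNReal.ofReal_le_ofReal
    rw [mul_add, mul_one]
    gcongr
  · intro k hk
    have := level_est hn u hu hc t0 (s k) ht0 (hspos k (hS1 k hk)) 1 (m k).toReal (hmS k hk)
      (by simpa using hvol) (hmS' k hk) (ε k) (hε0 k) (hεeq k).le
    have h1 : s k - t0 = (k:ℝ) ^ (1 / p) / γ ^ (1 / p) := by
      rw [← hroot]; simp only [hs]; ring
    rw [h1, ← hγdef, ← hpdef, hpw _ (by positivity), ← Real.rpow_mul (by positivity),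
      one_div_mul_cancel hp0.ne', Real.rpow_one, one_div, Real.log_inv] at this
    exact this
  · intro k1 hk1 k2 hk2 hlt
    have hss : s k1 < s k2 := by
      simp only [hs]
      gcongr
    have := level_est hn u hu hc (s k1) (s k2) (ht0.trans (hspos k1 (hS1 k1 hk1)).le) hss
      (m k1).toReal (m k2).toReal (hmS k2 hk2)
      (by rw [← hmS' k1 hk1]; exact measure_mono (fun x (hx : s k1 < u x) => hx.le))
      (hmS' k2 hk2) (1 - ε k1) (by linarith [hε1 k1]) ?_
    · have h1 : s k2 - s k1 = ((k2:ℝ) ^ (1 / p) - (k1:ℝ) ^ (1 / p)) / γ ^ (1 / p) := by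
        simp only [hs]; rw [hroot, hroot]; ring
      have h2 : 0 ≤ (k2:ℝ) ^ (1 / p) - (k1:ℝ) ^ (1 / p) := by
        apply sub_nonneg.2
        gcongr
      rw [h1, ← hγdef, ← hpdef, hpw _ h2, Real.log_div (hmS k1 hk1).ne' (hmS k2 hk2).ne'] at this
      have h3 : τ k2 - τ k1 = Real.log (m k1).toReal - Real.log (m k2).toReal := by
        simp only [hτ]; ring
      rw [h3]
      exact this
    · rw [ENNReal.ofReal_sub _ (hε0 k1), ENNReal.ofReal_one, ← hεeq k1]
      apply ENNReal.le_sub_of_add_le_left (ne_top_of_le_ne_top one_ne_top (hεI k1))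
      rw [← lintegral_union]
      · refine (lintegral_mono_set ?_).trans hE
        rintro x (hx | hx)
        · exact hx.1
        · exact (hspos k1 (hS1 k1 hk1)).trans hx.1
      · exact ((isOpen_lt continuous_const huc).inter (isOpen_lt huc continuous_const)).measurableSet
      · rw [Set.disjoint_left]
        intro x hx hx'
        exact lt_asymm hx.2 hx'.1

lemma mt_scaled (hn : 2 ≤ n) : ∃ C : ℝ, 0 ≤ C ∧ ∀ (u : 𝔼 → ℝ), ContDiff ℝ (⊤ : ℕ∞) u → HasCompactSupport u →
    ∀ t0 : ℝ, 0 ≤ t0 → volume {x | t0 < u x} ≤ 1 → ∀ a : ℝ, 0 < a →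
    ∫⁻ x in {x | t0 < u x}, ‖fderiv ℝ u x‖ₑ ^ n ≤ ENNReal.ofReal (a ^ n) →
    ∫⁻ x in {x | t0 < u x}, ENNReal.ofReal (Real.exp (gammaMT n * ((u x - t0) / a) ^ (pc n))) ≤ ENNReal.ofReal C := by
  obtain ⟨C, hC, h⟩ := mt_core hn
  refine ⟨C, hC, ?_⟩
  intro u hu hc t0 ht0 hvol a ha hE
  have hset : {x | t0 / a < (a⁻¹ • u) x} = {x | t0 < u x} := by
    ext x
    simp only [mem_ofPred_eq, Pi.smul_apply, smul_eq_mul]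
    rw [div_lt_iff₀ ha]
    field_simp
  have := h (a⁻¹ • u) (contDiff_const.smul hu) (hc.smul_left (f := fun _ => a⁻¹)) (t0 / a) (by positivity)
    (by rw [hset]; exact hvol) ?_
  · rw [hset] at this
    refine le_trans (le_of_eq ?_) this
    congr 1
    ext x
    simp only [Pi.smul_apply, smul_eq_mul]
    congr 5
    field_simp
  · rw [hset]
    have hd : ∀ x, ‖fderiv ℝ (a⁻¹ • u) x‖ₑ ^ n = ENNReal.ofReal ((a⁻¹) ^ n) * ‖fderiv ℝ u x‖ₑ ^ n := by
      intro x
      rw [fderiv_const_smul ((hu.differentiable (by simp)) x), ← ofReal_norm, ← ofReal_norm, norm_smul,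
        ← ENNReal.ofReal_pow (by positivity), ← ENNReal.ofReal_pow (by positivity),
        ← ENNReal.ofReal_mul (by positivity), mul_pow, Real.norm_eq_abs, abs_of_pos (inv_pos.2 ha)]
    simp only [hd]
    rw [lintegral_const_mul' _ _ ENNReal.ofReal_ne_top]
    calc _ ≤ ENNReal.ofReal ((a⁻¹) ^ n) * ENNReal.ofReal (a ^ n) := by gcongr
      _ = 1 := by
        rw [← ENNReal.ofReal_mul (by positivity), ← mul_pow, inv_mul_cancel₀ ha.ne', one_pow, ENNReal.ofReal_one]
end

lemma expRem_le (m : ℕ) (t : ℝ) (ht : 0 ≤ t) : expRem m t ≤ t ^ (m + 1) * Real.exp t := by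
  have h := Complex.norm_exp_sub_sum_le_norm_mul_exp (t : ℂ) (m + 1)
  have h1 : (Complex.exp (t:ℂ) - ∑ k ∈ Finset.range (m + 1), (t:ℂ) ^ k / (Nat.factorial k : ℂ)) =
      ((expRem m t : ℝ) : ℂ) := by
    unfold expRem
    push_cast
    rfl
  rw [h1, Complex.norm_real, Complex.norm_real, Real.norm_eq_abs, Real.norm_eq_abs, abs_of_nonneg ht] at h
  exact (le_abs_self _).trans h

lemma expRem_le_exp (m : ℕ) (t : ℝ) (ht : 0 ≤ t) : expRem m t ≤ Real.exp t := by
  unfold expRem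
  have : 0 ≤ ∑ k ∈ Finset.range (m + 1), t ^ k / (Nat.factorial k : ℝ) :=
    Finset.sum_nonneg (fun k _ => by positivity)
  linarith

lemma expRem_ge (m : ℕ) (t : ℝ) (ht : 0 ≤ t) : t ^ (m + 1) / (Nat.factorial (m + 1)) ≤ expRem m t := by
  have := Real.sum_le_exp_of_nonneg ht (m + 2)
  rw [Finset.sum_range_succ] at this
  unfold expRem
  linarith

lemma expRem_zero (m : ℕ) : expRem m 0 = 0 := by
  unfold expRem
  rw [Finset.sum_range_succ']
  simp

lemma gpow (n : ℕ) (hn : 2 ≤ n) (g x : ℝ) (hx : 0 ≤ x) :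
    (g * x ^ (pc n)) ^ (n - 2 + 1) = g ^ (n - 1) * x ^ n := by
  rw [show n - 2 + 1 = n - 1 by omega, mul_pow, ← Real.rpow_natCast (x ^ pc n), ← Real.rpow_mul hx, mul_comm (pc n),
    pc_mul n hn, Real.rpow_natCast]

section
variable {n : ℕ}

local notation "𝔼" => EuclideanSpace ℝ (Fin n)

lemma grad_en (hn : 2 ≤ n) (Ω : Set 𝔼) (u : 𝔼 → ℝ) (hu : ContDiff ℝ (⊤ : ℕ∞) u) (hc : HasCompactSupport u)
    (hΩ : tsupport u ⊆ Ω) :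
    ENNReal.ofReal (∫ x in Ω, ‖fderiv ℝ u x‖ ^ n) = ∫⁻ x, ‖fderiv ℝ u x‖ₑ ^ n := by
  have hz : ∀ x, x ∉ Ω → ‖fderiv ℝ u x‖ ^ n = 0 := by
    intro x hx
    have : x ∉ tsupport (fderiv ℝ u) := fun h => hx (hΩ (tsupport_fderiv_subset ℝ h))
    rw [image_eq_zero_of_notMem_tsupport this, norm_zero, zero_pow (by omega)]
  rw [setIntegral_eq_integral_of_forall_compl_eq_zero hz]
  have hcont : Continuous (fderiv ℝ u) := hu.continuous_fderiv (by simp)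
  have hcs : HasCompactSupport (fun x => ‖fderiv ℝ u x‖ ^ n) :=
    (hc.fderiv (𝕜 := ℝ)).comp_left (g := fun L => ‖L‖ ^ n) (by rw [norm_zero, zero_pow (by omega)])
  have hintg : Integrable (fun x => ‖fderiv ℝ u x‖ ^ n) :=
    (hcont.norm.pow n).integrable_of_hasCompactSupport hcs
  rw [ofReal_integral_eq_lintegral_ofReal hintg
    (Filter.Eventually.of_forall (fun x => by positivity))]
  congr 1
  ext x
  rw [ENNReal.ofReal_pow (norm_nonneg _), ofReal_norm]

lemma u_int (hn : 2 ≤ n) (u : 𝔼 → ℝ) (hu : ContDiff ℝ (⊤ : ℕ∞) u) (hc : HasCompactSupport u) :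
    Integrable (fun x => |u x| ^ n) := by
  have hcs : HasCompactSupport (fun x => |u x| ^ n) :=
    hc.comp_left (g := fun y : ℝ => |y| ^ n) (by simp; omega)
  exact ((hu.continuous.abs.pow n).integrable_of_hasCompactSupport hcs)

lemma u_en (hn : 2 ≤ n) (Ω : Set 𝔼) (u : 𝔼 → ℝ) (hu : ContDiff ℝ (⊤ : ℕ∞) u) (hc : HasCompactSupport u)
    (hΩ : tsupport u ⊆ Ω) :
    ENNReal.ofReal (∫ x in Ω, |u x| ^ n) = ∫⁻ x, ENNReal.ofReal (|u x| ^ n) := by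
  have hz : ∀ x, x ∉ Ω → |u x| ^ n = 0 := by
    intro x hx
    have : x ∉ tsupport u := fun h => hx (hΩ h)
    rw [image_eq_zero_of_notMem_tsupport this, abs_zero, zero_pow (by omega)]
  rw [setIntegral_eq_integral_of_forall_compl_eq_zero hz,
    ofReal_integral_eq_lintegral_ofReal (u_int hn u hu hc)
    (Filter.Eventually.of_forall (fun x => by positivity))]

lemma exists_level (u : 𝔼 → ℝ) (hu : Continuous u) (hc : HasCompactSupport u) :
    ∃ t0 : ℝ, 0 ≤ t0 ∧ volume {x | t0 < u x} ≤ 1 ∧ ∀ t, 0 < t → t < t0 → 1 ≤ volume {x | t ≤ u x} := by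
  obtain ⟨M, hM⟩ : ∃ M : ℝ, ∀ x, u x ≤ M := by
    obtain ⟨M, hM⟩ := hc.exists_bound_of_continuous hu
    exact ⟨M, fun x => (le_abs_self _).trans (hM x)⟩
  set T : Set ℝ := {t | 0 ≤ t ∧ volume {x | t < u x} ≤ 1} with hT
  have hne : T.Nonempty := by
    refine ⟨max M 0, le_max_right _ _, ?_⟩
    have : {x | max M 0 < u x} = ∅ := by
      ext x
      simp only [mem_ofPred_eq, mem_empty_iff_false, iff_false, not_lt]
      exact (hM x).trans (le_max_left _ _)
    rw [this]; simp
  have hb : BddBelow T := ⟨0, fun t ht => ht.1⟩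
  refine ⟨sInf T, le_csInf hne (fun t ht => ht.1), ?_, ?_⟩
  · have hU : {x | sInf T < u x} = ⋃ k : ℕ, {x | sInf T + 1 / ((k:ℝ) + 1) < u x} := by
      ext x
      simp only [mem_ofPred_eq, mem_iUnion]
      constructor
      · intro h
        obtain ⟨k, hk⟩ := exists_nat_one_div_lt (sub_pos.2 h)
        exact ⟨k, by linarith⟩
      · rintro ⟨k, hk⟩
        have : 0 < 1 / ((k:ℝ) + 1) := by positivity
        linarith
    have hmono : Monotone (fun k : ℕ => {x | sInf T + 1 / ((k:ℝ) + 1) < u x}) := by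
      intro k l hkl x hx
      have hx' : sInf T + 1 / ((k:ℝ) + 1) < u x := hx
      show sInf T + 1 / ((l:ℝ) + 1) < u x
      have : 1 / ((l:ℝ) + 1) ≤ 1 / ((k:ℝ) + 1) := Nat.one_div_le_one_div hkl
      linarith
    rw [hU, hmono.measure_iUnion]
    apply iSup_le
    intro k
    obtain ⟨t, ht, htk⟩ := exists_lt_of_csInf_lt hne
      (show sInf T < sInf T + 1 / ((k:ℝ) + 1) by
        have : 0 < 1 / ((k:ℝ) + 1) := by positivity
        linarith)
    refine le_trans (measure_mono ?_) ht.2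
    intro x hx
    exact lt_trans htk hx
  · intro t ht htt
    have h1 : t ∉ T := notMem_of_lt_csInf htt hb
    have h2 : ¬ volume {x | t < u x} ≤ 1 := fun h => h1 ⟨ht.le, h⟩
    exact (not_le.1 h2).le.trans (measure_mono (fun x (hx : t < u x) => hx.le))

lemma mt_half (hn : 2 ≤ n) (K : ℝ) (hK : 0 < K) : ∃ C : ℝ, 0 ≤ C ∧ ∀ (u : 𝔼 → ℝ), ContDiff ℝ (⊤ : ℕ∞) u →
    HasCompactSupport u → (∀ w : 𝔼 → ℝ, ContDiff ℝ (⊤ : ℕ∞) w → HasCompactSupport w → tsupport w ⊆ tsupport u →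
      ∫⁻ x, ENNReal.ofReal (|w x| ^ n) ≤ ENNReal.ofReal K * ∫⁻ x, ‖fderiv ℝ w x‖ₑ ^ n) →
    ∫⁻ x, ‖fderiv ℝ u x‖ₑ ^ n ≤ 1 →
    ∫⁻ x in {x | 0 < u x}, ENNReal.ofReal (expRem (n - 2) (gammaMT n * |u x| ^ (pc n))) ≤ ENNReal.ofReal C := by
  obtain ⟨C1, hC1, hcore⟩ := mt_scaled hn
  have hγ := gammaMT_pos n hn
  have hp := pc_gt n hn
  have hp0 : 0 < pc n := by linarith
  set γ := gammaMT n with hγdef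
  set p := pc n with hpdef
  have hne : n ≠ 0 := by omega
  set L : ℝ := 1 / (2 * K) with hL
  have hL0 : 0 < L := by positivity
  set B := γ * (L⁻¹ ^ (1 / (n:ℝ))) ^ p with hB
  set B2 := γ * (K ^ (1 / (n:ℝ))) ^ p with hB2
  refine ⟨Real.exp B * C1 + γ ^ (n - 1) * Real.exp B2 * K, by positivity, ?_⟩
  intro u hu hc hP hE
  have huc := hu.continuous
  obtain ⟨t0, ht0, hvol, hlev⟩ := exists_level u huc hc
  have hm1 : MeasurableSet {x | t0 < u x} := (isOpen_lt continuous_const huc).measurableSet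
  set G := ∫⁻ x in {x | t0 < u x}ᶜ, ‖fderiv ℝ u x‖ₑ ^ n with hG
  have hsplit : (∫⁻ x in {x | t0 < u x}, ‖fderiv ℝ u x‖ₑ ^ n) + G ≤ 1 := by
    rw [hG, lintegral_add_compl _ hm1]
    exact hE
  have hG1 : G ≤ 1 := le_trans le_add_self hsplit
  have hGtop : G ≠ ∞ := ne_top_of_le_ne_top one_ne_top hG1
  set g := G.toReal with hg
  have hg0 : 0 ≤ g := ENNReal.toReal_nonneg
  have hGg : G = ENNReal.ofReal g := (ENNReal.ofReal_toReal hGtop).symm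
  have hg1 : g ≤ 1 := ENNReal.toReal_le_of_le_ofReal zero_le_one (by simpa using hG1)
  have hstep : ∀ s, 0 < s → s < t0 → s ^ n ≤ K * g := by
    intro s hs hst
    set t := (s + t0) / 2 with ht
    have ht1 : s < t := by rw [ht]; linarith
    have ht2 : t < t0 := by rw [ht]; linarith
    have ht00 : 0 < t := by linarith
    have hst1 : s / t < 1 := by rw [div_lt_one ht00]; exact ht1
    have hst0 : 0 < s / t := by positivity
    obtain ⟨w, w1, w2, w3, w4, w5, w6, w7⟩ := trunc_fun u hu hc 0 t (1 - s / t) le_rfl ht00 (by linarith) (by linarith)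
    have h1 : ENNReal.ofReal (s ^ n) ≤ ∫⁻ x, ENNReal.ofReal (|w x| ^ n) := by
      calc ENNReal.ofReal (s ^ n) ≤ ENNReal.ofReal (s ^ n) * volume {x | t ≤ u x} :=
            le_mul_of_one_le_right zero_le (hlev t ht00 ht2)
        _ = ∫⁻ x in {x | t ≤ u x}, ENNReal.ofReal (s ^ n) := by rw [setLIntegral_const]
        _ ≤ ∫⁻ x in {x | t ≤ u x}, ENNReal.ofReal (|w x| ^ n) := by
            apply setLIntegral_mono' (isClosed_le continuous_const huc).measurableSet
            intro x hx
            have := w7 x hx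
            have h2 : s ≤ w x := by
              refine le_trans (le_of_eq ?_) this
              field_simp
              ring
            apply ENNReal.ofReal_le_ofReal
            rw [abs_of_nonneg (w4 x)]
            gcongr
        _ ≤ _ := setLIntegral_le_lintegral _ _
    have h3 : ∫⁻ x, ‖fderiv ℝ w x‖ₑ ^ n ≤ G := by
      rw [← lintegral_add_compl _ hm1]
      have : ∫⁻ x in {x | t0 < u x}, ‖fderiv ℝ w x‖ₑ ^ n = 0 := by
        rw [setLIntegral_congr_fun (g := fun _ => 0) hm1]
        · simp
        · intro x hx
          have hx' : t0 < u x := hx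
          have : fderiv ℝ w x = 0 := w5 x (fun h => by linarith [h.2])
          simp only []
          rw [← ofReal_norm, this, norm_zero, ENNReal.ofReal_zero, zero_pow hne]
      rw [this, zero_add]
      apply lintegral_mono
      intro x
      exact pow_le_pow_left' (enorm_le_iff_norm_le.2 (w6 x)) n
    have h4 : ENNReal.ofReal (s ^ n) ≤ ENNReal.ofReal (K * g) := by
      refine h1.trans ((hP w w1 w2 w3).trans ?_)
      rw [ENNReal.ofReal_mul hK.le, ← hGg]
      gcongr
    exact (ENNReal.ofReal_le_ofReal_iff (by positivity)).1 h4
  have ht0g : t0 ^ n ≤ K * g := by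
    rcases ht0.eq_or_lt with h | h
    · rw [← h, zero_pow hne]; positivity
    · have hcont : Filter.Tendsto (fun s : ℝ => s ^ n) (nhdsWithin t0 (Iio t0)) (nhds (t0 ^ n)) :=
        ((continuous_pow n).tendsto t0).mono_left nhdsWithin_le_nhds
      refine le_of_tendsto hcont ?_
      filter_upwards [Ioo_mem_nhdsLT h] with s hs
      exact hstep s hs.1 hs.2
  have hLg : L * t0 ^ n ≤ g / 2 := by
    calc L * t0 ^ n ≤ L * (K * g) := by gcongr
      _ = g / 2 := by rw [hL]; field_simp
  have ha0 : 0 < 1 - L * t0 ^ n := by linarith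
  set a := (1 - L * t0 ^ n) ^ (1 / (n:ℝ)) with ha
  have hapos : 0 < a := by positivity
  have han : a ^ n = 1 - L * t0 ^ n := by
    rw [ha, one_div, Real.rpow_inv_natCast_pow ha0.le hne]
  have hEa : ∫⁻ x in {x | t0 < u x}, ‖fderiv ℝ u x‖ₑ ^ n ≤ ENNReal.ofReal (a ^ n) := by
    have h1 : ∫⁻ x in {x | t0 < u x}, ‖fderiv ℝ u x‖ₑ ^ n ≤ 1 - G :=
      ENNReal.le_sub_of_add_le_right hGtop hsplit
    refine h1.trans ?_
    rw [hGg, ← ENNReal.ofReal_one, ← ENNReal.ofReal_sub _ hg0, han]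
    apply ENNReal.ofReal_le_ofReal
    linarith
  have hhigh := hcore u hu hc t0 ht0 hvol a hapos hEa
  have hint1 : ∫⁻ x in {x | t0 < u x}, ENNReal.ofReal (expRem (n - 2) (γ * |u x| ^ p)) ≤
      ENNReal.ofReal (Real.exp B * C1) := by
    rw [ENNReal.ofReal_mul (by positivity)]
    calc _ ≤ ∫⁻ x in {x | t0 < u x}, ENNReal.ofReal (Real.exp B) *
          ENNReal.ofReal (Real.exp (γ * ((u x - t0) / a) ^ p)) := by
          apply setLIntegral_mono' hm1
          intro x hx
          have hx' : t0 < u x := hx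
          have hu0 : 0 ≤ u x := by linarith
          rw [← ENNReal.ofReal_mul (by positivity), ← Real.exp_add, abs_of_nonneg hu0]
          apply ENNReal.ofReal_le_ofReal
          refine (expRem_le_exp _ _ (by positivity)).trans ?_
          apply Real.exp_le_exp.2
          have hv : 0 ≤ u x - t0 := by linarith
          have hH := two_holder_pow n hn ((u x - t0) / a) (L⁻¹ ^ (1 / (n:ℝ))) a (L ^ (1 / (n:ℝ)) * t0)
            (by positivity) (by positivity) hapos.le (by positivity)
          have e1 : (u x - t0) / a * a + L⁻¹ ^ (1 / (n:ℝ)) * (L ^ (1 / (n:ℝ)) * t0) = u x := by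
            rw [div_mul_cancel₀ _ hapos.ne', ← mul_assoc, ← Real.mul_rpow (by positivity) hL0.le,
              inv_mul_cancel₀ hL0.ne', Real.one_rpow]
            ring
          have e2 : a ^ n + (L ^ (1 / (n:ℝ)) * t0) ^ n = 1 := by
            rw [han, mul_pow, one_div, Real.rpow_inv_natCast_pow hL0.le hne]
            ring
          rw [e1, e2, Real.one_rpow, mul_one, ← hpdef] at hH
          rw [hB, ← mul_add]
          have := mul_le_mul_of_nonneg_left hH hγ.le
          linarith
      _ = ENNReal.ofReal (Real.exp B) * ∫⁻ x in {x | t0 < u x}, ENNReal.ofReal (Real.exp (γ * ((u x - t0) / a) ^ p)) :=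
          lintegral_const_mul' _ _ ENNReal.ofReal_ne_top
      _ ≤ _ := by gcongr
  have ht0K : t0 ≤ K ^ (1 / (n:ℝ)) := by
    have h1 : t0 ^ n ≤ K := ht0g.trans (mul_le_of_le_one_right hK.le hg1)
    have h2 := Real.rpow_le_rpow (by positivity) h1 (by positivity : 0 ≤ 1 / (n:ℝ))
    rw [one_div, Real.pow_rpow_inv_natCast ht0 hne] at h2
    rw [one_div]; exact h2
  have hmlow : MeasurableSet {x | 0 < u x ∧ u x ≤ t0} :=
    (isOpen_lt continuous_const huc).measurableSet.inter (isClosed_le huc continuous_const).measurableSet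
  have hint2 : ∫⁻ x in {x | 0 < u x ∧ u x ≤ t0}, ENNReal.ofReal (expRem (n - 2) (γ * |u x| ^ p)) ≤
      ENNReal.ofReal (γ ^ (n - 1) * Real.exp B2 * K) := by
    rw [ENNReal.ofReal_mul (by positivity)]
    calc _ ≤ ∫⁻ x in {x | 0 < u x ∧ u x ≤ t0}, ENNReal.ofReal (γ ^ (n - 1) * Real.exp B2) *
          ENNReal.ofReal (|u x| ^ n) := by
          apply setLIntegral_mono' hmlow
          intro x hx
          rw [← ENNReal.ofReal_mul (by positivity)]
          apply ENNReal.ofReal_le_ofReal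
          refine (expRem_le _ _ (by positivity)).trans ?_
          rw [gpow n hn γ |u x| (abs_nonneg _)]
          have h5 : |u x| ≤ K ^ (1 / (n:ℝ)) := by
            rw [abs_of_pos hx.1]
            exact hx.2.trans ht0K
          have h6 : γ * |u x| ^ p ≤ B2 := by rw [hB2]; gcongr
          have h7 := Real.exp_le_exp.2 h6
          calc γ ^ (n - 1) * |u x| ^ n * Real.exp (γ * |u x| ^ p)
              ≤ γ ^ (n - 1) * |u x| ^ n * Real.exp B2 := by gcongr
            _ = _ := by ring
      _ ≤ ∫⁻ x, ENNReal.ofReal (γ ^ (n - 1) * Real.exp B2) * ENNReal.ofReal (|u x| ^ n) :=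
          setLIntegral_le_lintegral _ _
      _ = ENNReal.ofReal (γ ^ (n - 1) * Real.exp B2) * ∫⁻ x, ENNReal.ofReal (|u x| ^ n) :=
          lintegral_const_mul' _ _ ENNReal.ofReal_ne_top
      _ ≤ _ := by
          gcongr
          refine (hP u hu hc Subset.rfl).trans ?_
          exact mul_le_of_le_one_right zero_le hE
  rw [ENNReal.ofReal_add (by positivity) (by positivity)]
  refine le_trans ?_ (add_le_add hint1 hint2)
  refine le_trans (lintegral_mono_set ?_) (lintegral_union_le _ _ _)
  intro x hx
  rcases lt_or_ge t0 (u x) with h | h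
  · exact Or.inl h
  · exact Or.inr ⟨hx, h⟩

lemma mt_of_poincare (hn : 2 ≤ n) (Ω : Set 𝔼) (C : ℝ) (hC : 0 < C)
    (hP : ∀ u : 𝔼 → ℝ,
        ContDiff ℝ (⊤ : ℕ∞) u → HasCompactSupport u → tsupport u ⊆ Ω →
        (∫ x in Ω, |u x| ^ n) ^ ((1 : ℝ) / n)
          ≤ C * (∫ x in Ω, ‖fderiv ℝ u x‖ ^ n) ^ ((1 : ℝ) / n)) :
    ∃ C > (0 : ℝ), ∀ u : 𝔼 → ℝ,
        ContDiff ℝ (⊤ : ℕ∞) u → HasCompactSupport u → tsupport u ⊆ Ω →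
        (∫ x in Ω, ‖fderiv ℝ u x‖ ^ n) ^ ((1 : ℝ) / n) ≤ 1 →
        ∫⁻ x in Ω,
            ENNReal.ofReal (expRem (n - 2) (gammaMT n * |u x| ^ ((n : ℝ) / ((n : ℝ) - 1))))
          ≤ ENNReal.ofReal C := by
  have hne : n ≠ 0 := by omega
  have hp := pc_gt n hn
  obtain ⟨C1, hC1, hhalf⟩ := mt_half hn (C ^ n) (by positivity)
  have hP2 : ∀ w : 𝔼 → ℝ, ContDiff ℝ (⊤ : ℕ∞) w → HasCompactSupport w → tsupport w ⊆ Ω →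
      ∫⁻ x, ENNReal.ofReal (|w x| ^ n) ≤ ENNReal.ofReal (C ^ n) * ∫⁻ x, ‖fderiv ℝ w x‖ₑ ^ n := by
    intro w w1 w2 w3
    rw [← u_en hn Ω w w1 w2 w3, ← grad_en hn Ω w w1 w2 w3, ← ENNReal.ofReal_mul (by positivity)]
    apply ENNReal.ofReal_le_ofReal
    have a1 : 0 ≤ ∫ x in Ω, |w x| ^ n := integral_nonneg (fun x => by positivity)
    have a2 : 0 ≤ ∫ x in Ω, ‖fderiv ℝ w x‖ ^ n := integral_nonneg (fun x => by positivity)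
    have := pow_le_pow_left₀ (by positivity) (hP w w1 w2 w3) n
    rw [mul_pow, one_div, Real.rpow_inv_natCast_pow a1 hne, Real.rpow_inv_natCast_pow a2 hne] at this
    exact this
  refine ⟨2 * C1 + 1, by positivity, ?_⟩
  intro u hu hc hΩ hE
  have hE1 : ∫⁻ x, ‖fderiv ℝ u x‖ₑ ^ n ≤ 1 := by
    rw [← grad_en hn Ω u hu hc hΩ, ← ENNReal.ofReal_one]
    apply ENNReal.ofReal_le_ofReal
    have a2 : 0 ≤ ∫ x in Ω, ‖fderiv ℝ u x‖ ^ n := integral_nonneg (fun x => by positivity)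
    have := pow_le_pow_left₀ (by positivity) hE n
    rwa [one_div, Real.rpow_inv_natCast_pow a2 hne, one_pow] at this
  have r1 := hhalf u hu hc (fun w w1 w2 w3 => hP2 w w1 w2 (w3.trans hΩ)) hE1
  have htn : tsupport (-u) = tsupport u := by
    unfold tsupport
    rw [Function.support_neg]
  have r2 := hhalf (-u) hu.neg hc.neg
    (fun w w1 w2 w3 => hP2 w w1 w2 (w3.trans (htn.le.trans hΩ))) (by
      refine le_trans (le_of_eq ?_) hE1
      congr 1
      ext x
      rw [fderiv_neg, ← ofReal_norm, ← ofReal_norm, norm_neg])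
  simp only [Pi.neg_apply, abs_neg] at r2
  change ∫⁻ x in Ω, ENNReal.ofReal (expRem (n - 2) (gammaMT n * |u x| ^ (pc n))) ≤ _
  set F : 𝔼 → ℝ≥0∞ := fun x => ENNReal.ofReal (expRem (n - 2) (gammaMT n * |u x| ^ (pc n))) with hF
  have hmeas : MeasurableSet ({x | 0 < u x} ∪ {x | 0 < - u x}) :=
    (isOpen_lt continuous_const hu.continuous).measurableSet.union
      (isOpen_lt continuous_const hu.continuous.neg).measurableSet
  calc ∫⁻ x in Ω, F x ≤ ∫⁻ x, F x := setLIntegral_le_lintegral _ _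
    _ = ∫⁻ x, ({x | 0 < u x} ∪ {x | 0 < - u x}).indicator F x := by
        congr 1
        ext x
        by_cases hx : x ∈ {x | 0 < u x} ∪ {x | 0 < - u x}
        · rw [indicator_of_mem hx]
        · rw [indicator_of_notMem hx]
          have h0 : u x = 0 := by
            have h1 : ¬ 0 < u x := fun h => hx (Or.inl h)
            have h2 : ¬ 0 < - u x := fun h => hx (Or.inr h)
            linarith
          simp only [hF]
          rw [h0, abs_zero, Real.zero_rpow (by linarith), mul_zero, expRem_zero, ENNReal.ofReal_zero]
    _ = ∫⁻ x in {x | 0 < u x} ∪ {x | 0 < - u x}, F x := lintegral_indicator hmeas _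
    _ ≤ (∫⁻ x in {x | 0 < u x}, F x) + ∫⁻ x in {x | 0 < - u x}, F x := lintegral_union_le _ _ _
    _ ≤ ENNReal.ofReal C1 + ENNReal.ofReal C1 := add_le_add r1 r2
    _ = ENNReal.ofReal (C1 + C1) := (ENNReal.ofReal_add hC1 hC1).symm
    _ ≤ _ := ENNReal.ofReal_le_ofReal (by linarith)

lemma poincare_of_mt (hn : 2 ≤ n) (Ω : Set 𝔼) (C : ℝ) (hC : 0 < C)
    (hM : ∀ u : 𝔼 → ℝ,
        ContDiff ℝ (⊤ : ℕ∞) u → HasCompactSupport u → tsupport u ⊆ Ω →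
        (∫ x in Ω, ‖fderiv ℝ u x‖ ^ n) ^ ((1 : ℝ) / n) ≤ 1 →
        ∫⁻ x in Ω,
            ENNReal.ofReal (expRem (n - 2) (gammaMT n * |u x| ^ ((n : ℝ) / ((n : ℝ) - 1))))
          ≤ ENNReal.ofReal C) :
    ∃ C > (0 : ℝ), ∀ u : 𝔼 → ℝ,
        ContDiff ℝ (⊤ : ℕ∞) u → HasCompactSupport u → tsupport u ⊆ Ω →
        (∫ x in Ω, |u x| ^ n) ^ ((1 : ℝ) / n)
          ≤ C * (∫ x in Ω, ‖fderiv ℝ u x‖ ^ n) ^ ((1 : ℝ) / n) := by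
  have hne : n ≠ 0 := by omega
  have hγ := gammaMT_pos n hn
  set κ : ℝ := gammaMT n ^ (n - 1) / (Nat.factorial (n - 2 + 1)) with hκ
  have hκ0 : 0 < κ := by positivity
  set D := (C / κ) ^ ((1:ℝ) / n) with hD
  have hD0 : 0 < D := by positivity
  refine ⟨D, hD0, ?_⟩
  intro u hu hc hΩ
  have a1 : 0 ≤ ∫ x in Ω, |u x| ^ n := integral_nonneg (fun x => by positivity)
  have a2 : 0 ≤ ∫ x in Ω, ‖fderiv ℝ u x‖ ^ n := integral_nonneg (fun x => by positivity)
  set E := (∫ x in Ω, ‖fderiv ℝ u x‖ ^ n) ^ ((1 : ℝ) / n) with hE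
  have hE0 : 0 ≤ E := by positivity
  have hEn : E ^ n = ∫ x in Ω, ‖fderiv ℝ u x‖ ^ n := by
    rw [hE, one_div, Real.rpow_inv_natCast_pow a2 hne]
  have key : ∀ b, E < b → (∫ x in Ω, |u x| ^ n) ^ ((1 : ℝ) / n) ≤ D * b := by
    intro b hb
    have hb0 : 0 < b := lt_of_le_of_lt hE0 hb
    have hts : tsupport (b⁻¹ • u) ⊆ Ω := by
      refine Subset.trans (closure_mono ?_) hΩ
      intro x hx hx'
      apply hx
      simp [hx']
    have hw1 : ContDiff ℝ (⊤ : ℕ∞) (b⁻¹ • u) := contDiff_const.smul hu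
    have hw2 : HasCompactSupport (b⁻¹ • u) := hc.smul_left (f := fun _ => b⁻¹)
    have h := hM (b⁻¹ • u) hw1 hw2 hts ?_
    · have h1 : ∫⁻ x in Ω, ENNReal.ofReal (κ * (b⁻¹ ^ n * |u x| ^ n)) ≤ ENNReal.ofReal C := by
        refine le_trans (lintegral_mono (fun x => ?_)) h
        apply ENNReal.ofReal_le_ofReal
        refine le_trans (le_of_eq ?_) (expRem_ge _ _ (by positivity))
        have := gpow n hn (gammaMT n) |(b⁻¹ • u) x| (abs_nonneg _)
        unfold pc at this
        rw [this, Pi.smul_apply, smul_eq_mul, abs_mul, mul_pow, abs_of_pos (inv_pos.2 hb0), hκ]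
        ring
      have hi : Integrable (fun x => κ * (b⁻¹ ^ n * |u x| ^ n)) (volume.restrict Ω) :=
        (((u_int hn u hu hc).const_mul _).const_mul _).restrict
      rw [← ofReal_integral_eq_lintegral_ofReal hi (Filter.Eventually.of_forall (fun x => by positivity)),
        integral_const_mul, integral_const_mul] at h1
      have h2 := (ENNReal.ofReal_le_ofReal_iff hC.le).1 h1
      have h3 : ∫ x in Ω, |u x| ^ n ≤ (C / κ) * b ^ n := by
        rw [inv_pow] at h2
        rw [div_mul_eq_mul_div, le_div_iff₀ hκ0]
        have hbn : 0 < b ^ n := by positivity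
        have h4 := mul_le_mul_of_nonneg_right h2 hbn.le
        refine le_trans (le_of_eq ?_) h4
        field_simp
      have h5 := Real.rpow_le_rpow a1 h3 (by positivity : 0 ≤ (1:ℝ) / n)
      rw [Real.mul_rpow (by positivity) (by positivity), one_div, Real.pow_rpow_inv_natCast hb0.le hne] at h5
      rw [hD, one_div]
      exact h5
    · have hd : ∀ x, ‖fderiv ℝ (b⁻¹ • u) x‖ ^ n = (b⁻¹) ^ n * ‖fderiv ℝ u x‖ ^ n := by
        intro x
        rw [fderiv_const_smul ((hu.differentiable (by simp)) x), norm_smul, mul_pow, Real.norm_eq_abs,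
          abs_of_pos (inv_pos.2 hb0)]
      simp only [hd]
      rw [integral_const_mul, ← hEn, ← mul_pow]
      apply Real.rpow_le_one (by positivity) _ (by positivity)
      apply pow_le_one₀ (by positivity)
      rw [inv_mul_le_iff₀ hb0]
      linarith
  apply _root_.le_of_forall_pos_le_add
  intro δ hδ
  have := key (E + δ / D) (by have : 0 < δ / D := by positivity
                              linarith)
  rw [mul_add, mul_div_cancel₀ _ hD0.ne'] at this
  exact this
end

end helpers

/-- The Moser-Trudinger inequality (CMT) holds on an open set `Ω ⊆ ℝⁿ` if and only if
the Poincaré inequality (Pn) holds on `Ω`. -/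
theorem mt_iff_poincare (n : ℕ) (hn : 2 ≤ n)
    (Ω : Set (EuclideanSpace ℝ (Fin n))) (hΩ : IsOpen Ω) :
    (∃ C > (0 : ℝ), ∀ u : EuclideanSpace ℝ (Fin n) → ℝ,
        ContDiff ℝ (⊤ : ℕ∞) u → HasCompactSupport u → tsupport u ⊆ Ω →
        (∫ x in Ω, ‖fderiv ℝ u x‖ ^ n) ^ ((1 : ℝ) / n) ≤ 1 →
        ∫⁻ x in Ω,
            ENNReal.ofReal (expRem (n - 2) (gammaMT n * |u x| ^ ((n : ℝ) / ((n : ℝ) - 1))))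
          ≤ ENNReal.ofReal C)
    ↔
    (∃ C > (0 : ℝ), ∀ u : EuclideanSpace ℝ (Fin n) → ℝ,
        ContDiff ℝ (⊤ : ℕ∞) u → HasCompactSupport u → tsupport u ⊆ Ω →
        (∫ x in Ω, |u x| ^ n) ^ ((1 : ℝ) / n)
          ≤ C * (∫ x in Ω, ‖fderiv ℝ u x‖ ^ n) ^ ((1 : ℝ) / n)) := by
  constructor
  · rintro ⟨C, hC, h⟩
    exact poincare_of_mt hn Ω C hC h
  · rintro ⟨C, hC, h⟩
    exact mt_of_poincare hn Ω C hC h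
end

section
/- Let n ≥ 2. For every κ > 0 there exists a constant C > 0 such that ∫_{ℝⁿ} exp_{n-2}[γₙ |u(x)|^{n/(n-1)}] dx ≤ C for every u ∈ C_c^∞(ℝⁿ) satisfying ∫_{ℝⁿ} |∇u(x)|ⁿ dx + κ ∫_{ℝⁿ} |u(x)|ⁿ dx ≤ 1. -/
open MeasureTheory Real


namespace RMT

/-- two-term Hölder inequality -/
lemma holder_two {q p : ℝ} (hqp : q.HolderConjugate p) {a b c d : ℝ} (ha : 0 ≤ a) (hb : 0 ≤ b)
    (hc : 0 ≤ c) (hd : 0 ≤ d) :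
    a * c + b * d ≤ (a ^ q + b ^ q) ^ (1 / q) * (c ^ p + d ^ p) ^ (1 / p) := by
  have := Real.inner_le_Lp_mul_Lq_of_nonneg (Finset.univ : Finset (Fin 2)) (f := ![a, b])
    (g := ![c, d]) hqp (by intro i _; fin_cases i <;> simpa) (by intro i _; fin_cases i <;> simpa)
  simpa [Fin.sum_univ_two] using this

/-- Hölder conjugacy of `n` and `n/(n-1)`. -/
lemma holder_n {n : ℕ} (hn : 2 ≤ n) : (n : ℝ).HolderConjugate ((n : ℝ) / ((n : ℝ) - 1)) := by
  have : (2 : ℝ) ≤ n := by exact_mod_cast hn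
  exact Real.HolderConjugate.conjExponent (by linarith)

lemma rpow_inv_rpow' {x p : ℝ} (hx : 0 ≤ x) (hp : 0 < p) : (x ^ (1 / p)) ^ p = x := by
  rw [← Real.rpow_mul hx, one_div_mul_cancel hp.ne', Real.rpow_one]

/-- The weak bound. -/
lemma num0 {q p L t j : ℝ} (hqp : q.HolderConjugate p) (hL0 : 0 ≤ L) (hL1 : L ^ q ≤ 1)
    (ht : 0 ≤ t) (hj : 0 ≤ j)
    (h : j ^ (1 / p) ≤ q * L + (1 - L ^ q) ^ (1 / q) * t ^ (1 / p)) : j ≤ t + q ^ p := by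
  have hq0 := hqp.pos
  have hp0 := hqp.symm.pos
  have h1 := holder_two hqp hL0 (Real.rpow_nonneg (by linarith : 0 ≤ 1 - L ^ q) (1 / q))
    hq0.le (Real.rpow_nonneg ht (1 / p))
  rw [rpow_inv_rpow' (by linarith) hq0, rpow_inv_rpow' ht hp0] at h1
  have h2 : j ^ (1 / p) ≤ (q ^ p + t) ^ (1 / p) := by
    calc _ ≤ _ := h
      _ = L * q + (1 - L ^ q) ^ (1 / q) * t ^ (1 / p) := by ring
      _ ≤ _ := h1
      _ = _ := by simp
  have h3 := (Real.rpow_le_rpow_iff hj (by positivity) (by positivity)).1 h2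
  linarith

/-- Smallness of the tail. -/
lemma num1 {n : ℕ} (hn : 2 ≤ n) {p L t j l : ℝ} (hqp : (n : ℝ).HolderConjugate p) (hL0 : 0 ≤ L)
    (hL1 : L ^ (n : ℝ) ≤ 1) (ht : 0 < t) (hl : 0 ≤ l) (hjl : t - l ≤ j)
    (h : j ^ (1 / p) ≤ n * L + (1 - L ^ (n : ℝ)) ^ (1 / (n : ℝ)) * t ^ (1 / p)) :
    t * L ^ (n : ℝ) ≤ 2 * n * l + (2 * (n : ℝ) ^ 2) ^ n := by
  have hn2 : (2 : ℝ) ≤ n := by exact_mod_cast hn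
  have hq0 := hqp.pos
  have hp0 := hqp.symm.pos
  have hLn : 0 ≤ L ^ (n : ℝ) := by positivity
  have hpow : 0 ≤ (2 * (n : ℝ) ^ 2) ^ n := by positivity
  by_cases hlt : t ≤ l
  · nlinarith
  push Not at hlt
  have hb : (1 - L ^ (n : ℝ)) ^ (1 / (n : ℝ)) ≤ 1 - L ^ (n : ℝ) / n := by
    have := rpow_one_add_le_one_add_mul_self (s := - L ^ (n : ℝ)) (by linarith) (p := 1 / (n : ℝ))
      (by positivity) (by rw [div_le_one (by linarith)]; linarith)
    calc _ = (1 + - L ^ (n : ℝ)) ^ (1 / (n : ℝ)) := by ring_nf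
      _ ≤ _ := this
      _ = _ := by ring
  have hp1 : 1 / p ≤ 1 := by
    rw [div_le_one hp0]; exact hqp.symm.lt.le
  have hs : t ^ (1 / p) * (1 - l / t) ≤ j ^ (1 / p) := by
    calc t ^ (1 / p) * (1 - l / t) ≤ t ^ (1 / p) * (1 - l / t) ^ (1 / p) := by
          gcongr
          have h0 : 0 < 1 - l / t := by rw [sub_pos, div_lt_one ht]; exact hlt
          have h1 : 1 - l / t ≤ 1 := by have : 0 ≤ l / t := by positivity
                                        linarith
          simpa using Real.rpow_le_rpow_of_exponent_ge h0 h1 hp1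
      _ = (t - l) ^ (1 / p) := by
          rw [← Real.mul_rpow ht.le (by rw [sub_nonneg, div_le_one ht]; exact hlt.le)]
          congr 1; field_simp
      _ ≤ _ := by gcongr
  set T := t ^ (1 / p) with hT
  have hTpos : 0 < T := by positivity
  set S := t ^ (1 / (n : ℝ)) with hS
  have hSpos : 0 < S := by positivity
  have hTS : S * T = t := by
    rw [hS, hT, ← Real.rpow_add ht]
    have := hqp.inv_add_inv_eq_one
    simp only [one_div, this, Real.rpow_one]
  have h1 : T * (1 - l / t) ≤ n * L + (1 - L ^ (n : ℝ) / n) * T :=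
    hs.trans (h.trans (by gcongr))
  have h2 : T * (L ^ (n : ℝ) / n) ≤ n * L + T * (l / t) := by linarith
  have h3 : t * (L ^ (n : ℝ) / n) ≤ n * (S * L) + l := by
    have := mul_le_mul_of_nonneg_left h2 hSpos.le
    have e1 : S * (T * (L ^ (n : ℝ) / n)) = t * (L ^ (n : ℝ) / n) := by rw [← mul_assoc, hTS]
    have e2 : S * (n * L + T * (l / t)) = n * (S * L) + l := by
      have : S * (T * (l / t)) = l := by rw [← mul_assoc, hTS]; field_simp
      linear_combination this
    linarith
  have h4 : t * L ^ (n : ℝ) = (S * L) ^ n := by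
    rw [← Real.rpow_natCast (S * L), Real.mul_rpow hSpos.le hL0, hS, rpow_inv_rpow' ht.le hq0]
  have h5 : (S * L) ^ n ≤ n ^ 2 * (S * L) + n * l := by
    rw [← h4]
    have e : t * L ^ (n : ℝ) = n * (t * (L ^ (n : ℝ) / n)) := by field_simp
    rw [e]
    nlinarith
  rw [h4]
  set X := S * L
  have hX : 0 ≤ X := by positivity
  by_cases hc : X ≤ 2 * n ^ 2
  · have : X ^ n ≤ (2 * (n : ℝ) ^ 2) ^ n := by gcongr
    nlinarith
  · push Not at hc
    have hX1 : 1 ≤ X := by nlinarith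
    have : X ^ 2 ≤ X ^ n := pow_le_pow_right₀ hX1 hn
    nlinarith

/-- Closeness of two almost extremal levels. -/
lemma num2 {n : ℕ} (hn : 2 ≤ n) {p L t s j l Λ K : ℝ} (hqp : (n : ℝ).HolderConjugate p)
    (hp2 : p ≤ 2) (hL0 : 0 ≤ L) (hΛ : 0 < Λ) (hK : K = 16 ^ (n - 1)) (ht : K * Λ ≤ t) (hts : t ≤ s)
    (hj0 : 0 ≤ j) (hjl : s - l ≤ j) (hLt : t * L ^ (n : ℝ) ≤ Λ)
    (h : j ^ (1 / p) ≤ n * L + L * (s - t) ^ (1 / p) + t ^ (1 / p)) :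
    s - t ≤ 2 * (K * Λ + l) + n ^ p := by
  have hn2 : (2 : ℝ) ≤ n := by exact_mod_cast hn
  have hq0 := hqp.pos
  have hp0 := hqp.symm.pos
  have hKpos : 0 < K := by rw [hK]; positivity
  have htpos : 0 < t := lt_of_lt_of_le (by positivity) ht
  set δ := s - t with hδ
  have hδ0 : 0 ≤ δ := by linarith
  set R := K * Λ / t with hR
  have hRpos : 0 < R := by positivity
  have hR1 : R ≤ 1 := by rw [hR, div_le_one htpos]; exact ht
  set r := R ^ (1 / (n : ℝ)) with hr
  have hrpos : 0 < r := by positivity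
  set y := L * (n + δ ^ (1 / p)) with hy
  have hy0 : 0 ≤ y := by positivity
  have h1 := holder_two hqp zero_le_one hrpos.le (Real.rpow_nonneg htpos.le (1 / p))
    (div_nonneg hy0 hrpos.le)
  rw [rpow_inv_rpow' htpos.le hp0, hr, rpow_inv_rpow' hRpos.le hq0, ← hr, Real.one_rpow] at h1
  have h2 : j ^ (1 / p) ≤ (1 + R) ^ (1 / (n : ℝ)) * (t + (y / r) ^ p) ^ (1 / p) := by
    refine le_trans (h.trans (le_of_eq ?_)) h1
    rw [hy]; field_simp; ring
  have hpn : 1 / (n : ℝ) * p ≤ 1 := by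
    rw [one_div_mul_eq_div, div_le_one hq0]; linarith
  have h3 : j ≤ (1 + R) * (t + (y / r) ^ p) := by
    have := Real.rpow_le_rpow (by positivity) h2 hp0.le
    rw [rpow_inv_rpow' hj0 hp0, Real.mul_rpow (by positivity) (by positivity),
      rpow_inv_rpow' (by positivity) hp0, ← Real.rpow_mul (by positivity)] at this
    refine this.trans ?_
    gcongr
    calc (1 + R) ^ (1 / (n : ℝ) * p) ≤ (1 + R) ^ (1 : ℝ) :=
          Real.rpow_le_rpow_of_exponent_le (by linarith) hpn
      _ = _ := Real.rpow_one _
  -- bound y / r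
  have hLr : (L / r) ^ p ≤ 1 / 16 := by
    have e1 : (L / r) ^ (n : ℝ) ≤ 1 / K := by
      rw [Real.div_rpow hL0 hrpos.le, hr, rpow_inv_rpow' hRpos.le hq0, hR]
      rw [div_div_eq_mul_div, div_le_div_iff₀ (by positivity) hKpos]
      nlinarith
    have e2 : (L / r) ^ p = ((L / r) ^ (n : ℝ)) ^ (1 / ((n : ℝ) - 1)) := by
      rw [← Real.rpow_mul (by positivity)]
      congr 1
      rw [hqp.conjugate_eq]; field_simp
    rw [e2]
    calc _ ≤ (1 / K) ^ (1 / ((n : ℝ) - 1)) := by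
          apply Real.rpow_le_rpow (by positivity) e1
          apply div_nonneg zero_le_one; linarith
      _ = 1 / 16 := by
          rw [hK, ← one_div_pow, ← Real.rpow_natCast, ← Real.rpow_mul (by positivity)]
          have : ((n - 1 : ℕ) : ℝ) * (1 / ((n : ℝ) - 1)) = 1 := by
            rw [Nat.cast_sub (by omega)]
            have : (n : ℝ) - 1 ≠ 0 := by linarith
            push_cast
            field_simp
          rw [this, Real.rpow_one]
  have hsum : (n + δ ^ (1 / p)) ^ p ≤ 4 * (n ^ p + δ) := by
    have hd : 0 ≤ δ ^ (1 / p) := by positivity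
    have hm : (n : ℝ) + δ ^ (1 / p) ≤ 2 * max (n : ℝ) (δ ^ (1 / p)) := by
      have := le_max_left (n : ℝ) (δ ^ (1 / p))
      have := le_max_right (n : ℝ) (δ ^ (1 / p))
      linarith
    have h24 : (2 : ℝ) ^ p ≤ 4 := by
      calc (2 : ℝ) ^ p ≤ 2 ^ (2 : ℝ) := Real.rpow_le_rpow_of_exponent_le (by norm_num) hp2
        _ = 4 := by norm_num
    calc (n + δ ^ (1 / p)) ^ p ≤ (2 * max (n : ℝ) (δ ^ (1 / p))) ^ p := by gcongr
      _ = 2 ^ p * (max (n : ℝ) (δ ^ (1 / p))) ^ p := by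
          rw [Real.mul_rpow (by norm_num) (le_max_of_le_right hd)]
      _ ≤ 4 * (n ^ p + δ) := by
          gcongr
          rcases max_choice (n : ℝ) (δ ^ (1 / p)) with h | h <;> rw [h]
          · linarith
          · rw [rpow_inv_rpow' hδ0 hp0]
            have : 0 ≤ (n : ℝ) ^ p := by positivity
            linarith
  have h4 : (y / r) ^ p ≤ (n ^ p + δ) / 4 := by
    have : y / r = (L / r) * (n + δ ^ (1 / p)) := by rw [hy]; ring
    rw [this, Real.mul_rpow (by positivity) (by positivity)]
    calc _ ≤ 1 / 16 * (4 * (n ^ p + δ)) := by gcongr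
      _ = _ := by ring
  have h5 : R * t = K * Λ := by rw [hR]; field_simp
  have h6 : 0 ≤ (y / r) ^ p := by positivity
  have h7 : R * (y / r) ^ p ≤ (y / r) ^ p := by nlinarith
  have h8 : (1 + R) * (t + (y / r) ^ p) = t + R * t + (y / r) ^ p + R * (y / r) ^ p := by ring
  linarith

end RMT


namespace RMT

/-- counting lemma -/
lemma count_set (S : Set ℕ) (d : ℕ) (h : ∀ i ∈ S, ∀ j ∈ S, i < j → i ≤ d ∨ j ≤ i + d) :
    ∑' j : ℕ, S.indicator (fun _ => (1 : ENNReal)) j ≤ ((2 * d + 2 : ℕ) : ENNReal) := by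
  classical
  have key : ∃ T : Finset ℕ, S ⊆ T ∧ T.card ≤ 2 * d + 2 := by
    by_cases hex : ∃ j, j ∈ S ∧ d < j
    · refine ⟨Finset.range (d + 1) ∪ Finset.Icc (Nat.find hex) (Nat.find hex + d), ?_, ?_⟩
      · intro j hj
        simp only [Finset.coe_union, Set.mem_union, Finset.mem_coe, Finset.mem_range,
          Finset.mem_Icc]
        by_cases hjd : j ≤ d
        · left; omega
        · right
          have h1 : Nat.find hex ≤ j := Nat.find_min' hex ⟨hj, by omega⟩
          refine ⟨h1, ?_⟩
          obtain ⟨h2, h3⟩ := Nat.find_spec hex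
          rcases h1.eq_or_lt with h4 | h4
          · omega
          · rcases h _ h2 _ hj h4 with h5 | h5 <;> omega
      · refine (Finset.card_union_le _ _).trans ?_
        simp; omega
    · push Not at hex
      exact ⟨Finset.range (d + 1), fun j hj => by
        have := hex j hj
        simp; omega, by simp; omega⟩
  obtain ⟨T, hST, hT⟩ := key
  rw [tsum_eq_sum (s := T)]
  · calc ∑ j ∈ T, S.indicator (fun _ => (1 : ENNReal)) j ≤ ∑ j ∈ T, 1 := by
          apply Finset.sum_le_sum
          intro j _
          exact Set.indicator_le_self' (fun _ _ => by simp) j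
      _ = (T.card : ENNReal) := by simp
      _ ≤ _ := by exact_mod_cast hT
  · intro j hj
    exact Set.indicator_of_notMem (fun h => hj (hST h)) _

lemma num3 {n : ℕ} (hn : 2 ≤ n) {p : ℝ} (hqp : (n : ℝ).HolderConjugate p) :
    ∃ C : ℝ, 0 < C ∧ ∀ m L : ℕ → ℝ, (∀ j, 0 ≤ m j) → (∀ j, m j ≤ 1) → Antitone m →
      (∀ j, 0 ≤ L j) → (∀ j, L j ^ (n : ℝ) ≤ 1) →
      (∀ j, 0 < m j → (j : ℝ) ^ (1 / p) ≤
        n * L j + (1 - L j ^ (n : ℝ)) ^ (1 / (n : ℝ)) * (-log (m j)) ^ (1 / p)) →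
      (∀ i j, i < j → 0 < m j → (j : ℝ) ^ (1 / p) ≤
        n * L i + L i * (log (m i) - log (m j)) ^ (1 / p) + (-log (m i)) ^ (1 / p)) →
      ∑' j : ℕ, ENNReal.ofReal (exp j * m j) ≤ ENNReal.ofReal C := by
  have hn2 : (2 : ℝ) ≤ n := by exact_mod_cast hn
  have hq0 := hqp.pos
  have hp0 := hqp.symm.pos
  have hp2 : p ≤ 2 := by
    rw [hqp.conjugate_eq, div_le_iff₀ (by linarith)]; linarith
  set b : ℝ := (n : ℝ) ^ p with hb
  have hb0 : 0 ≤ b := by positivity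
  set K : ℝ := 16 ^ (n - 1) with hK
  have hK0 : 0 < K := by positivity
  set B : ℝ := (2 * (n : ℝ) ^ 2) ^ n with hB
  have hB0 : 0 < B := by positivity
  obtain ⟨N, hN⟩ := exists_nat_ge (2 * K * (2 * n) + 3 + (2 * K * B + 2 * b))
  have hNd : ∀ k : ℕ, 2 * K * (2 * n * k + B) + 3 * k + 2 * b ≤ ((N * (k + 1) : ℕ) : ℝ) := by
    intro k
    push_cast
    have hk : (0 : ℝ) ≤ k := by positivity
    have h1 := mul_le_mul_of_nonneg_right hN (by linarith : (0 : ℝ) ≤ k + 1)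
    have h2 : 0 ≤ 2 * K * (2 * n) + 3 := by positivity
    have h3 : 0 ≤ 2 * K * B + 2 * b := by positivity
    nlinarith
  -- summable bound
  have hsum : Summable (fun k : ℕ => exp (b + 1) * exp (-(k : ℝ)) * ((2 * (N * (k + 1)) + 2 : ℕ) : ℝ)) := by
    have h1 : Summable (fun k : ℕ => (k : ℝ) ^ 1 * exp (-1 : ℝ) ^ k) := by
      apply summable_pow_mul_geometric_of_norm_lt_one
      rw [Real.norm_of_nonneg (exp_pos _).le]
      simp
    have h0 : Summable (fun k : ℕ => exp (-1 : ℝ) ^ k) := by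
      apply summable_geometric_of_lt_one (exp_pos _).le
      simp
    have h2 := (h1.mul_left (exp (b + 1) * (2 * N))).add (h0.mul_left (exp (b + 1) * (2 * N + 2)))
    refine h2.congr ?_
    intro k
    have : exp (-(k : ℝ)) = exp (-1 : ℝ) ^ k := by
      rw [← Real.exp_nat_mul]; ring_nf
    rw [this]; push_cast; ring
  set C := ∑' k : ℕ, exp (b + 1) * exp (-(k : ℝ)) * ((2 * (N * (k + 1)) + 2 : ℕ) : ℝ) with hC
  refine ⟨C + 1, ?_, ?_⟩
  · have : 0 ≤ C := tsum_nonneg (fun k => by positivity)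
    linarith
  intro m L hm0 hm1 hmono hL0 hL1 hA hBB
  set S : ℕ → Set ℕ := fun k => {j | 0 < m j ∧ -log (m j) - j ≤ k} with hS
  have ht0 : ∀ j, 0 < m j → 0 ≤ -log (m j) := fun j hj => by
    have := Real.log_nonpos (hm0 j) (hm1 j); linarith
  have hweak : ∀ j, 0 < m j → (j : ℝ) ≤ -log (m j) + b := fun j hj =>
    num0 hqp (hL0 j) (hL1 j) (ht0 j hj) (by positivity) (hA j hj)
  have hpair : ∀ k, ∀ i ∈ S k, ∀ j ∈ S k, i < j → i ≤ N * (k + 1) ∨ j ≤ i + N * (k + 1) := by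
    intro k i hi j hj hij
    obtain ⟨hi0, hi1⟩ := hi
    obtain ⟨hj0, hj1⟩ := hj
    have hd := hNd k
    have hk : (0 : ℝ) ≤ k := by positivity
    set Λ : ℝ := 2 * n * k + B with hΛ
    have hΛ0 : 0 < Λ := by positivity
    have hKΛ : 0 < K * Λ := by positivity
    by_cases hc : K * Λ ≤ -log (m i)
    · right
      have hL : -log (m i) * L i ^ (n : ℝ) ≤ Λ :=
        num1 hn hqp (hL0 i) (hL1 i) (lt_of_lt_of_le hKΛ hc) hk (by linarith) (hA i hi0)
      have hlog : log (m j) ≤ log (m i) := Real.log_le_log hj0 (hmono hij.le)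
      have := num2 (s := -log (m j)) (l := k) (j := j) hn hqp hp2 (hL0 i) hΛ0 hK hc (by linarith)
        (by positivity) (by linarith) hL (by
          have := hBB i j hij hj0
          rwa [show -log (m j) - -log (m i) = log (m i) - log (m j) by ring])
      have h1 := hweak j hj0
      have h2 : (j : ℝ) ≤ i + ((N * (k + 1) : ℕ) : ℝ) := by linarith
      exact_mod_cast h2
    · left
      push Not at hc
      have h1 := hweak i hi0
      have h2 : (i : ℝ) ≤ ((N * (k + 1) : ℕ) : ℝ) := by linarith
      exact_mod_cast h2
  have hterm : ∀ j : ℕ, ENNReal.ofReal (exp j * m j) ≤ ∑' k : ℕ,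
      ENNReal.ofReal (exp (b + 1) * exp (-(k : ℝ))) * (S k).indicator (fun _ => (1 : ENNReal)) j := by
    intro j
    by_cases hj : 0 < m j
    · set k := ⌈-log (m j) - j⌉₊ with hk
      refine le_trans ?_ (ENNReal.le_tsum k)
      have hmem : j ∈ S k := ⟨hj, Nat.le_ceil _⟩
      rw [Set.indicator_of_mem hmem, mul_one]
      apply ENNReal.ofReal_le_ofReal
      rw [← Real.exp_add]
      nth_rewrite 1 [← Real.exp_log hj]
      rw [← Real.exp_add]
      apply Real.exp_le_exp.2
      have hw := hweak j hj
      by_cases h0 : 0 ≤ -log (m j) - j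
      · have := Nat.ceil_lt_add_one h0
        rw [← hk] at this
        linarith
      · push Not at h0
        have : k = 0 := by rw [hk, Nat.ceil_eq_zero]; exact h0.le
        rw [this]; push_cast; linarith
    · have : m j = 0 := le_antisymm (not_lt.1 hj) (hm0 j)
      simp [this]
  calc ∑' j : ℕ, ENNReal.ofReal (exp j * m j)
      ≤ ∑' j : ℕ, ∑' k : ℕ, ENNReal.ofReal (exp (b + 1) * exp (-(k : ℝ))) *
          (S k).indicator (fun _ => (1 : ENNReal)) j := ENNReal.tsum_le_tsum hterm
    _ = ∑' k : ℕ, ENNReal.ofReal (exp (b + 1) * exp (-(k : ℝ))) *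
          ∑' j : ℕ, (S k).indicator (fun _ => (1 : ENNReal)) j := by
        rw [ENNReal.tsum_comm]
        simp_rw [ENNReal.tsum_mul_left]
    _ ≤ ∑' k : ℕ, ENNReal.ofReal (exp (b + 1) * exp (-(k : ℝ)) * ((2 * (N * (k + 1)) + 2 : ℕ) : ℝ)) := by
        apply ENNReal.tsum_le_tsum
        intro k
        rw [ENNReal.ofReal_mul (p := exp (b + 1) * exp (-(k : ℝ))) (by positivity), ENNReal.ofReal_natCast]
        gcongr
        exact count_set _ _ (hpair k)
    _ = ENNReal.ofReal C := by
        rw [hC, ENNReal.ofReal_tsum_of_nonneg (fun k => by positivity) hsum]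
    _ ≤ _ := ENNReal.ofReal_le_ofReal (by linarith)

end RMT


namespace RMT

/-- the (real) energy of `φ` on `(a,c]` -/
noncomputable def en (n : ℕ) (φ : ℝ → ENNReal) (a c : ℝ) : ℝ :=
  (∫⁻ s in Set.Ioc a c, φ s ^ (n : ℝ)).toReal

/-- the tail norm -/
noncomputable def tailL (n : ℕ) (φ : ℝ → ENNReal) (m : ℝ) : ℝ := (en n φ 0 m) ^ (1 / (n : ℝ))

/-- The functional of ONeil. -/
noncomputable def oneil (n : ℕ) (p : ℝ) (φ : ℝ → ENNReal) (m : ℝ) : ENNReal :=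
  ENNReal.ofReal (n * m ^ (-(1 / p))) * (∫⁻ s in Set.Ioc 0 m, φ s) +
    ∫⁻ s in Set.Ioc m 1, φ s * ENNReal.ofReal (s ^ (-(1 / p)))

section
variable {n : ℕ} {φ : ℝ → ENNReal} {p : ℝ}

lemma en_fin (hφ1 : ∫⁻ s in Set.Ioi (0 : ℝ), φ s ^ (n : ℝ) ≤ 1) {a c : ℝ} (ha : 0 ≤ a) :
    ∫⁻ s in Set.Ioc a c, φ s ^ (n : ℝ) = ENNReal.ofReal (en n φ a c) := by
  rw [en, ENNReal.ofReal_toReal]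
  apply ne_top_of_le_ne_top ENNReal.one_ne_top
  refine le_trans (lintegral_mono_set ?_) hφ1
  intro x hx
  exact lt_of_le_of_lt ha hx.1

lemma en_nonneg (a c : ℝ) : 0 ≤ en n φ a c := ENNReal.toReal_nonneg

lemma en_le_one (hφ1 : ∫⁻ s in Set.Ioi (0 : ℝ), φ s ^ (n : ℝ) ≤ 1) {a c : ℝ} (ha : 0 ≤ a) :
    en n φ a c ≤ 1 := by
  rw [← ENNReal.ofReal_le_one, ← en_fin hφ1 ha]
  refine le_trans (lintegral_mono_set ?_) hφ1
  intro x hx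
  exact lt_of_le_of_lt ha hx.1

lemma en_add (hφ1 : ∫⁻ s in Set.Ioi (0 : ℝ), φ s ^ (n : ℝ) ≤ 1) {a b c : ℝ} (ha : 0 ≤ a)
    (hab : a ≤ b) (hbc : b ≤ c) : en n φ a b + en n φ b c = en n φ a c := by
  have h : ∫⁻ s in Set.Ioc a c, φ s ^ (n : ℝ) =
      (∫⁻ s in Set.Ioc a b, φ s ^ (n : ℝ)) + ∫⁻ s in Set.Ioc b c, φ s ^ (n : ℝ) := by
    rw [← Set.Ioc_union_Ioc_eq_Ioc hab hbc, lintegral_union measurableSet_Ioc]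
    exact Set.Ioc_disjoint_Ioc_of_le le_rfl
  rw [en_fin hφ1 ha, en_fin hφ1 ha, en_fin hφ1 (ha.trans hab), ← ENNReal.ofReal_add (en_nonneg _ _)
    (en_nonneg _ _)] at h
  rw [ENNReal.ofReal_eq_ofReal_iff (en_nonneg _ _) (add_nonneg (en_nonneg _ _) (en_nonneg _ _))] at h
  exact h.symm

lemma hold1 (hqp : (n : ℝ).HolderConjugate p) (hφ : Measurable φ)
    (hφ1 : ∫⁻ s in Set.Ioi (0 : ℝ), φ s ^ (n : ℝ) ≤ 1) {m : ℝ} (hm : 0 < m) :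
    ENNReal.ofReal (n * m ^ (-(1 / p))) * ∫⁻ s in Set.Ioc 0 m, φ s ≤
      ENNReal.ofReal (n * tailL n φ m) := by
  have h := ENNReal.lintegral_mul_le_Lp_mul_Lq (volume.restrict (Set.Ioc 0 m)) hqp
    hφ.aemeasurable (g := fun _ => 1) aemeasurable_const
  simp only [Pi.mul_apply, mul_one, ENNReal.one_rpow, lintegral_const, one_mul,
    Measure.restrict_apply MeasurableSet.univ, Set.univ_inter, Real.volume_Ioc, sub_zero] at h
  rw [en_fin hφ1 le_rfl, ENNReal.ofReal_rpow_of_nonneg (en_nonneg _ _) (by positivity),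
    ENNReal.ofReal_rpow_of_nonneg hm.le (by have := hqp.symm.pos; positivity),
    ← ENNReal.ofReal_mul (Real.rpow_nonneg (en_nonneg _ _) _)] at h
  refine (mul_le_mul_right h _).trans ?_
  rw [← ENNReal.ofReal_mul (by positivity)]
  apply ENNReal.ofReal_le_ofReal
  apply le_of_eq
  rw [tailL, Real.rpow_neg hm.le]
  have : m ^ (1 / p) ≠ 0 := by positivity
  field_simp

lemma lint_inv {a c : ℝ} (ha : 0 < a) (hac : a ≤ c) :
    ∫⁻ s in Set.Ioc a c, ENNReal.ofReal (s⁻¹) = ENNReal.ofReal (log c - log a) := by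
  rw [← Real.log_div (by linarith) ha.ne', ← integral_inv_of_pos ha (by linarith),
    intervalIntegral.integral_of_le hac]
  rw [ofReal_integral_eq_lintegral_ofReal]
  · have : IntervalIntegrable (fun x : ℝ => x⁻¹) volume a c := by
      apply intervalIntegral.intervalIntegrable_inv
      · intro x hx
        rw [Set.uIcc_of_le hac] at hx
        have := hx.1
        linarith
      · exact continuousOn_id
    exact (intervalIntegrable_iff_integrableOn_Ioc_of_le hac).1 this
  · filter_upwards [ae_restrict_mem measurableSet_Ioc] with x hx
    have : 0 < x := ha.trans hx.1
    simp; positivity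

lemma hold2 (hqp : (n : ℝ).HolderConjugate p) (hφ : Measurable φ)
    (hφ1 : ∫⁻ s in Set.Ioi (0 : ℝ), φ s ^ (n : ℝ) ≤ 1) {a c : ℝ} (ha : 0 < a) (hac : a ≤ c) :
    ∫⁻ s in Set.Ioc a c, φ s * ENNReal.ofReal (s ^ (-(1 / p))) ≤
      ENNReal.ofReal ((en n φ a c) ^ (1 / (n : ℝ)) * (log c - log a) ^ (1 / p)) := by
  have hp0 := hqp.symm.pos
  have h := ENNReal.lintegral_mul_le_Lp_mul_Lq (volume.restrict (Set.Ioc a c)) hqp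
    hφ.aemeasurable (g := fun s => ENNReal.ofReal (s ^ (-(1 / p)))) (by fun_prop)
  have h2 : ∫⁻ s in Set.Ioc a c, ENNReal.ofReal (s ^ (-(1 / p))) ^ p =
      ENNReal.ofReal (log c - log a) := by
    rw [← lint_inv ha hac]
    apply setLIntegral_congr_fun measurableSet_Ioc
    intro s hs
    have hs0 : 0 < s := ha.trans hs.1
    simp only
    rw [ENNReal.ofReal_rpow_of_nonneg (by positivity) hp0.le, ← Real.rpow_mul hs0.le]
    congr 1
    rw [show -(1 / p) * p = -1 by field_simp, Real.rpow_neg_one]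
  have hlog : 0 ≤ log c - log a := by
    have := Real.log_le_log ha hac; linarith
  rw [h2, en_fin hφ1 ha.le, ENNReal.ofReal_rpow_of_nonneg (en_nonneg _ _) (by positivity),
    ENNReal.ofReal_rpow_of_nonneg hlog (by positivity),
    ← ENNReal.ofReal_mul (Real.rpow_nonneg (en_nonneg _ _) _)] at h
  exact h

lemma tailL_nonneg (m : ℝ) : 0 ≤ tailL n φ m := Real.rpow_nonneg (en_nonneg _ _) _

lemma tailL_pow (hqp : (n : ℝ).HolderConjugate p) (m : ℝ) : tailL n φ m ^ (n : ℝ) = en n φ 0 m :=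
  rpow_inv_rpow' (en_nonneg _ _) hqp.pos

lemma oneil_H1 (hqp : (n : ℝ).HolderConjugate p) (hφ : Measurable φ)
    (hφ1 : ∫⁻ s in Set.Ioi (0 : ℝ), φ s ^ (n : ℝ) ≤ 1) {m : ℝ} (hm : 0 < m) (hm1 : m ≤ 1) :
    oneil n p φ m ≤ ENNReal.ofReal (n * tailL n φ m +
      (1 - tailL n φ m ^ (n : ℝ)) ^ (1 / (n : ℝ)) * (-log m) ^ (1 / p)) := by
  have hlog := Real.log_nonpos hm.le hm1
  have hL := en_le_one (c := m) hφ1 le_rfl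
  rw [tailL_pow hqp, ENNReal.ofReal_add (mul_nonneg (by positivity) (tailL_nonneg _))
    (mul_nonneg (Real.rpow_nonneg (by linarith) _) (Real.rpow_nonneg (by linarith) _)), oneil]
  gcongr
  · exact hold1 hqp hφ hφ1 hm
  · refine (hold2 hqp hφ hφ1 hm hm1).trans ?_
    apply ENNReal.ofReal_le_ofReal
    rw [Real.log_one, zero_sub]
    have h1 := en_add hφ1 le_rfl hm.le hm1
    have h2 := en_le_one (c := 1) hφ1 le_rfl
    apply mul_le_mul_of_nonneg_right _ (Real.rpow_nonneg (by linarith) _)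
    apply Real.rpow_le_rpow (en_nonneg _ _) (by linarith) (by positivity)

lemma oneil_H2 (hqp : (n : ℝ).HolderConjugate p) (hφ : Measurable φ)
    (hφ1 : ∫⁻ s in Set.Ioi (0 : ℝ), φ s ^ (n : ℝ) ≤ 1) {m k : ℝ} (hk : 0 < k) (hkm : k ≤ m)
    (hm1 : m ≤ 1) :
    oneil n p φ k ≤ ENNReal.ofReal (n * tailL n φ m +
      tailL n φ m * (log m - log k) ^ (1 / p) + (-log m) ^ (1 / p)) := by
  have hm : 0 < m := hk.trans_le hkm
  have hlog := Real.log_nonpos hm.le hm1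
  have hlog2 := Real.log_le_log hk hkm
  have hT := tailL_nonneg (n := n) (φ := φ) m
  have hr1 : 0 ≤ (log m - log k) ^ (1 / p) := Real.rpow_nonneg (by linarith) _
  have hr2 : 0 ≤ (-log m) ^ (1 / p) := Real.rpow_nonneg (by linarith) _
  rw [add_assoc, ENNReal.ofReal_add (by positivity) (by positivity),
    ENNReal.ofReal_add (by positivity) (by positivity), oneil]
  have hadd := en_add hφ1 le_rfl hk.le hkm
  gcongr
  · refine (hold1 hqp hφ hφ1 hk).trans (ENNReal.ofReal_le_ofReal ?_)
    gcongr
    apply Real.rpow_le_rpow (en_nonneg _ _) _ (by positivity)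
    have := en_nonneg (n := n) (φ := φ) k m
    linarith
  · rw [← Set.Ioc_union_Ioc_eq_Ioc hkm hm1, lintegral_union measurableSet_Ioc
      (Set.Ioc_disjoint_Ioc_of_le le_rfl)]
    gcongr
    · refine (hold2 hqp hφ hφ1 hk hkm).trans (ENNReal.ofReal_le_ofReal ?_)
      gcongr
      apply Real.rpow_le_rpow (en_nonneg _ _) _ (by positivity)
      have := en_nonneg (n := n) (φ := φ) 0 k
      linarith
    · refine (hold2 hqp hφ hφ1 hm hm1).trans (ENNReal.ofReal_le_ofReal ?_)
      rw [Real.log_one, zero_sub]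
      apply mul_le_of_le_one_left hr2
      exact Real.rpow_le_one (en_nonneg _ _) (en_le_one hφ1 hm.le) (by positivity)

/-- abstract one-dimensional conclusion -/
lemma oneil_sum (hn : 2 ≤ n) (hqp : (n : ℝ).HolderConjugate p) :
    ∃ C : ℝ, 0 < C ∧ ∀ φ : ℝ → ENNReal, Measurable φ →
      ∫⁻ s in Set.Ioi (0 : ℝ), φ s ^ (n : ℝ) ≤ 1 → ∀ m : ℕ → ℝ, (∀ j, 0 ≤ m j) → (∀ j, m j ≤ 1) →
      Antitone m → (∀ j : ℕ, 0 < m j → ENNReal.ofReal ((j : ℝ) ^ (1 / p)) ≤ oneil n p φ (m j)) →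
      ∑' j : ℕ, ENNReal.ofReal (exp j * m j) ≤ ENNReal.ofReal C := by
  obtain ⟨C, hC, h⟩ := num3 hn hqp
  refine ⟨C, hC, fun φ hφ hφ1 m hm0 hm1 hanti hj => h m (fun j => tailL n φ (m j)) hm0 hm1 hanti
    (fun j => tailL_nonneg _) (fun j => ?_) (fun j hj0 => ?_) (fun i j hij hj0 => ?_)⟩
  · rw [tailL_pow hqp]; exact en_le_one hφ1 le_rfl
  · have h1 := (hj j hj0).trans (oneil_H1 hqp hφ hφ1 hj0 (hm1 j))
    rwa [ENNReal.ofReal_le_ofReal_iff] at h1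
    have hlog := Real.log_nonpos (hm0 j) (hm1 j)
    have hL := en_le_one (c := m j) hφ1 le_rfl
    rw [tailL_pow hqp]
    exact add_nonneg (mul_nonneg (by positivity) (tailL_nonneg _))
      (mul_nonneg (Real.rpow_nonneg (by linarith) _) (Real.rpow_nonneg (by linarith) _))
  · have h1 := (hj j hj0).trans (oneil_H2 hqp hφ hφ1 hj0 (hanti hij.le) (hm1 i))
    rwa [ENNReal.ofReal_le_ofReal_iff] at h1
    have hm : 0 < m i := hj0.trans_le (hanti hij.le)
    have hlog := Real.log_nonpos hm.le (hm1 i)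
    have hlog2 := Real.log_le_log hj0 (hanti hij.le)
    have hT := tailL_nonneg (n := n) (φ := φ) (m i)
    have hr1 : 0 ≤ (log (m i) - log (m j)) ^ (1 / p) := Real.rpow_nonneg (by linarith) _
    have hr2 : 0 ≤ (-log (m i)) ^ (1 / p) := Real.rpow_nonneg (by linarith) _
    positivity

end

end RMT


namespace RMT

/-- the Riesz kernel -/
noncomputable def kern (n : ℕ) (z : EuclideanSpace ℝ (Fin n)) : ENNReal :=
  ENNReal.ofReal ((‖z‖ ^ (n - 1))⁻¹)

/-- volume of the unit ball -/
noncomputable def bet (n : ℕ) : ℝ := (volume (Metric.ball (0 : EuclideanSpace ℝ (Fin n)) 1)).toReal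

lemma measurable_kern (n : ℕ) : Measurable (kern n) := by
  unfold kern; fun_prop

lemma ofReal_bet (n : ℕ) : ENNReal.ofReal (bet n) =
    volume (Metric.ball (0 : EuclideanSpace ℝ (Fin n)) 1) :=
  ENNReal.ofReal_toReal measure_ball_lt_top.ne

lemma bet_pos (n : ℕ) : 0 < bet n :=
  ENNReal.toReal_pos (Metric.measure_ball_pos _ _ one_pos).ne' measure_ball_lt_top.ne

lemma polar {n : ℕ} (G : EuclideanSpace ℝ (Fin n) → ENNReal) (hn : 2 ≤ n) (hG : Measurable G) :
    ∫⁻ z, G z = ∫⁻ θ, (∫⁻ r in Set.Ioi (0 : ℝ), ENNReal.ofReal (r ^ (n - 1)) *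
      G (r • (θ : EuclideanSpace ℝ (Fin n))))
      ∂((volume : Measure (EuclideanSpace ℝ (Fin n))).toSphere) := by
  have : Nonempty (Fin n) := ⟨⟨0, by omega⟩⟩
  set μ := (volume : Measure (EuclideanSpace ℝ (Fin n))) with hμ
  have hd : Module.finrank ℝ (EuclideanSpace ℝ (Fin n)) = n := by simp
  have hmeas : Measurable (fun x : (Metric.sphere (0 : EuclideanSpace ℝ (Fin n)) 1) ×
      (Set.Ioi (0 : ℝ)) => G ((x.2 : ℝ) • (x.1 : EuclideanSpace ℝ (Fin n)))) := by
    apply hG.comp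
    fun_prop
  calc ∫⁻ z, G z ∂μ = ∫⁻ x : ({(0)}ᶜ : Set (EuclideanSpace ℝ (Fin n))), G x ∂(μ.comap (↑)) := by
        rw [lintegral_subtype_comap (measurableSet_singleton _).compl, restrict_compl_singleton]
    _ = ∫⁻ x, G ((x.2 : ℝ) • (x.1 : EuclideanSpace ℝ (Fin n)))
          ∂μ.toSphere.prod (.volumeIoiPow (Module.finrank ℝ (EuclideanSpace ℝ (Fin n)) - 1)) := by
        rw [← μ.measurePreserving_homeomorphUnitSphereProd.lintegral_comp_emb
          (Homeomorph.measurableEmbedding _)]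
        apply lintegral_congr
        intro a
        rw [← homeomorphUnitSphereProd_symm_apply_coe, Homeomorph.symm_apply_apply]
    _ = _ := by
        rw [lintegral_prod _ hmeas.aemeasurable]
        apply lintegral_congr
        intro θ
        rw [Measure.volumeIoiPow, hd, lintegral_withDensity_eq_lintegral_mul _ (by fun_prop)
          (by exact hmeas.comp (measurable_prodMk_left))]
        simp only [Pi.mul_apply]
        exact lintegral_subtype_comap measurableSet_Ioi (fun a : ℝ => ENNReal.ofReal (a ^ (n - 1)) *
          G (a • (θ : EuclideanSpace ℝ (Fin n))))

lemma polar_kern {n : ℕ} (G : EuclideanSpace ℝ (Fin n) → ENNReal) (hn : 2 ≤ n) (hG : Measurable G) :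
    ∫⁻ z, G z * kern n z = ∫⁻ θ, (∫⁻ r in Set.Ioi (0 : ℝ),
      G (r • (θ : EuclideanSpace ℝ (Fin n))))
      ∂((volume : Measure (EuclideanSpace ℝ (Fin n))).toSphere) := by
  rw [polar (fun z => G z * kern n z) hn (hG.mul (measurable_kern n))]
  apply lintegral_congr
  intro θ
  apply setLIntegral_congr_fun measurableSet_Ioi
  intro r hr
  have hr : 0 < r := hr
  have hθ : ‖(θ : EuclideanSpace ℝ (Fin n))‖ = 1 := by simpa using θ.2
  simp only [kern, norm_smul, hθ, mul_one, Real.norm_of_nonneg hr.le]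
  rw [mul_comm (G _), ← mul_assoc, ← ENNReal.ofReal_mul (by positivity),
    mul_inv_cancel₀ (by positivity), ENNReal.ofReal_one, one_mul]

lemma toSphere_univ {n : ℕ} : (volume : Measure (EuclideanSpace ℝ (Fin n))).toSphere Set.univ =
    ENNReal.ofReal (n * bet n) := by
  rw [Measure.toSphere_apply_univ, ENNReal.ofReal_mul (by positivity), ofReal_bet]
  simp

lemma ball_kern {n : ℕ} (hn : 2 ≤ n) {R : ℝ} (hR : 0 ≤ R) :
    ∫⁻ z in Metric.ball (0 : EuclideanSpace ℝ (Fin n)) R, kern n z = ENNReal.ofReal (n * bet n * R) := by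
  have h : ∫⁻ z in Metric.ball (0 : EuclideanSpace ℝ (Fin n)) R, kern n z =
      ∫⁻ z, (Metric.ball (0 : EuclideanSpace ℝ (Fin n)) R).indicator 1 z * kern n z := by
    rw [← lintegral_indicator measurableSet_ball]
    apply lintegral_congr
    intro z
    by_cases hz : z ∈ Metric.ball (0 : EuclideanSpace ℝ (Fin n)) R <;> simp [hz]
  rw [h, polar_kern _ hn (measurable_one.indicator measurableSet_ball)]
  have h2 : ∀ θ : Metric.sphere (0 : EuclideanSpace ℝ (Fin n)) 1, ∫⁻ r in Set.Ioi (0 : ℝ),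
      (Metric.ball (0 : EuclideanSpace ℝ (Fin n)) R).indicator 1
        (r • (θ : EuclideanSpace ℝ (Fin n))) = ENNReal.ofReal R := by
    intro θ
    have hθ : ‖(θ : EuclideanSpace ℝ (Fin n))‖ = 1 := by simpa using θ.2
    calc _ = ∫⁻ r in Set.Ioi (0 : ℝ), (Set.Iio R).indicator (1 : ℝ → ENNReal) r := by
          apply setLIntegral_congr_fun measurableSet_Ioi
          intro r hr
          have hr : 0 < r := hr
          simp [Set.indicator, norm_smul, hθ, abs_of_pos hr]
      _ = ENNReal.ofReal R := by
          rw [lintegral_indicator_one measurableSet_Iio, Measure.restrict_apply measurableSet_Iio,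
            Set.Iio_inter_Ioi, Real.volume_Ioo, sub_zero]
  simp_rw [h2]
  rw [lintegral_const, toSphere_univ, ← ENNReal.ofReal_mul hR]
  congr 1; ring

lemma bathtub {n : ℕ} (hn : 2 ≤ n) {p : ℝ} (hqp : (n : ℝ).HolderConjugate p)
    (S : Set (EuclideanSpace ℝ (Fin n))) (hS : MeasurableSet S) {s : ℝ} (hs : 0 ≤ s)
    (hSs : volume S = ENNReal.ofReal s) (x : EuclideanSpace ℝ (Fin n)) :
    ∫⁻ y in S, kern n (y - x) ≤ ENNReal.ofReal (n * bet n ^ (1 / p) * s ^ (1 / (n : ℝ))) := by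
  have : Nonempty (Fin n) := ⟨⟨0, by omega⟩⟩
  have hb := bet_pos n
  have hn0 : (n : ℝ) ≠ 0 := by positivity
  rcases hs.eq_or_lt with h0 | hspos
  · have : volume S = 0 := by rw [hSs, ← h0]; simp
    rw [setLIntegral_measure_zero _ _ this]; simp
  set r := (s / bet n) ^ (1 / (n : ℝ)) with hr
  have hrpos : 0 < r := by positivity
  have hrn : r ^ n = s / bet n := by
    rw [← Real.rpow_natCast, hr, rpow_inv_rpow' (by positivity) (by positivity)]
  set B := Metric.ball x r with hB
  have hBm : MeasurableSet B := measurableSet_ball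
  have hBv : volume B = ENNReal.ofReal s := by
    rw [hB, Measure.addHaar_ball_of_pos _ _ hrpos, ← ofReal_bet, finrank_euclideanSpace_fin, hrn,
      ← ENNReal.ofReal_mul (by positivity)]
    congr 1; field_simp
  have hdiff : volume (S \ B) = volume (B \ S) := by
    have h1 := measure_sdiff_add_inter (μ := volume) S hBm
    have h2 := measure_sdiff_add_inter (μ := volume) B hS
    rw [hSs, ← hBv, ← h2, Set.inter_comm B S] at h1
    refine (ENNReal.add_left_inj ?_).1 h1
    exact ne_top_of_le_ne_top (by rw [hSs]; exact ENNReal.ofReal_ne_top)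
      (measure_mono Set.inter_subset_left)
  set c := ENNReal.ofReal ((r ^ (n - 1))⁻¹) with hc
  have hout : ∫⁻ y in S \ B, kern n (y - x) ≤ c * volume (S \ B) := by
    rw [← setLIntegral_const]
    apply setLIntegral_mono' (hS.diff hBm)
    intro y hy
    apply ENNReal.ofReal_le_ofReal
    have : r ≤ ‖y - x‖ := by
      have := hy.2
      rw [hB, Metric.mem_ball, dist_eq_norm] at this
      exact not_lt.1 this
    gcongr
  have hin : c * volume (B \ S) ≤ ∫⁻ y in B \ S, kern n (y - x) := by
    rw [← setLIntegral_const]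
    apply lintegral_mono_ae
    have hne : ∀ᵐ y ∂(volume.restrict (B \ S)), y ≠ x := by
      apply ae_restrict_of_ae
      exact Measure.ae_ne volume x
    filter_upwards [hne, ae_restrict_mem (hBm.diff hS)] with y hy hyB
    apply ENNReal.ofReal_le_ofReal
    have h1 : ‖y - x‖ ≤ r := by
      have := hyB.1
      rw [hB, Metric.mem_ball, dist_eq_norm] at this
      exact this.le
    have h2 : 0 < ‖y - x‖ := norm_pos_iff.2 (sub_ne_zero.2 hy)
    gcongr
  have hball : ∫⁻ y in B, kern n (y - x) = ENNReal.ofReal (n * bet n * r) := by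
    rw [← ball_kern hn hrpos.le, ← lintegral_indicator hBm, ← lintegral_indicator measurableSet_ball,
      ← lintegral_sub_right_eq_self
        ((Metric.ball (0 : EuclideanSpace ℝ (Fin n)) r).indicator fun z => kern n z) x]
    apply lintegral_congr
    intro y
    simp [Set.indicator, hB, dist_eq_norm]
  calc ∫⁻ y in S, kern n (y - x)
      = (∫⁻ y in S ∩ B, kern n (y - x)) + ∫⁻ y in S \ B, kern n (y - x) :=
        (lintegral_inter_add_sdiff _ _ hBm).symm
    _ ≤ (∫⁻ y in B ∩ S, kern n (y - x)) + ∫⁻ y in B \ S, kern n (y - x) := by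
        rw [Set.inter_comm S B]
        gcongr 1
        exact hout.trans ((le_of_eq (by rw [hdiff])).trans hin)
    _ = ∫⁻ y in B, kern n (y - x) := lintegral_inter_add_sdiff _ _ hS
    _ = _ := by
        rw [hball]
        congr 1
        have h1 : 1 / p = 1 - 1 / (n : ℝ) := by
          have := hqp.inv_add_inv_eq_one
          simp only [one_div]; linarith
        rw [hr, Real.div_rpow hs hb.le, h1, Real.rpow_sub hb, Real.rpow_one]
        ring

end RMT


namespace RMT

/-- weight -/
noncomputable def wt (n : ℕ) (p m σ : ℝ) : ENNReal :=
  if σ ≤ m then ENNReal.ofReal (n * m ^ (-(1 / p))) else ENNReal.ofReal (σ ^ (-(1 / p)))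

lemma measurable_wt (n : ℕ) (p m : ℝ) : Measurable (wt n p m) := by
  unfold wt
  apply Measurable.ite measurableSet_Iic <;> fun_prop

lemma wt_int {n : ℕ} (hn : 2 ≤ n) {p m s : ℝ} (hqp : (n : ℝ).HolderConjugate p) (hm : 0 < m)
    (hs : 0 ≤ s) : ENNReal.ofReal (n * min (s ^ (1 / (n : ℝ))) (s * m ^ (-(1 / p)))) ≤
      ∫⁻ σ in Set.Ioo 0 s, wt n p m σ := by
  have hp0 := hqp.symm.pos
  have h1 : -(1 / p) + 1 = 1 / (n : ℝ) := by
    have := hqp.inv_add_inv_eq_one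
    simp only [one_div]; linarith
  have hn0 : (0 : ℝ) < n := hqp.pos
  have hn1 : 0 < 1 / (n : ℝ) := by positivity
  rcases le_or_gt s m with hsm | hsm
  · have : ∫⁻ σ in Set.Ioo 0 s, wt n p m σ = ∫⁻ σ in Set.Ioo 0 s, ENNReal.ofReal (n * m ^ (-(1 / p))) := by
      apply setLIntegral_congr_fun measurableSet_Ioo
      intro σ hσ
      simp only [wt]; rw [if_pos (hσ.2.le.trans hsm)]
    rw [this, setLIntegral_const, Real.volume_Ioo, sub_zero, ← ENNReal.ofReal_mul (by positivity)]
    apply ENNReal.ofReal_le_ofReal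
    calc _ ≤ n * (s * m ^ (-(1 / p))) := by gcongr; exact min_le_right _ _
      _ = _ := by ring
  · have e1 : ∫⁻ σ in Set.Ioo 0 s, wt n p m σ =
        (∫⁻ σ in Set.Ioc 0 m, wt n p m σ) + ∫⁻ σ in Set.Ioo m s, wt n p m σ := by
      rw [← lintegral_union measurableSet_Ioo, Set.Ioc_union_Ioo_eq_Ioo hm.le hsm]
      rw [Set.disjoint_left]; intro x hx hy; exact absurd hx.2 (not_le.2 hy.1)
    have e2 : ∫⁻ σ in Set.Ioc 0 m, wt n p m σ = ENNReal.ofReal (n * m ^ (1 / (n : ℝ))) := by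
      have : ∫⁻ σ in Set.Ioc 0 m, wt n p m σ = ∫⁻ σ in Set.Ioc 0 m, ENNReal.ofReal (n * m ^ (-(1 / p))) := by
        apply setLIntegral_congr_fun measurableSet_Ioc
        intro σ hσ
        simp only [wt]; rw [if_pos hσ.2]
      rw [this, setLIntegral_const, Real.volume_Ioc, sub_zero, ← ENNReal.ofReal_mul (by positivity),
        mul_assoc, ← h1, Real.rpow_add hm, Real.rpow_one]
    have e3 : ∫⁻ σ in Set.Ioo m s, wt n p m σ =
        ENNReal.ofReal (n * (s ^ (1 / (n : ℝ)) - m ^ (1 / (n : ℝ)))) := by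
      have : ∫⁻ σ in Set.Ioo m s, wt n p m σ = ∫⁻ σ in Set.Ioc m s, ENNReal.ofReal (σ ^ (-(1 / p))) := by
        rw [← restrict_Ioo_eq_restrict_Ioc]
        apply setLIntegral_congr_fun measurableSet_Ioo
        intro σ hσ
        simp only [wt]; rw [if_neg (not_le.2 hσ.1)]
      rw [this, ← ofReal_integral_eq_lintegral_ofReal, ← intervalIntegral.integral_of_le hsm.le,
        integral_rpow (Or.inl (by linarith)), h1]
      · congr 1; field_simp
      · exact (intervalIntegrable_iff_integrableOn_Ioc_of_le hsm.le).1
          (intervalIntegral.intervalIntegrable_rpow' (by linarith))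
      · filter_upwards [ae_restrict_mem measurableSet_Ioc] with x hx
        have : 0 < x := hm.trans hx.1
        simp only [Pi.zero_apply]; positivity
    have hmono : m ^ (1 / (n : ℝ)) ≤ s ^ (1 / (n : ℝ)) := Real.rpow_le_rpow hm.le hsm.le hn1.le
    rw [e1, e2, e3, ← ENNReal.ofReal_add (by positivity) (mul_nonneg hn0.le (by linarith))]
    apply ENNReal.ofReal_le_ofReal
    calc _ ≤ n * (s ^ (1 / (n : ℝ))) := by gcongr; exact min_le_left _ _
      _ = _ := by ring

lemma kern_symm (n : ℕ) (x y : EuclideanSpace ℝ (Fin n)) : kern n (y - x) = kern n (x - y) := by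
  simp only [kern, norm_sub_rev]

lemma measurable_kern2 (n : ℕ) : Measurable (fun z : EuclideanSpace ℝ (Fin n) ×
    EuclideanSpace ℝ (Fin n) => kern n (z.1 - z.2)) :=
  (measurable_kern n).comp (by fun_prop)

lemma double {n : ℕ} (hn : 2 ≤ n) {p : ℝ} (hqp : (n : ℝ).HolderConjugate p)
    (S E : Set (EuclideanSpace ℝ (Fin n))) (hS : MeasurableSet S) (hE : MeasurableSet E) {s m : ℝ}
    (hs : 0 ≤ s) (hm : 0 < m)
    (hSs : volume S = ENNReal.ofReal s) (hEm : volume E = ENNReal.ofReal m) :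
    ∫⁻ y in S, ∫⁻ x in E, kern n (y - x) ≤ ENNReal.ofReal (m * bet n ^ (1 / p)) *
      ENNReal.ofReal (n * min (s ^ (1 / (n : ℝ))) (s * m ^ (-(1 / p)))) := by
  have hb := bet_pos n
  have h1 : -(1 / p) + 1 = 1 / (n : ℝ) := by
    have := hqp.inv_add_inv_eq_one
    simp only [one_div]; linarith
  rw [← ENNReal.ofReal_mul (by positivity)]
  rcases min_choice (s ^ (1 / (n : ℝ))) (s * m ^ (-(1 / p))) with h | h <;> rw [h]
  · rw [lintegral_lintegral_swap (measurable_kern2 n).aemeasurable]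
    calc _ ≤ ∫⁻ x in E, ENNReal.ofReal (n * bet n ^ (1 / p) * s ^ (1 / (n : ℝ))) := by
          apply lintegral_mono
          intro x
          exact bathtub hn hqp S hS hs hSs x
      _ = _ := by
          rw [setLIntegral_const, hEm, ← ENNReal.ofReal_mul (by positivity)]
          congr 1; ring
  · calc _ ≤ ∫⁻ y in S, ENNReal.ofReal (n * bet n ^ (1 / p) * m ^ (1 / (n : ℝ))) := by
          apply lintegral_mono
          intro y
          simp_rw [kern_symm n _ y]
          exact bathtub hn hqp E hE hm.le hEm y
      _ = _ := by
          rw [setLIntegral_const, hSs, ← ENNReal.ofReal_mul (by positivity)]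
          congr 1
          rw [← h1, Real.rpow_add hm, Real.rpow_one]
          ring

/-- decreasing rearrangement -/
noncomputable def rearr {n : ℕ} (F : EuclideanSpace ℝ (Fin n) → ℝ) (σ : ℝ) : ENNReal :=
  volume {c : ℝ | 0 < c ∧ ENNReal.ofReal σ < volume {y | c < F y}}

lemma measurable_rearr {n : ℕ} (F : EuclideanSpace ℝ (Fin n) → ℝ) : Measurable (rearr F) := by
  apply Antitone.measurable
  intro a b hab
  apply measure_mono
  intro c hc
  exact ⟨hc.1, (ENNReal.ofReal_le_ofReal hab).trans_lt hc.2⟩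

lemma measurable_dist {n : ℕ} (F : EuclideanSpace ℝ (Fin n) → ℝ) :
    Measurable (fun c : ℝ => volume {y | c < F y}) := by
  apply Antitone.measurable
  intro a b hab
  apply measure_mono
  intro y hy
  exact lt_of_le_of_lt hab hy

set_option maxHeartbeats 800000 in
lemma oneil_bound {n : ℕ} (hn : 2 ≤ n) {p : ℝ} (hqp : (n : ℝ).HolderConjugate p)
    (F : EuclideanSpace ℝ (Fin n) → ℝ) (hF : Measurable F)
    (hF1 : ∀ c : ℝ, 0 < c → volume {y | c < F y} ≤ 1)
    (E : Set (EuclideanSpace ℝ (Fin n))) (hE : MeasurableSet E) {m : ℝ} (hm : 0 < m) (hm1 : m ≤ 1)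
    (hEm : volume E = ENNReal.ofReal m) :
    ∫⁻ x in E, ∫⁻ y, ENNReal.ofReal (F y) * kern n (y - x) ≤
      ENNReal.ofReal (m * bet n ^ (1 / p)) * oneil n p (rearr F) m := by
  set K : EuclideanSpace ℝ (Fin n) → ENNReal := fun y => ∫⁻ x in E, kern n (y - x) with hK
  have hKm : Measurable K := (measurable_kern2 n).lintegral_prod_right'
  have hlay : ∀ y, ENNReal.ofReal (F y) =
      ∫⁻ c in Set.Ioi (0 : ℝ), {y | c < F y}.indicator (1 : EuclideanSpace ℝ (Fin n) → ENNReal) y := by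
    intro y
    calc ENNReal.ofReal (F y) = ∫⁻ c in Set.Ioi (0 : ℝ), (Set.Iio (F y)).indicator 1 c := by
          rw [lintegral_indicator_one measurableSet_Iio, Measure.restrict_apply measurableSet_Iio,
            Set.Iio_inter_Ioi, Real.volume_Ioo, sub_zero]
      _ = _ := by
          apply lintegral_congr; intro c; simp [Set.indicator]
  have hjoint : Measurable (fun z : EuclideanSpace ℝ (Fin n) × ℝ =>
      {y | z.2 < F y}.indicator (1 : EuclideanSpace ℝ (Fin n) → ENNReal) z.1) := by
    have hset : MeasurableSet {z : EuclideanSpace ℝ (Fin n) × ℝ | z.2 < F z.1} :=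
      measurableSet_lt measurable_snd (hF.comp measurable_fst)
    have := (measurable_one (α := ENNReal)).indicator hset
    exact this

  calc ∫⁻ x in E, ∫⁻ y, ENNReal.ofReal (F y) * kern n (y - x)
      = ∫⁻ y, ∫⁻ x in E, ENNReal.ofReal (F y) * kern n (y - x) := by
        have hmm : Measurable (fun z : EuclideanSpace ℝ (Fin n) × EuclideanSpace ℝ (Fin n) =>
            ENNReal.ofReal (F z.2) * kern n (z.2 - z.1)) := by
          have h1 : Measurable (fun z : EuclideanSpace ℝ (Fin n) × EuclideanSpace ℝ (Fin n) =>
            ENNReal.ofReal (F z.2)) := (hF.comp measurable_snd).ennreal_ofReal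
          have h2 : Measurable (fun z : EuclideanSpace ℝ (Fin n) × EuclideanSpace ℝ (Fin n) =>
            kern n (z.2 - z.1)) := (measurable_kern n).comp (by fun_prop)
          exact h1.mul h2
        exact lintegral_lintegral_swap hmm.aemeasurable
    _ = ∫⁻ y, ENNReal.ofReal (F y) * K y := by
        apply lintegral_congr
        intro y
        rw [lintegral_const_mul]
        exact (measurable_kern n).comp (by fun_prop)
    _ = ∫⁻ y, ∫⁻ c in Set.Ioi (0 : ℝ), {y | c < F y}.indicator (1 : EuclideanSpace ℝ (Fin n) → ENNReal) y * K y := by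
        apply lintegral_congr
        intro y
        rw [lintegral_mul_const, ← hlay]
        exact hjoint.comp (measurable_prodMk_left)
    _ = ∫⁻ c in Set.Ioi (0 : ℝ), ∫⁻ y, {y | c < F y}.indicator (1 : EuclideanSpace ℝ (Fin n) → ENNReal) y * K y := by
        rw [lintegral_lintegral_swap]
        exact (hjoint.mul (hKm.comp measurable_fst)).aemeasurable
    _ = ∫⁻ c in Set.Ioi (0 : ℝ), ∫⁻ y in {y | c < F y}, K y := by
        apply lintegral_congr
        intro c
        rw [← lintegral_indicator (measurableSet_lt measurable_const hF)]
        apply lintegral_congr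
        intro y
        by_cases hy : y ∈ {y | c < F y} <;> simp only [Set.indicator, hy, if_true, if_false,
          Pi.one_apply, one_mul, zero_mul]
    _ ≤ ∫⁻ c in Set.Ioi (0 : ℝ), ENNReal.ofReal (m * bet n ^ (1 / p)) *
          ∫⁻ σ in Set.Ioi (0 : ℝ), {σ : ℝ | ENNReal.ofReal σ < volume {y | c < F y}}.indicator
            (1 : ℝ → ENNReal) σ * wt n p m σ := by
        apply setLIntegral_mono' measurableSet_Ioi
        intro c hc
        have hfin : volume {y | c < F y} ≠ ⊤ := ne_top_of_le_ne_top ENNReal.one_ne_top (hF1 c hc)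
        set s := (volume {y | c < F y}).toReal with hs
        have hs0 : 0 ≤ s := ENNReal.toReal_nonneg
        have hSs : volume {y | c < F y} = ENNReal.ofReal s := (ENNReal.ofReal_toReal hfin).symm
        refine (double hn hqp _ E (measurableSet_lt measurable_const hF) hE hs0 hm hSs hEm).trans ?_
        gcongr
        refine (wt_int hn hqp hm hs0).trans (le_of_eq ?_)
        rw [hSs, ← lintegral_indicator measurableSet_Ioo, ← lintegral_indicator measurableSet_Ioi]
        apply lintegral_congr
        intro σ
        by_cases h0 : 0 < σ
        · by_cases h1 : σ < s
          · have : ENNReal.ofReal σ < ENNReal.ofReal s :=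
              (ENNReal.ofReal_lt_ofReal_iff (h0.trans h1)).2 h1
            simp [h0, h1, this, Set.indicator]
          · have : ¬ ENNReal.ofReal σ < ENNReal.ofReal s := by
              rw [not_lt]; exact ENNReal.ofReal_le_ofReal (not_lt.1 h1)
            simp [h1, this, Set.indicator]
        · simp [h0, Set.indicator]
    _ = ENNReal.ofReal (m * bet n ^ (1 / p)) * ∫⁻ σ in Set.Ioi (0 : ℝ), rearr F σ * wt n p m σ := by
        have hset : MeasurableSet {z : ℝ × ℝ | ENNReal.ofReal z.2 < volume {y | z.1 < F y}} :=
          measurableSet_lt (by fun_prop) ((measurable_dist F).comp measurable_fst)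
        have hj2 : Measurable (fun z : ℝ × ℝ => {σ : ℝ | ENNReal.ofReal σ < volume {y | z.1 < F y}}.indicator
            (1 : ℝ → ENNReal) z.2 * wt n p m z.2) := by
          refine Measurable.mul ?_ ((measurable_wt n p m).comp measurable_snd)
          exact (measurable_one (α := ENNReal)).indicator hset
        rw [lintegral_const_mul _ hj2.lintegral_prod_right', lintegral_lintegral_swap hj2.aemeasurable]
        congr 1
        apply lintegral_congr
        intro σ
        have hset2 : MeasurableSet {c : ℝ | ENNReal.ofReal σ < volume {y | c < F y}} :=
          measurableSet_lt measurable_const (measurable_dist F)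
        calc _ = ∫⁻ c in Set.Ioi (0 : ℝ), {c : ℝ | ENNReal.ofReal σ < volume {y | c < F y}}.indicator
              (1 : ℝ → ENNReal) c * wt n p m σ := rfl
          _ = _ := by
            rw [lintegral_mul_const _ ((measurable_one (α := ENNReal)).indicator hset2),
              lintegral_indicator_one hset2, Measure.restrict_apply hset2, rearr]
            congr 2
            ext c
            simp [and_comm]
    _ = _ := by
        congr 1
        rw [oneil]
        have e0 : ∫⁻ σ in Set.Ioi (1 : ℝ), rearr F σ * wt n p m σ = 0 := by
          rw [setLIntegral_eq_zero measurableSet_Ioi]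
          intro σ hσ
          have hσ : 1 < σ := hσ
          have : rearr F σ = 0 := by
            rw [rearr]
            convert measure_empty (μ := volume)
            ext c
            simp only [Set.mem_ofPred_eq, Set.mem_empty_iff_false, iff_false, not_and, not_lt]
            intro hc
            refine (hF1 c hc).trans ?_
            rw [← ENNReal.ofReal_one]
            exact ENNReal.ofReal_le_ofReal hσ.le
          simp [this]
        rw [← Set.Ioc_union_Ioi_eq_Ioi hm.le, lintegral_union measurableSet_Ioi
          (Set.Ioc_disjoint_Ioi le_rfl), ← Set.Ioc_union_Ioi_eq_Ioi hm1,
          lintegral_union measurableSet_Ioi (Set.Ioc_disjoint_Ioi le_rfl), e0, add_zero]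
        congr 1
        · rw [← lintegral_const_mul _ (measurable_rearr F)]
          apply setLIntegral_congr_fun measurableSet_Ioc
          intro σ hσ
          simp only [wt]; rw [if_pos hσ.2, mul_comm]
        · apply setLIntegral_congr_fun measurableSet_Ioc
          intro σ hσ
          simp only [wt]; rw [if_neg (not_le.2 hσ.1)]

lemma rearr_norm {n : ℕ} (hn : 2 ≤ n) (F : EuclideanSpace ℝ (Fin n) → ℝ) (hF : Measurable F)
    (hF0 : ∀ y, 0 ≤ F y) {M : ℝ} (hM : ∀ y, F y ≤ M) :
    ∫⁻ σ in Set.Ioi (0 : ℝ), rearr F σ ^ (n : ℝ) ≤ ∫⁻ y, ENNReal.ofReal (F y ^ (n : ℝ)) := by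
  have hn0 : (0 : ℝ) < n := by positivity
  have hfin : ∀ σ, rearr F σ ≤ ENNReal.ofReal M := by
    intro σ
    calc rearr F σ ≤ volume (Set.Ioo 0 M) := by
          apply measure_mono
          rintro c ⟨hc, h2⟩
          refine ⟨hc, ?_⟩
          by_contra hcon
          have : {y | c < F y} = ∅ := by
            ext y; simp only [Set.mem_ofPred_eq, Set.mem_empty_iff_false, iff_false, not_lt]
            exact (hM y).trans (not_lt.1 hcon)
          rw [this] at h2
          simp at h2
      _ = _ := by simp
  have hne : ∀ σ, rearr F σ ≠ ⊤ := fun σ => ne_top_of_le_ne_top ENNReal.ofReal_ne_top (hfin σ)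
  have e1 : ∫⁻ σ in Set.Ioi (0 : ℝ), rearr F σ ^ (n : ℝ) =
      ∫⁻ σ in Set.Ioi (0 : ℝ), ENNReal.ofReal ((rearr F σ).toReal ^ (n : ℝ)) := by
    apply lintegral_congr
    intro σ
    rw [← ENNReal.ofReal_rpow_of_nonneg ENNReal.toReal_nonneg hn0.le, ENNReal.ofReal_toReal (hne σ)]
  rw [e1, lintegral_rpow_eq_lintegral_meas_lt_mul _ (Filter.Eventually.of_forall fun _ => ENNReal.toReal_nonneg)
    (measurable_rearr F).ennreal_toReal.aemeasurable hn0,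
    lintegral_rpow_eq_lintegral_meas_lt_mul _ (Filter.Eventually.of_forall hF0) hF.aemeasurable hn0]
  refine mul_le_mul_right ?_ _
  apply setLIntegral_mono' measurableSet_Ioi
  intro c hc
  have hc : 0 < c := hc
  gcongr
  have hms : MeasurableSet {a | c < (rearr F a).toReal} :=
    measurableSet_lt measurable_const (measurable_rearr F).ennreal_toReal
  rw [Measure.restrict_apply hms]
  by_cases htop : volume {y | c < F y} = ⊤
  · rw [htop]; exact le_top
  calc _ ≤ volume (Set.Ioo 0 (volume {y | c < F y}).toReal) := by
        apply measure_mono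
        rintro σ ⟨h1, h2⟩
        have h2 : 0 < σ := h2
        refine ⟨h2, ?_⟩
        by_contra hcon
        have h3 : volume {y | c < F y} ≤ ENNReal.ofReal σ := by
          rw [← ENNReal.ofReal_toReal htop]
          exact ENNReal.ofReal_le_ofReal (not_lt.1 hcon)
        have h4 : rearr F σ ≤ ENNReal.ofReal c := by
          calc rearr F σ ≤ volume (Set.Ioo 0 c) := by
                apply measure_mono
                rintro d ⟨hd, h5⟩
                refine ⟨hd, ?_⟩
                by_contra hcd
                have : volume {y | d < F y} ≤ volume {y | c < F y} := by
                  apply measure_mono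
                  intro y hy
                  exact lt_of_le_of_lt (not_lt.1 hcd) hy
                exact absurd (h5.trans_le (this.trans h3)) (lt_irrefl _)
            _ = _ := by simp
        have h5 := ENNReal.toReal_mono ENNReal.ofReal_ne_top h4
        rw [ENNReal.toReal_ofReal hc.le] at h5
        exact absurd h1 (not_lt.2 h5)
    _ = _ := by
        rw [Real.volume_Ioo, sub_zero, ENNReal.ofReal_toReal htop]

end RMT


namespace RMT

lemma adams {n : ℕ} (hn : 2 ≤ n) {p : ℝ} (hqp : (n : ℝ).HolderConjugate p) :
    ∃ C : ℝ, 0 < C ∧ ∀ (F : EuclideanSpace ℝ (Fin n) → ℝ) (M : ℝ) (Ω : Set (EuclideanSpace ℝ (Fin n)))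
      (W : EuclideanSpace ℝ (Fin n) → ℝ), Measurable F → (∀ y, 0 ≤ F y) → (∀ y, F y ≤ M) →
      (∀ c : ℝ, 0 < c → volume {y | c < F y} ≤ 1) → ∫⁻ y, ENNReal.ofReal (F y ^ (n : ℝ)) ≤ 1 →
      MeasurableSet Ω → volume Ω ≤ 1 → Measurable W → (∀ x ∈ Ω, 0 ≤ W x) →
      (∀ x ∈ Ω, ENNReal.ofReal (bet n ^ (1 / p) * W x) ≤
        ∫⁻ y, ENNReal.ofReal (F y) * kern n (y - x)) →
      ∫⁻ x in Ω, ENNReal.ofReal (exp (W x ^ p)) ≤ ENNReal.ofReal C := by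
  obtain ⟨C, hC, hsum⟩ := oneil_sum hn hqp
  refine ⟨exp 1 * C, by positivity, ?_⟩
  intro F M Ω W hF hF0 hFM hF1 hFn hΩ hΩ1 hW hW0 hR
  have hp0 := hqp.symm.pos
  have hb := bet_pos n
  set E : ℕ → Set (EuclideanSpace ℝ (Fin n)) := fun j => Ω ∩ {x | (j : ℝ) ^ (1 / p) ≤ W x} with hEdef
  have hE : ∀ j, MeasurableSet (E j) := fun j => hΩ.inter (measurableSet_le measurable_const hW)
  have hEle : ∀ j, volume (E j) ≤ 1 := fun j => (measure_mono Set.inter_subset_left).trans hΩ1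
  have hEfin : ∀ j, volume (E j) ≠ ⊤ := fun j => ne_top_of_le_ne_top ENNReal.one_ne_top (hEle j)
  set m : ℕ → ℝ := fun j => (volume (E j)).toReal with hmdef
  have hEm : ∀ j, volume (E j) = ENNReal.ofReal (m j) := fun j => (ENNReal.ofReal_toReal (hEfin j)).symm
  have hm0 : ∀ j, 0 ≤ m j := fun j => ENNReal.toReal_nonneg
  have hm1 : ∀ j, m j ≤ 1 := fun j => by
    have := ENNReal.toReal_mono ENNReal.one_ne_top (hEle j)
    simpa using this
  have hanti : Antitone m := by
    intro i j hij
    apply ENNReal.toReal_mono (hEfin i)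
    apply measure_mono
    rintro x ⟨h1, h2⟩
    simp only [Set.mem_ofPred_eq] at h2
    refine ⟨h1, ?_⟩
    simp only [Set.mem_ofPred_eq]
    refine le_trans ?_ h2
    exact Real.rpow_le_rpow (by positivity) (by exact_mod_cast hij) (by positivity)
  have key := hsum (rearr F) (measurable_rearr F) ((rearr_norm hn F hF hF0 hFM).trans hFn) m hm0 hm1 hanti (by
    intro j hj
    have h1 := oneil_bound hn hqp F hF hF1 (E j) (hE j) hj (hm1 j) (hEm j)
    have h2 : ∫⁻ x in E j, ENNReal.ofReal (bet n ^ (1 / p) * (j : ℝ) ^ (1 / p)) ≤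
        ∫⁻ x in E j, ∫⁻ y, ENNReal.ofReal (F y) * kern n (y - x) := by
      apply setLIntegral_mono' (hE j)
      intro x hx
      refine le_trans (ENNReal.ofReal_le_ofReal ?_) (hR x hx.1)
      have := hx.2
      simp only [Set.mem_ofPred_eq] at this
      gcongr
    rw [setLIntegral_const, hEm, ← ENNReal.ofReal_mul (by positivity)] at h2
    have h3 := h2.trans h1
    rw [show bet n ^ (1 / p) * (j : ℝ) ^ (1 / p) * m j = (m j * bet n ^ (1 / p)) * (j : ℝ) ^ (1 / p) by ring,
      ENNReal.ofReal_mul (by positivity)] at h3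
    have hpos : 0 < m j * bet n ^ (1 / p) := by positivity
    exact (ENNReal.mul_le_mul_iff_right (by simpa using hpos) ENNReal.ofReal_ne_top).1 h3)
  calc ∫⁻ x in Ω, ENNReal.ofReal (exp (W x ^ p))
      ≤ ∫⁻ x in Ω, ∑' j : ℕ, (E j).indicator (fun _ => ENNReal.ofReal (exp (j + 1))) x := by
        apply setLIntegral_mono' hΩ
        intro x hx
        have hw := hW0 x hx
        have hfl := Nat.floor_le (Real.rpow_nonneg hw p)
        have hmem : x ∈ E ⌊W x ^ p⌋₊ := by
          refine ⟨hx, ?_⟩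
          simp only [Set.mem_ofPred_eq]
          calc _ ≤ (W x ^ p) ^ (1 / p) := Real.rpow_le_rpow (by positivity) hfl (by positivity)
            _ = W x := by rw [← Real.rpow_mul hw, mul_one_div_cancel hp0.ne', Real.rpow_one]
        refine le_trans ?_ (ENNReal.le_tsum ⌊W x ^ p⌋₊)
        rw [Set.indicator_of_mem hmem]
        apply ENNReal.ofReal_le_ofReal
        exact Real.exp_le_exp.2 (Nat.lt_floor_add_one _).le
    _ = ∑' j : ℕ, ENNReal.ofReal (exp 1) * ENNReal.ofReal (exp j * m j) := by
        rw [lintegral_tsum (fun j => (measurable_const.indicator (hE j)).aemeasurable)]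
        congr 1
        ext j
        rw [lintegral_indicator (hE j), Measure.restrict_restrict (hE j),
          Set.inter_eq_left.2 (Set.inter_subset_left), setLIntegral_const, hEm,
          ← ENNReal.ofReal_mul (by positivity), ← ENNReal.ofReal_mul (by positivity), Real.exp_add]
        congr 1; ring
    _ = ENNReal.ofReal (exp 1) * ∑' j : ℕ, ENNReal.ofReal (exp j * m j) := ENNReal.tsum_mul_left
    _ ≤ _ := by
        rw [ENNReal.ofReal_mul (by positivity)]
        exact mul_le_mul_right key _

end RMT


namespace RMT

lemma ray {g g' : ℝ → ℝ} (hg : ∀ r, HasDerivAt g (g' r) r) (hg' : Continuous g') {R A : ℝ}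
    (hR : 0 ≤ R) (hgR : g R = 0) (hA : 0 ≤ A) (h0 : A < |g 0|) :
    ENNReal.ofReal (|g 0| - A) ≤
      ∫⁻ r in Set.Ioi (0 : ℝ), {r | A < |g r|}.indicator (fun r => ENNReal.ofReal |g' r|) r := by
  have hgc : Continuous g := continuous_iff_continuousAt.2 fun r => (hg r).continuousAt
  have hcl : IsClosed {r | |g r| ≤ A} := isClosed_le hgc.abs continuous_const
  have hcpt : IsCompact (Set.Icc 0 R ∩ {r | |g r| ≤ A}) := isCompact_Icc.inter_right hcl
  obtain ⟨b, hb, hbl⟩ := hcpt.exists_isLeast ⟨R, ⟨hR, le_rfl⟩, by simpa [hgR] using hA⟩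
  have hbA : |g b| ≤ A := hb.2
  have hb0 : 0 ≤ b := hb.1.1
  have hlt : ∀ r ∈ Set.Ioo 0 b, A < |g r| := by
    intro r hr
    by_contra hcon
    exact absurd (hbl ⟨⟨hr.1.le, hr.2.le.trans hb.1.2⟩, not_lt.1 hcon⟩) (not_le.2 hr.2)
  have hftc : ∫ r in (0 : ℝ)..b, g' r = g b - g 0 :=
    intervalIntegral.integral_eq_sub_of_hasDerivAt (fun r _ => hg r) (hg'.intervalIntegrable _ _)
  have h1 : |g 0| - A ≤ ∫ r in (0 : ℝ)..b, |g' r| := by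
    calc |g 0| - A ≤ |g 0| - |g b| := by linarith
      _ ≤ |g 0 - g b| := abs_sub_abs_le_abs_sub _ _
      _ = |∫ r in (0 : ℝ)..b, g' r| := by rw [hftc, abs_sub_comm]
      _ ≤ _ := intervalIntegral.abs_integral_le_integral_abs hb0
  calc ENNReal.ofReal (|g 0| - A) ≤ ENNReal.ofReal (∫ r in (0 : ℝ)..b, |g' r|) :=
        ENNReal.ofReal_le_ofReal h1
    _ = ∫⁻ r in Set.Ioo 0 b, ENNReal.ofReal |g' r| := by
        rw [intervalIntegral.integral_of_le hb0, ofReal_integral_eq_lintegral_ofReal,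
          ← restrict_Ioo_eq_restrict_Ioc]
        · exact (intervalIntegrable_iff_integrableOn_Ioc_of_le hb0).1 (hg'.abs.intervalIntegrable _ _)
        · exact Filter.Eventually.of_forall fun r => abs_nonneg _
    _ = ∫⁻ r in Set.Ioo 0 b, {r | A < |g r|}.indicator (fun r => ENNReal.ofReal |g' r|) r := by
        apply setLIntegral_congr_fun measurableSet_Ioo
        intro r hr
        have hm : r ∈ {r | A < |g r|} := hlt r hr
        simp only [Set.indicator_of_mem hm]
    _ ≤ _ := lintegral_mono_set fun r hr => hr.1

lemma riesz {n : ℕ} (hn : 2 ≤ n) {u : EuclideanSpace ℝ (Fin n) → ℝ} (hu : ContDiff ℝ 1 u)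
    (hs : HasCompactSupport u) {A : ℝ} (hA : 0 ≤ A) (x : EuclideanSpace ℝ (Fin n)) (hx : A < |u x|) :
    ENNReal.ofReal (n * bet n * (|u x| - A)) ≤
      ∫⁻ y, ENNReal.ofReal ({y | A < |u y|}.indicator (fun y => ‖fderiv ℝ u y‖) y) * kern n (y - x) := by
  have hfc : Continuous (fderiv ℝ u) := hu.continuous_fderiv one_ne_zero
  have hdiff : Differentiable ℝ u := hu.differentiable (by norm_num)
  set f : EuclideanSpace ℝ (Fin n) → ℝ := {y | A < |u y|}.indicator (fun y => ‖fderiv ℝ u y‖) with hf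
  have hfm : Measurable f :=
    hfc.norm.measurable.indicator (measurableSet_lt measurable_const hu.continuous.abs.measurable)
  have hG : Measurable (fun z => ENNReal.ofReal (f (x + z))) :=
    (hfm.comp (measurable_const_add x)).ennreal_ofReal
  have e1 : ∫⁻ y, ENNReal.ofReal (f y) * kern n (y - x) =
      ∫⁻ z, ENNReal.ofReal (f (x + z)) * kern n z := by
    rw [← lintegral_add_left_eq_self _ x]
    simp
  rw [e1, polar_kern _ hn hG, mul_comm, ENNReal.ofReal_mul (by linarith), ← toSphere_univ,
    ← lintegral_const]
  apply lintegral_mono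
  intro θ
  have hθ : ‖(θ : EuclideanSpace ℝ (Fin n))‖ = 1 := by simpa using θ.2
  obtain ⟨R, hR⟩ := hs.isCompact.isBounded.subset_closedBall x
  have hg : ∀ r : ℝ, HasDerivAt (fun r : ℝ => u (x + r • (θ : EuclideanSpace ℝ (Fin n))))
      (fderiv ℝ u (x + r • (θ : EuclideanSpace ℝ (Fin n))) θ) r := by
    intro r
    have h1 : HasDerivAt (fun r : ℝ => x + r • (θ : EuclideanSpace ℝ (Fin n))) (θ : EuclideanSpace ℝ (Fin n)) r := by
      simpa using ((hasDerivAt_id r).smul_const (θ : EuclideanSpace ℝ (Fin n))).const_add x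
    exact (hdiff _).hasFDerivAt.comp_hasDerivAt r h1
  have hray := ray (A := A) (R := |R| + 1) hg (by fun_prop) (by positivity) (by
      by_contra hne
      have hmem := hR (subset_tsupport _ (Function.mem_support.2 hne))
      rw [Metric.mem_closedBall, dist_eq_norm] at hmem
      simp only [add_sub_cancel_left, norm_smul, hθ, mul_one, Real.norm_eq_abs] at hmem
      rw [abs_of_nonneg (by positivity)] at hmem
      linarith [le_abs_self R]) hA (by simpa using hx)
  simp only [zero_smul, add_zero] at hray
  refine hray.trans ?_
  apply lintegral_mono
  intro r
  by_cases hr : A < |u (x + r • (θ : EuclideanSpace ℝ (Fin n)))|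
  · simp only [hf, Set.indicator, Set.mem_ofPred_eq, hr, if_true]
    apply ENNReal.ofReal_le_ofReal
    have := (fderiv ℝ u (x + r • (θ : EuclideanSpace ℝ (Fin n)))).le_opNorm (θ : EuclideanSpace ℝ (Fin n))
    rw [hθ, mul_one] at this
    exact this
  · simp [Set.indicator, hr]

end RMT


namespace RMT

lemma expRem_le_exp (m : ℕ) {t : ℝ} (ht : 0 ≤ t) : expRem m t ≤ exp t := by
  rw [expRem]
  have : 0 ≤ ∑ k ∈ Finset.range (m + 1), t ^ k / (Nat.factorial k) :=
    Finset.sum_nonneg fun k _ => by positivity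
  linarith

lemma expRem_le_pow (m : ℕ) {t : ℝ} (ht : 0 ≤ t) : expRem m t ≤ t ^ (m + 1) * exp t := by
  have hs : HasSum (fun k : ℕ => t ^ k / (Nat.factorial k : ℝ)) (exp t) := by
    rw [Real.exp_eq_exp_ℝ]
    exact NormedSpace.expSeries_div_hasSum_exp t
  have h1 := hs.summable.sum_add_tsum_nat_add (m + 1)
  rw [hs.tsum_eq] at h1
  have h2 : expRem m t = ∑' k : ℕ, t ^ (k + (m + 1)) / (Nat.factorial (k + (m + 1)) : ℝ) := by
    rw [expRem]; linarith
  have h3 : HasSum (fun k : ℕ => t ^ (m + 1) * (t ^ k / (Nat.factorial k : ℝ))) (t ^ (m + 1) * exp t) :=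
    hs.mul_left _
  rw [h2, ← h3.tsum_eq]
  refine Summable.tsum_le_tsum (fun k => ?_) ((summable_nat_add_iff (m + 1)).2 hs.summable) h3.summable
  rw [pow_add, mul_comm (t ^ k), mul_div_assoc]
  gcongr
  omega

lemma gamma_eq {n : ℕ} (hn : 2 ≤ n) {v : ℝ} (hv : 0 ≤ v) :
    gammaMT n * v ^ ((n : ℝ) / ((n : ℝ) - 1)) =
      (n * bet n ^ (1 / (n : ℝ)) * v) ^ ((n : ℝ) / ((n : ℝ) - 1)) := by
  have hb := bet_pos n
  have hn0 : (0 : ℝ) < n := by positivity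
  have hn1 : (0 : ℝ) < (n : ℝ) - 1 := by
    have : (2 : ℝ) ≤ n := by exact_mod_cast hn
    linarith
  have e1 : gammaMT n = n * (n * bet n) ^ ((1 : ℝ) / ((n : ℝ) - 1)) := rfl
  rw [e1, Real.mul_rpow (by positivity) hv, Real.mul_rpow (by positivity) (by positivity),
    Real.mul_rpow hn0.le (Real.rpow_nonneg hb.le _), ← Real.rpow_mul hb.le]
  have e2 : 1 / (n : ℝ) * ((n : ℝ) / ((n : ℝ) - 1)) = 1 / ((n : ℝ) - 1) := by field_simp
  have e3 : (n : ℝ) / ((n : ℝ) - 1) = 1 + 1 / ((n : ℝ) - 1) := by field_simp; ring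
  rw [e2]
  have e4 : (n : ℝ) ^ ((n : ℝ) / ((n : ℝ) - 1)) = n * (n : ℝ) ^ (1 / ((n : ℝ) - 1)) := by
    rw [e3, Real.rpow_add hn0, Real.rpow_one]
  rw [e4]; ring

lemma gamma_pos {n : ℕ} (hn : 2 ≤ n) : 0 < gammaMT n := by
  have hb := bet_pos n
  have hn0 : (0 : ℝ) < n := by positivity
  have e1 : gammaMT n = n * (n * bet n) ^ ((1 : ℝ) / ((n : ℝ) - 1)) := rfl
  rw [e1]; positivity

end RMT

open RMT

/-- The Ruf-Moser-Trudinger inequality (RMT) holds on `ℝⁿ`. -/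
theorem ruf_moser_trudinger (n : ℕ) (hn : 2 ≤ n) (κ : ℝ) (hκ : 0 < κ) :
    ∃ C > (0 : ℝ), ∀ u : EuclideanSpace ℝ (Fin n) → ℝ,
      ContDiff ℝ (⊤ : ℕ∞) u → HasCompactSupport u →
      (∫ x, ‖fderiv ℝ u x‖ ^ n) + κ * (∫ x, |u x| ^ n) ≤ 1 →
      ∫⁻ x,
          ENNReal.ofReal (expRem (n - 2) (gammaMT n * |u x| ^ ((n : ℝ) / ((n : ℝ) - 1))))
        ≤ ENNReal.ofReal C := by
  have hqp := holder_n hn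
  obtain ⟨C0, hC0, hadams⟩ := adams hn hqp
  have hγ := gamma_pos hn
  have hb := bet_pos n
  have hn0 : (0 : ℝ) < n := by positivity
  have hnn : n ≠ 0 := by omega
  have hn1 : (0 : ℝ) < (n : ℝ) - 1 := by
    have : (2 : ℝ) ≤ n := by exact_mod_cast hn
    linarith
  have hg := @gamma_eq n hn
  set p : ℝ := (n : ℝ) / ((n : ℝ) - 1) with hp
  have hp0 : 0 < p := hqp.symm.pos
  set γ := gammaMT n with hγdef
  set K : ℝ := (2 / κ) ^ (1 / (n : ℝ)) with hK
  have hK0 : 0 ≤ K := by positivity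
  set L : ℝ := (1 / κ) ^ (1 / (n : ℝ)) with hL
  have hL0 : 0 ≤ L := by positivity
  refine ⟨exp (γ * K ^ p) * C0 + γ ^ (n - 1) * exp (γ * L ^ p) * (1 / κ), by positivity, ?_⟩
  intro u hu hsupp hle
  have hu1 : ContDiff ℝ 1 u := hu.of_le (by exact_mod_cast le_top)
  have huc : Continuous u := hu1.continuous
  have hfc : Continuous (fderiv ℝ u) := hu1.continuous_fderiv one_ne_zero
  have hfs : HasCompactSupport (fderiv ℝ u) := hsupp.fderiv (𝕜 := ℝ)
  have hIu : Integrable (fun x => |u x| ^ n) := by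
    apply (huc.abs.pow n).integrable_of_hasCompactSupport
    exact hsupp.comp_left (g := fun t : ℝ => |t| ^ n) (by simp [hnn])
  have hID : Integrable (fun x => ‖fderiv ℝ u x‖ ^ n) := by
    apply (hfc.norm.pow n).integrable_of_hasCompactSupport
    exact hfs.comp_left (g := fun t => ‖t‖ ^ n) (by simp [hnn])
  have hlU : ∫⁻ x, ENNReal.ofReal (|u x| ^ n) = ENNReal.ofReal (∫ x, |u x| ^ n) :=
    (ofReal_integral_eq_lintegral_ofReal hIu (Filter.Eventually.of_forall fun x => by positivity)).symm
  have hlD : ∫⁻ x, ENNReal.ofReal (‖fderiv ℝ u x‖ ^ n) = ENNReal.ofReal (∫ x, ‖fderiv ℝ u x‖ ^ n) :=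
    (ofReal_integral_eq_lintegral_ofReal hID (Filter.Eventually.of_forall fun x => by positivity)).symm
  have hU0 : 0 ≤ ∫ x, |u x| ^ n := integral_nonneg fun x => by positivity
  have hD0 : 0 ≤ ∫ x, ‖fderiv ℝ u x‖ ^ n := integral_nonneg fun x => by positivity
  set U := ∫ x, |u x| ^ n with hU
  set D := ∫ x, ‖fderiv ℝ u x‖ ^ n with hD
  set A : ℝ := U ^ (1 / (n : ℝ)) with hA
  have hA0 : 0 ≤ A := by positivity
  have hκU : κ * U ≤ 1 := by linarith
  have hUκ : U ≤ 1 / κ := by rw [le_div_iff₀ hκ]; linarith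
  set s : ℝ := (1 - κ * U / 2) ^ (1 / (n : ℝ)) with hs
  set r : ℝ := (κ * U / 2) ^ (1 / (n : ℝ)) with hr
  have hs0 : 0 < s := Real.rpow_pos_of_pos (by linarith) _
  have hr0 : 0 ≤ r := by positivity
  have hsn : s ^ (n : ℝ) = 1 - κ * U / 2 := rpow_inv_rpow' (by linarith) hn0
  have hrn : r ^ (n : ℝ) = κ * U / 2 := rpow_inv_rpow' (by positivity) hn0
  have hAn : A ^ n = U := by rw [← Real.rpow_natCast]; exact rpow_inv_rpow' hU0 hn0
  have hrK : r * K = A := by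
    rw [hr, hK, ← Real.mul_rpow (by positivity) (by positivity), hA]
    congr 1; field_simp
  have hAL : A ≤ L := Real.rpow_le_rpow hU0 hUκ (by positivity)
  set Ω : Set (EuclideanSpace ℝ (Fin n)) := {y | A < |u y|} with hΩdef
  have hΩ : MeasurableSet Ω := measurableSet_lt measurable_const huc.abs.measurable
  have hΩ1 : volume Ω ≤ 1 := by
    rcases hU0.eq_or_lt with h0 | h0
    · rw [← h0, ENNReal.ofReal_zero, lintegral_eq_zero_iff (by fun_prop)] at hlU
      have : volume Ω = 0 := by
        refine measure_mono_null ?_ hlU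
        intro x hx
        have hx : A < |u x| := hx
        have hne : u x ≠ 0 := abs_pos.1 (hA0.trans_lt hx)
        simp [hne]
      rw [this]; exact zero_le_one
    · have h1 := mul_meas_ge_le_lintegral (μ := volume)
        (f := fun x => ENNReal.ofReal (|u x| ^ n)) (by fun_prop) (ENNReal.ofReal U)
      rw [hlU] at h1
      have h2 : volume Ω ≤ volume {x | ENNReal.ofReal U ≤ ENNReal.ofReal (|u x| ^ n)} := by
        apply measure_mono
        intro x hx
        have hx : A < |u x| := hx
        apply ENNReal.ofReal_le_ofReal
        rw [← hAn]
        gcongr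
      refine h2.trans ?_
      rw [← ENNReal.mul_le_mul_iff_right (a := ENNReal.ofReal U) (by simpa using h0) ENNReal.ofReal_ne_top,
        mul_one]
      exact h1
  obtain ⟨M, hM⟩ := hfs.exists_bound_of_continuous hfc
  have hM0 : 0 ≤ M := (norm_nonneg _).trans (hM 0)
  set f : EuclideanSpace ℝ (Fin n) → ℝ := Ω.indicator (fun y => ‖fderiv ℝ u y‖) with hf
  have hfm : Measurable f := hfc.norm.measurable.indicator hΩ
  have hf0 : ∀ y, 0 ≤ f y := fun y => Set.indicator_nonneg (fun _ _ => norm_nonneg _) y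
  have hfle : ∀ y, f y ≤ ‖fderiv ℝ u y‖ := fun y =>
    Set.indicator_le_self' (fun _ _ => norm_nonneg _) y
  set W : EuclideanSpace ℝ (Fin n) → ℝ := fun x => n * bet n ^ (1 / (n : ℝ)) * ((|u x| - A) / s) with hW
  have hmain := hadams (fun y => f y / s) (M / s) Ω W (hfm.div_const s)
    (fun y => div_nonneg (hf0 y) hs0.le)
    (fun y => by
      have := (hfle y).trans (hM y)
      gcongr)
    (by
      intro c hc
      refine le_trans (measure_mono ?_) hΩ1
      intro y hy
      have hy : c < f y / s := hy
      by_contra hcon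
      rw [hf, Set.indicator_of_notMem hcon, zero_div] at hy
      linarith)
    (by
      calc ∫⁻ y, ENNReal.ofReal ((f y / s) ^ (n : ℝ))
          ≤ ∫⁻ y, ENNReal.ofReal (1 / s ^ (n : ℝ)) * ENNReal.ofReal (‖fderiv ℝ u y‖ ^ n) := by
            apply lintegral_mono
            intro y
            beta_reduce
            rw [← ENNReal.ofReal_mul (by positivity)]
            apply ENNReal.ofReal_le_ofReal
            rw [Real.div_rpow (hf0 y) hs0.le, div_eq_mul_one_div, mul_comm]
            rw [Real.rpow_natCast (f y)]
            have h1 := hf0 y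
            have h2 := hfle y
            gcongr
        _ = ENNReal.ofReal (1 / s ^ (n : ℝ)) * ENNReal.ofReal D := by
            rw [lintegral_const_mul _ (by fun_prop), hlD]
        _ ≤ 1 := by
            rw [← ENNReal.ofReal_mul (by positivity), ← ENNReal.ofReal_one]
            apply ENNReal.ofReal_le_ofReal
            rw [hsn, one_div_mul_eq_div, div_le_one (by linarith)]
            have : 0 ≤ κ * U := by positivity
            linarith)
    hΩ hΩ1 (by fun_prop)
    (by
      intro x hx
      have hx : A < |u x| := hx
      have : 0 ≤ |u x| - A := by linarith
      positivity)
    (by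
      intro x hx
      have hx : A < |u x| := hx
      have h1 := riesz hn hu1 hsupp hA0 x hx
      have e1 : bet n ^ (1 / p) * W x = (1 / s) * (n * bet n * (|u x| - A)) := by
        have : bet n ^ (1 / p) * bet n ^ (1 / (n : ℝ)) = bet n := by
          rw [← Real.rpow_add hb, one_div, one_div, add_comm, hqp.inv_add_inv_eq_one, Real.rpow_one]
        rw [hW]
        calc _ = (bet n ^ (1 / p) * bet n ^ (1 / (n : ℝ))) * n * ((|u x| - A) / s) := by ring
          _ = _ := by rw [this]; ring
      rw [e1, ENNReal.ofReal_mul (by positivity)]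
      calc _ ≤ ENNReal.ofReal (1 / s) * ∫⁻ y, ENNReal.ofReal (f y) * kern n (y - x) :=
            mul_le_mul_right h1 _
        _ = _ := by
            rw [← lintegral_const_mul]
            · apply lintegral_congr
              intro y
              rw [← mul_assoc, ← ENNReal.ofReal_mul (by positivity)]
              congr 2; ring
            · exact hfm.ennreal_ofReal.mul ((measurable_kern n).comp (by fun_prop)))
  have hpt : ∀ x ∈ Ω, γ * |u x| ^ p ≤ W x ^ p + γ * K ^ p := by
    intro x hx
    have hx : A < |u x| := hx
    set v : ℝ := (|u x| - A) / s with hv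
    have hv0 : 0 ≤ v := div_nonneg (by linarith) hs0.le
    have h1 := holder_two hqp hs0.le hr0 hv0 hK0
    rw [hsn, hrn, hrK, hv, mul_div_cancel₀ _ hs0.ne'] at h1
    rw [sub_add_cancel, sub_add_cancel, Real.one_rpow, one_mul] at h1
    have h2 := Real.rpow_le_rpow (abs_nonneg (u x)) h1 hp0.le
    rw [rpow_inv_rpow' (by positivity) hp0] at h2
    have h3 : W x ^ p = γ * v ^ p := (hg hv0).symm
    rw [h3, ← mul_add]
    gcongr
  have hX : ∫⁻ x in Ω, ENNReal.ofReal (expRem (n - 2) (γ * |u x| ^ p)) ≤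
      ENNReal.ofReal (exp (γ * K ^ p) * C0) := by
    calc _ ≤ ∫⁻ x in Ω, ENNReal.ofReal (exp (γ * K ^ p)) * ENNReal.ofReal (exp (W x ^ p)) := by
          apply setLIntegral_mono' hΩ
          intro x hx
          rw [← ENNReal.ofReal_mul (by positivity), ← Real.exp_add]
          apply ENNReal.ofReal_le_ofReal
          refine (expRem_le_exp _ (by positivity)).trans (Real.exp_le_exp.2 ?_)
          have := hpt x hx
          linarith
      _ = ENNReal.ofReal (exp (γ * K ^ p)) * ∫⁻ x in Ω, ENNReal.ofReal (exp (W x ^ p)) :=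
          lintegral_const_mul' _ _ ENNReal.ofReal_ne_top
      _ ≤ _ := by
          rw [ENNReal.ofReal_mul (by positivity)]
          exact mul_le_mul_right hmain _
  have hY : ∫⁻ x in Ωᶜ, ENNReal.ofReal (expRem (n - 2) (γ * |u x| ^ p)) ≤
      ENNReal.ofReal (γ ^ (n - 1) * exp (γ * L ^ p) * (1 / κ)) := by
    calc _ ≤ ∫⁻ x in Ωᶜ, ENNReal.ofReal (γ ^ (n - 1) * exp (γ * L ^ p)) * ENNReal.ofReal (|u x| ^ n) := by
          apply setLIntegral_mono' hΩ.compl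
          intro x hx
          have hx : |u x| ≤ A := not_lt.1 hx
          rw [← ENNReal.ofReal_mul (by positivity)]
          apply ENNReal.ofReal_le_ofReal
          refine (expRem_le_pow _ (by positivity)).trans ?_
          have e1 : (|u x| ^ p) ^ (n - 1) = |u x| ^ n := by
            rw [← Real.rpow_natCast, ← Real.rpow_mul (abs_nonneg _), ← Real.rpow_natCast _ n]
            congr 1
            rw [Nat.cast_sub (by omega), Nat.cast_one, hp]
            field_simp
          rw [show n - 2 + 1 = n - 1 by omega, mul_pow, e1]
          have h2 : |u x| ≤ L := hx.trans hAL
          calc _ ≤ γ ^ (n - 1) * |u x| ^ n * exp (γ * L ^ p) := by gcongr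
            _ = _ := by ring
      _ ≤ ∫⁻ x, ENNReal.ofReal (γ ^ (n - 1) * exp (γ * L ^ p)) * ENNReal.ofReal (|u x| ^ n) :=
          setLIntegral_le_lintegral _ _
      _ = ENNReal.ofReal (γ ^ (n - 1) * exp (γ * L ^ p)) * ENNReal.ofReal U := by
          rw [lintegral_const_mul' _ _ ENNReal.ofReal_ne_top, hlU]
      _ ≤ _ := by
          rw [ENNReal.ofReal_mul (p := γ ^ (n - 1) * exp (γ * L ^ p)) (by positivity)]
          exact mul_le_mul_right (ENNReal.ofReal_le_ofReal hUκ) _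
  rw [← lintegral_add_compl _ hΩ, ENNReal.ofReal_add (by positivity) (by positivity)]
  exact add_le_add hX hY
end
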